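/- arXiv:1410.6708 — 10 statements merged into one kernel-verified Lean document; each statement's English description precedes it below -/
import Mathlib

section
/- Let d ≥ 1, let Λ = ℤ^d, let k ≥ 1, and let A be a commutative ring in which k! is a unit. For additive group homomorphisms φ₁,…,φ_k : Λ → A, consider the two degree-k inhomogeneous cochains c_prod(λ₁,…,λ_k) = φ₁(λ₁)⋯φ_k(λ_k) and c_alt(λ₁,…,λ_k) = (k!)⁻¹ Σ_{σ ∈ S_k} sgn(σ) φ₁(λ_{σ(1)})⋯φ_k(λ_{σ(k)}) of Λ with values in A (trivial action). Then both c_prod and c_alt are cocycles, and they are cohomologous: there exists b ∈ C^{k−1}(Λ,A) with c_prod − c_alt = d^{k−1} b. -/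
/-- The inhomogeneous cochain differential for an abelian group `Λ` acting trivially on
an abelian group `A`. -/
def dCochain {Λ A : Type*} [AddCommGroup Λ] [AddCommGroup A] (k : ℕ)
    (f : (Fin k → Λ) → A) : (Fin (k + 1) → Λ) → A :=
  fun g =>
    f (fun i => g i.succ) +
      ∑ j : Fin (k + 1), ((-1 : ℤ) ^ ((j : ℕ) + 1)) • f (Fin.contractNth j (· + ·) g)

/-- The cochain `c_prod(λ₁,…,λ_k) = φ₁(λ₁)⋯φ_k(λ_k)`. -/
def cProd {Λ A : Type*} [AddCommGroup Λ] [CommRing A] {k : ℕ}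
    (φ : Fin k → (Λ →+ A)) : (Fin k → Λ) → A :=
  fun g => ∏ i : Fin k, φ i (g i)

/-- The cochain `c_alt(λ₁,…,λ_k) = (k!)⁻¹ ∑_{σ ∈ S_k} sgn σ · φ₁(λ_{σ1})⋯φ_k(λ_{σk})`. -/
noncomputable def cAlt {Λ A : Type*} [AddCommGroup Λ] [CommRing A] {k : ℕ}
    (φ : Fin k → (Λ →+ A)) : (Fin k → Λ) → A :=
  fun g =>
    Ring.inverse ((k.factorial : ℕ) : A) *
      ∑ σ : Equiv.Perm (Fin k),
        ((Equiv.Perm.sign σ : ℤ)) • ∏ i : Fin k, φ i (g (σ i))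

section Helpers
variable {Λ A : Type*} [AddCommGroup Λ] [CommRing A]

lemma dC_add (k : ℕ) (f f' : (Fin k → Λ) → A) (g : Fin (k+1) → Λ) :
    dCochain k (fun x => f x + f' x) g = dCochain k f g + dCochain k f' g := by
  simp only [dCochain, smul_add, Finset.sum_add_distrib]
  abel

lemma dC_mul (k : ℕ) (a : A) (f : (Fin k → Λ) → A) (g : Fin (k+1) → Λ) :
    dCochain k (fun x => a * f x) g = a * dCochain k f g := by
  simp only [dCochain, mul_add, Finset.mul_sum, mul_smul_comm]

lemma dC_zero (k : ℕ) (g : Fin (k+1) → Λ) :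
    dCochain k (fun _ => (0 : A)) g = 0 := by
  simp [dCochain]

lemma contract_tail (k : ℕ) (j : Fin (k+1)) (g : Fin (k+2) → Λ) (i : Fin k) :
    Fin.contractNth j.succ (· + ·) g i.succ =
      Fin.contractNth j (· + ·) (fun i => g i.succ) i := by
  simp only [Fin.contractNth, Fin.val_succ, add_lt_add_iff_right, add_left_inj]
  rfl

lemma dC_cons (k : ℕ) (u : Λ → A) (f : (Fin k → Λ) → A) (g : Fin (k+2) → Λ) :
    dCochain (k+1) (fun x => u (x 0) * f (fun i => x i.succ)) g =
      (u (g 1) - u (g 0 + g 1) + u (g 0)) * f (fun i => g i.succ.succ)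
      - u (g 0) * dCochain k f (fun i => g i.succ) := by
  simp only [dCochain]
  rw [Fin.sum_univ_succ]
  have h0 : (Fin.contractNth (0 : Fin (k+2)) (· + ·) g) 0 = g 0 + g 1 := by
    simp [Fin.contractNth]
  have h1 : ∀ i : Fin k, (Fin.contractNth (0 : Fin (k+2)) (· + ·) g) i.succ = g i.succ.succ := by
    intro i
    simp [Fin.contractNth]
  have h2 : ∀ j : Fin (k+1), (Fin.contractNth j.succ (· + ·) g) 0 = g 0 := by
    intro i
    simp [Fin.contractNth]
  simp only [h0, h1, h2, contract_tail, Fin.val_succ, pow_succ _ (_ + 1), mul_neg, mul_one,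
    neg_smul, Finset.sum_neg_distrib, mul_add, Finset.mul_sum, mul_smul_comm]
  simp
  ring

lemma cProd_cons {k : ℕ} (φ : Fin (k+1) → (Λ →+ A)) :
    cProd φ = fun x => φ 0 (x 0) * cProd (fun i => φ i.succ) (fun i => x i.succ) := by
  funext x
  simp [cProd, Fin.prod_univ_succ]

lemma dC_cProd (k : ℕ) (φ : Fin k → (Λ →+ A)) (g : Fin (k+1) → Λ) :
    dCochain k (cProd φ) g = 0 := by
  induction k with
  | zero => simp [dCochain, cProd]
  | succ k ih =>
    rw [cProd_cons, dC_cons k (fun x => φ 0 x) (cProd fun i => φ i.succ), ih]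
    simp

def IsCob {m : ℕ} (f : (Fin (m+1) → Λ) → A) : Prop := ∃ b, ∀ g, f g = dCochain m b g

lemma IsCob.add {m : ℕ} {f f' : (Fin (m+1) → Λ) → A} (h : IsCob f) (h' : IsCob f') :
    IsCob (fun g => f g + f' g) := by
  obtain ⟨b, hb⟩ := h
  obtain ⟨b', hb'⟩ := h'
  exact ⟨fun x => b x + b' x, fun g => by simp only [dC_add, hb, hb']⟩

lemma IsCob.mul {m : ℕ} {f : (Fin (m+1) → Λ) → A} (a : A) (h : IsCob f) :
    IsCob (fun g => a * f g) := by
  obtain ⟨b, hb⟩ := h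
  exact ⟨fun x => a * b x, fun g => by simp only [dC_mul, hb]⟩

lemma IsCob.zero {m : ℕ} : IsCob (fun _ : Fin (m+1) → Λ => (0 : A)) :=
  ⟨fun _ => 0, fun g => by rw [dC_zero]⟩

lemma IsCob.sum {m : ℕ} {ι : Type*} (s : Finset ι) (f : ι → (Fin (m+1) → Λ) → A)
    (h : ∀ i, IsCob (f i)) : IsCob (fun g => ∑ i ∈ s, f i g) := by
  classical
  induction s using Finset.induction_on with
  | empty => simpa using IsCob.zero
  | insert a s ha ih =>
    simp only [Finset.sum_insert ha]
    exact (h a).add ih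

lemma cob_swap (m : ℕ) (i : Fin m) (φ : Fin (m+1) → (Λ →+ A)) :
    IsCob (fun g => cProd φ g + cProd (fun j => φ (Equiv.swap i.castSucc i.succ j)) g) := by
  induction m with
  | zero => exact i.elim0
  | succ m ih =>
    refine Fin.cases ?_ (fun i => ?_) i
    · refine ⟨fun x => (fun y => -(φ 0 y * φ 1 y)) (x 0) *
        cProd (fun i => φ i.succ.succ) (fun i => x i.succ), fun g => ?_⟩
      rw [dC_cons _ (fun y => -(φ 0 y * φ 1 y)) (cProd (fun i => φ i.succ.succ)), dC_cProd]
      have hs : ∀ j : Fin m, Equiv.swap (0 : Fin (m+2)) 1 j.succ.succ = j.succ.succ := by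
        intro j
        apply Equiv.swap_apply_of_ne_of_ne
        · exact Fin.succ_ne_zero _
        · intro h
          exact Fin.succ_ne_zero j (Fin.succ_injective _ h)
      simp [cProd, Fin.prod_univ_succ, hs]
      ring
    · obtain ⟨b, hb⟩ := ih i (fun j => φ j.succ)
      refine ⟨fun x => (fun y => - φ 0 y) (x 0) * b (fun i => x i.succ), fun g => ?_⟩
      rw [dC_cons _ (fun y => - φ 0 y) b, ← hb, cProd_cons φ, cProd_cons (fun j => φ (Equiv.swap i.succ.castSucc i.succ.succ j))]
      have h0 : Equiv.swap i.succ.castSucc i.succ.succ 0 = 0 := by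
        apply Equiv.swap_apply_of_ne_of_ne
        · rw [← Fin.succ_castSucc]; exact (Fin.succ_ne_zero _).symm
        · exact (Fin.succ_ne_zero _).symm
      have hs : ∀ j : Fin (m+1), Equiv.swap i.succ.castSucc i.succ.succ j.succ =
          (Equiv.swap i.castSucc i.succ j).succ := by
        intro j
        rw [← Fin.succ_castSucc]
        exact ((Fin.succ_injective _).map_swap _ _ _).symm
      simp only [h0, hs, map_add]
      ring

lemma cob_perm (m : ℕ) (σ : Equiv.Perm (Fin (m+1))) : ∀ (φ : Fin (m+1) → (Λ →+ A)),
    IsCob (fun g => cProd φ g - ((Equiv.Perm.sign σ : ℤ) : A) * cProd (fun j => φ (σ j)) g) := by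
  have hσ : σ ∈ Submonoid.closure
      (Set.range fun i : Fin m => Equiv.swap i.castSucc i.succ) := by
    rw [Equiv.Perm.mclosure_swap_castSucc_succ]; trivial
  induction hσ using Submonoid.closure_induction with
  | mem x hx =>
    obtain ⟨i, rfl⟩ := hx
    intro φ
    have h := cob_swap m i φ
    rw [Equiv.Perm.sign_swap (Fin.castSucc_lt_succ).ne]
    simpa using h
  | one => intro φ; simpa using IsCob.zero
  | mul x y _ _ hx hy =>
    intro φ
    have h := (hx φ).add ((hy (fun j => φ (x j))).mul ((Equiv.Perm.sign x : ℤ) : A))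
    convert h using 2
    simp
    ring

lemma cAlt_eq {k : ℕ} (φ : Fin k → (Λ →+ A)) (g : Fin k → Λ) : cAlt φ g =
    Ring.inverse ((k.factorial : ℕ) : A) * ∑ σ : Equiv.Perm (Fin k),
      ((Equiv.Perm.sign σ : ℤ) : A) * cProd (fun j => φ (σ j)) g := by
  unfold cAlt
  congr 1
  refine Fintype.sum_equiv (Equiv.inv _) _ _ fun σ => ?_
  simp only [zsmul_eq_mul, cProd, Equiv.inv_apply, Equiv.Perm.sign_inv]
  congr 1
  refine Fintype.prod_equiv σ _ _ fun i => ?_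
  simp

lemma dC_sum (k : ℕ) {ι : Type*} (s : Finset ι) (f : ι → (Fin k → Λ) → A) (g : Fin (k+1) → Λ) :
    dCochain k (fun x => ∑ i ∈ s, f i x) g = ∑ i ∈ s, dCochain k (f i) g := by
  classical
  induction s using Finset.induction_on with
  | empty => simpa using dC_zero k g
  | insert a s ha ih =>
    simp only [Finset.sum_insert ha]
    rw [dC_add, ih]

lemma dC_cAlt (k : ℕ) (φ : Fin k → (Λ →+ A)) (g : Fin (k+1) → Λ) :
    dCochain k (cAlt φ) g = 0 := by
  have : cAlt φ = _ := funext (cAlt_eq φ)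
  rw [this, dC_mul, dC_sum]
  simp [dC_mul, dC_cProd]

lemma cob_main (m : ℕ) (hu : IsUnit (((m + 1).factorial : ℕ) : A))
    (φ : Fin (m + 1) → (Λ →+ A)) : IsCob (fun g => cProd φ g - cAlt φ g) := by
  have h := (IsCob.sum Finset.univ _ (fun σ => cob_perm m σ φ)).mul
    (Ring.inverse (((m+1).factorial : ℕ) : A))
  convert h using 2 with g
  rw [cAlt_eq, Finset.sum_sub_distrib, mul_sub]
  congr 1
  rw [Finset.sum_const, Finset.card_univ, Fintype.card_perm, Fintype.card_fin, nsmul_eq_mul,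
    ← mul_assoc, Ring.inverse_mul_cancel _ hu, one_mul]

end Helpers

/-- for `Λ = ℤ^d` (`d ≥ 1`), `k = m + 1 ≥ 1`, and a commutative ring `A` in which
`k!` is a unit, the cochains `c_prod` and `c_alt` attached to additive homomorphisms
`φ₁,…,φ_k : Λ → A` are both cocycles, and they are cohomologous. -/
theorem cProd_cAlt_cocycles_and_cohomologous (d m : ℕ) (hd : 1 ≤ d) (A : Type*) [CommRing A]
    (hu : IsUnit (((m + 1).factorial : ℕ) : A))
    (φ : Fin (m + 1) → ((Fin d → ℤ) →+ A)) :
    (∀ g : Fin (m + 1 + 1) → (Fin d → ℤ), dCochain (m + 1) (cProd φ) g = 0) ∧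
    (∀ g : Fin (m + 1 + 1) → (Fin d → ℤ), dCochain (m + 1) (cAlt φ) g = 0) ∧
    (∃ b : (Fin m → (Fin d → ℤ)) → A,
      ∀ g : Fin (m + 1) → (Fin d → ℤ), cProd φ g - cAlt φ g = dCochain m b g) := by
  exact ⟨dC_cProd _ φ, dC_cAlt _ φ, cob_main m hu φ⟩
end

section
/- Let d ≥ 1, let Λ = ℤ^d, let n ≥ 1, and let A be a commutative ring in which n! is a unit. The A-linear map from the n-th exterior power (over A) of the A-module Hom_ℤ(Λ, A) of additive homomorphisms Λ → A to the group cohomology H^n(Λ, A) (trivial Λ-action on A), determined by the alternating map sending (φ₁,…,φ_n) to the cohomology class of the cocycle (λ₁,…,λ_n) ↦ (n!)⁻¹ Σ_{σ ∈ S_n} sgn(σ) φ₁(λ_{σ(1)})⋯φ_n(λ_{σ(n)}), is an isomorphism of A-modules. -/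
/-- The inhomogeneous cochain differential (trivial action) as an `A`-linear map
`C^n(Λ, A) → C^{n+1}(Λ, A)`. -/
noncomputable def dLin (Λ : Type*) [AddCommGroup Λ] (A : Type*) [CommRing A] (n : ℕ) :
    ((Fin n → Λ) → A) →ₗ[A] ((Fin (n + 1) → Λ) → A) where
  toFun f := fun g =>
    f (fun i => g i.succ) +
      ∑ j : Fin (n + 1), ((-1 : ℤ) ^ ((j : ℕ) + 1)) • f (Fin.contractNth j (· + ·) g)
  map_add' f₁ f₂ := by
    funext g
    simp only [Pi.add_apply, smul_add, Finset.sum_add_distrib]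
    abel
  map_smul' a f := by
    funext g
    simp only [Pi.smul_apply, RingHom.id_apply, smul_comm a, Finset.smul_sum, smul_add]

/-- The `n`-th group cohomology of `Λ` with coefficients in `A` (trivial action), for `n ≥ 1`,
realized as cocycles modulo coboundaries of the inhomogeneous cochain complex;
here `n = m + 1`. -/
noncomputable abbrev cohomologyOfAbelian (Λ : Type*) [AddCommGroup Λ] (A : Type*) [CommRing A]
    (m : ℕ) :=
  LinearMap.ker (dLin Λ A (m + 1)) ⧸
    (Submodule.comap (LinearMap.ker (dLin Λ A (m + 1))).subtype
      (LinearMap.range (dLin Λ A m)))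


namespace ExtCoh
variable {G : Type*} [AddCommGroup G] {A : Type*} [CommRing A]

/-- differential with coefficients in functions `G → A` -/
noncomputable def D (n : ℕ) : ((Fin n → G) → G → A) →ₗ[A] ((Fin (n + 1) → G) → G → A) where
  toFun f := fun g x =>
    f (fun i => g i.succ) (x + g 0) +
      ∑ j : Fin (n + 1), ((-1 : ℤ) ^ ((j : ℕ) + 1)) • f (Fin.contractNth j (· + ·) g) x
  map_add' f₁ f₂ := by
    funext g x
    simp only [Pi.add_apply, smul_add, Finset.sum_add_distrib]
    abel
  map_smul' a f := by
    funext g x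
    simp only [Pi.smul_apply, RingHom.id_apply, smul_comm a, Finset.smul_sum, smul_add]

theorem D_apply (n : ℕ) (f : (Fin n → G) → G → A) (g : Fin (n+1) → G) (x : G) :
    D n f g x = f (fun i => g i.succ) (x + g 0) +
      ∑ j : Fin (n + 1), ((-1 : ℤ) ^ ((j : ℕ) + 1)) • f (Fin.contractNth j (· + ·) g) x := rfl

def sh (n : ℕ) (t : G) : ((Fin n → G) → G → A) →ₗ[A] ((Fin n → G) → G → A) where
  toFun f := fun g x => f g (x + t)
  map_add' _ _ := rfl
  map_smul' _ _ := rfl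

theorem sh_apply (n : ℕ) (t : G) (f : (Fin n → G) → G → A) (g x) : sh n t f g x = f g (x + t) := rfl

theorem D_sh (n : ℕ) (t : G) (f : (Fin n → G) → G → A) : D n (sh n t f) = sh (n+1) t (D n f) := by
  funext g x
  simp only [D_apply, sh_apply, add_right_comm x t]

def ht (n : ℕ) : ((Fin (n+1) → G) → G → A) →ₗ[A] ((Fin n → G) → G → A) where
  toFun f := fun g x => f (Fin.cons x g) 0
  map_add' _ _ := rfl
  map_smul' _ _ := rfl

theorem ht_apply (n : ℕ) (f : (Fin (n+1) → G) → G → A) (g x) :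
    ht n f g x = f (Fin.cons x g) 0 := rfl

theorem contract_zero (n : ℕ) (x : G) (g : Fin (n+1) → G) :
    Fin.contractNth 0 (· + ·) (Fin.cons x g : Fin (n+2) → G) =
      Fin.cons (x + g 0) (fun i => g i.succ) := by
  funext i
  refine Fin.cases ?_ (fun i => ?_) i
  · simp [Fin.contractNth]
  · simp [Fin.contractNth]

theorem contract_succ (n : ℕ) (j : Fin (n+1)) (x : G) (g : Fin (n+1) → G) :
    Fin.contractNth j.succ (· + ·) (Fin.cons x g : Fin (n+2) → G) =
      Fin.cons x (Fin.contractNth j (· + ·) g) := by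
  funext i
  refine Fin.cases ?_ (fun i => ?_) i
  · simp [Fin.contractNth]
  · simp [Fin.contractNth]

theorem homotopy (n : ℕ) (f : (Fin (n+1) → G) → G → A) :
    ht (n+1) (D (n+1) f) + D n (ht n f) = f := by
  funext g x
  simp only [Pi.add_apply, D_apply, ht_apply]
  rw [Fin.sum_univ_succ]
  simp only [contract_zero, contract_succ]
  simp [pow_succ]
  ring

theorem DD (n : ℕ) : ∀ f : (Fin n → G) → G → A, D (n+1) (D n f) = 0 := by
  induction n with
  | zero =>
    intro f
    funext g x
    simp only [D_apply, Fin.sum_univ_succ, Fin.sum_univ_zero]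
    have h : ∀ a b : Fin 0 → G, a = b := fun a b => Subsingleton.elim _ _
    simp [Fin.contractNth, add_assoc]
    simp [h _ (fun i => g i.succ.succ)]
  | succ n ih =>
    intro f
    have key : ∀ f : (Fin (n+1) → G) → G → A, ht (n+2) (D (n+2) (D (n+1) f)) = 0 := by
      intro f
      have h1 := homotopy (n+1) (D (n+1) f)
      have h2 := congrArg (D (n+1)) (homotopy n f)
      rw [map_add, ih, add_zero] at h2
      rw [h2] at h1
      simpa using h1
    funext g x
    have := congrFun (congrFun (key (sh _ x f)) (fun i => g i.succ)) (g 0)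
    rw [D_sh, D_sh, ht_apply, sh_apply] at this
    have hg : (Fin.cons (g 0) (fun i => g i.succ) : Fin (n+3) → G) = g := Fin.cons_self_tail g
    simpa [hg] using this

noncomputable def ev (n : ℕ) (v : Fin n → G) : ((Fin n → G) → G → A) →ₗ[A] (G → A) where
  toFun f := fun x => ∑ σ : Equiv.Perm (Fin n), (Equiv.Perm.sign σ : ℤ) • f (v ∘ σ) x
  map_add' _ _ := by
    funext x; simp [Finset.sum_add_distrib]
  map_smul' a f := by
    funext x
    simp only [Pi.smul_apply, RingHom.id_apply, smul_comm a, Finset.smul_sum]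

theorem ev_apply (n : ℕ) (v : Fin n → G) (f : (Fin n → G) → G → A) (x : G) :
  ev n v f x = ∑ σ : Equiv.Perm (Fin n), (Equiv.Perm.sign σ : ℤ) • f (v ∘ σ) x := rfl

theorem contract_swap (n : ℕ) (j : Fin n) (w : Fin (n+1) → G) :
    Fin.contractNth j.castSucc (· + ·) (w ∘ Equiv.swap j.castSucc j.succ) =
      Fin.contractNth j.castSucc (· + ·) w := by
  funext i
  rcases lt_trichotomy i j with h | h | h
  · have h' : (i:ℕ) < j := h
    rw [Fin.contractNth_apply_of_lt _ _ _ _ (by simpa using h'),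
      Fin.contractNth_apply_of_lt _ _ _ _ (by simpa using h')]
    rw [Function.comp, Equiv.swap_apply_of_ne_of_ne] <;> simp [Fin.ext_iff] <;> omega
  · subst h
    rw [Fin.contractNth_apply_of_eq _ _ _ _ (by simp),
      Fin.contractNth_apply_of_eq _ _ _ _ (by simp)]
    simp [add_comm]
  · have h' : (j:ℕ) < i := h
    rw [Fin.contractNth_apply_of_gt _ _ _ _ (by simpa using h'),
      Fin.contractNth_apply_of_gt _ _ _ _ (by simpa using h')]
    rw [Function.comp, Equiv.swap_apply_of_ne_of_ne] <;> simp [Fin.ext_iff] <;> omega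

theorem contract_last (n : ℕ) (w : Fin (n+1) → G) :
    Fin.contractNth (Fin.last n) (· + ·) w = fun i => w i.castSucc := by
  funext i
  rw [Fin.contractNth_apply_of_lt _ _ _ _ (by simp)]

theorem mid_zero (n : ℕ) (j : Fin n) (v : Fin (n+1) → G) (f : (Fin n → G) → A) :
    ∑ σ : Equiv.Perm (Fin (n+1)), (Equiv.Perm.sign σ : ℤ) •
      f (Fin.contractNth j.castSucc (· + ·) (v ∘ σ)) = 0 := by
  refine Finset.sum_involution (fun σ _ => σ * Equiv.swap j.castSucc j.succ) ?_ ?_ ?_ ?_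
  · intro σ _
    rw [Equiv.Perm.coe_mul, ← Function.comp_assoc, contract_swap]
    simp [Equiv.Perm.sign_swap (show j.castSucc ≠ j.succ by simp [Fin.ext_iff])]
  · intro σ _ _ h
    have := mul_eq_left.mp h
    rw [Equiv.swap_eq_one_iff] at this
    simp [Fin.ext_iff] at this
  · simp
  · intro σ _
    simp [mul_assoc]

theorem ev_D (n : ℕ) (v : Fin (n+1) → G) (f : (Fin n → G) → G → A) (x : G) :
    ev (n+1) v (D n f) x = ∑ σ : Equiv.Perm (Fin (n+1)), (Equiv.Perm.sign σ : ℤ) •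
      (f (fun i => v (σ i.succ)) (x + v (σ 0)) - f (fun i => v (σ i.succ)) x) := by
  rw [ev_apply]
  simp only [D_apply, smul_add, Finset.sum_add_distrib, smul_sub, Finset.sum_sub_distrib]
  rw [sub_eq_add_neg]
  congr 1
  simp only [Finset.smul_sum]
  rw [Finset.sum_comm, Fin.sum_univ_castSucc, Finset.sum_eq_zero, zero_add]
  · simp only [contract_last]
    rw [← Equiv.sum_comp (Equiv.mulRight (finRotate (n+1)))]
    rw [← Finset.sum_neg_distrib]
    refine Finset.sum_congr rfl fun σ _ => ?_
    simp only [Equiv.coe_mulRight, Equiv.Perm.sign_mul, sign_finRotate, Function.comp,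
      Equiv.Perm.mul_apply, finRotate_apply, Fin.coeSucc_eq_succ, smul_smul, Fin.val_last]
    rw [← neg_smul]
    congr 1
    push_cast
    rw [mul_assoc, ← pow_add]
    rw [show n + (n+1) = 2*n+1 by ring]
    simp [pow_succ, pow_mul]
  · intro j _
    simp only [smul_comm _ ((-1:ℤ)^_)]
    rw [← Finset.smul_sum, mid_zero n j v (fun w => f w x), smul_zero]

theorem ev_D_inv (n : ℕ) (v : Fin (n+1) → G) (f : (Fin n → G) → G → A) (x : G)
    (h : ∀ i g x, f g (x + v i) = f g x) : ev (n+1) v (D n f) x = 0 := by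
  rw [ev_D]; simp [h]

theorem ev_D_cons (n : ℕ) (t : G) (v : Fin n → G) (f : (Fin n → G) → G → A) (x : G)
    (h : ∀ i g x, f g (x + v i) = f g x) :
    ev (n+1) (Fin.cons t v) (D n f) x = ev n v (sh n t f - f) x := by
  rw [ev_D, ← Equiv.sum_comp Equiv.Perm.decomposeFin.symm, Fintype.sum_prod_type,
    Fin.sum_univ_succ]
  rw [Finset.sum_eq_zero (s := Finset.univ) (f := fun i : Fin n => _), add_zero, ev_apply]
  · refine Finset.sum_congr rfl fun σ _ => ?_
    simp [sh_apply, Function.comp_def]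
  · intro i _
    refine Finset.sum_eq_zero fun σ _ => ?_
    simp [h]

theorem exists_sum : ∃ U : (ℤ → A) → ℤ → A, ∀ u k, U u (k+1) = U u k + u k := by
  refine ⟨fun u k => ∑ r ∈ Finset.range k.toNat, u r -
    ∑ r ∈ Finset.range (-k).toNat, u (-(r+1)), fun u k => ?_⟩
  rcases le_or_gt 0 k with h | h
  · obtain ⟨n, rfl⟩ := Int.eq_ofNat_of_zero_le h
    have h1 : ((n:ℤ)+1).toNat = n + 1 := by omega
    have h2 : (-(n:ℤ)).toNat = 0 := by omega
    have h3 : (-((n:ℤ)+1)).toNat = 0 := by omega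
    simp only [h1, h2, h3, Finset.sum_range_succ, Int.toNat_natCast]
    simp
  · obtain ⟨n, hn⟩ := Int.eq_ofNat_of_zero_le (show 0 ≤ -k-1 by omega)
    obtain rfl : k = -(n+1) := by omega
    have h1 : (-((n:ℤ)+1)).toNat = 0 := by omega
    have h2 : (-((n:ℤ)+1)+1).toNat = 0 := by omega
    have h3 : (-(-((n:ℤ)+1)+1)).toNat = n := by omega
    have h4 : (-(-((n:ℤ)+1))).toNat = n+1 := by omega
    simp only [h1, h2, h3, h4, Finset.sum_range_succ]
    simp

section zd
variable {d : ℕ}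

abbrev e (i : Fin d) : Fin d → ℤ := Pi.single i 1

def Inv (T : Finset (Fin d)) {n : ℕ} (F : (Fin n → (Fin d → ℤ)) → (Fin d → ℤ) → A) : Prop :=
  ∀ i ∈ T, ∀ g x, F g (x + e i) = F g x

theorem exists_prim (T : Finset (Fin d)) (i : Fin d) (hi : i ∉ T) {n : ℕ}
    (L : (Fin n → (Fin d → ℤ)) → (Fin d → ℤ) → A) (hL : Inv T L) :
    ∃ L', Inv T L' ∧ sh n (e i) L' - L' = L := by
  obtain ⟨U, hU⟩ := exists_sum (A := A)
  refine ⟨fun g x => U (fun r => L g (Function.update x i r)) (x i), ?_, ?_⟩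
  · intro j hj g x
    have hij : i ≠ j := fun h => hi (h ▸ hj)
    have : ∀ r, Function.update (x + e j) i r = Function.update x i r + e j := by
      intro r
      funext k
      by_cases hk : k = i
      · subst hk; simp [e, hij]
      · simp [hk]
    simp only [this, hL j hj]
    simp [e, hij]
  · funext g x
    have : ∀ r, Function.update (x + e i) i r = Function.update x i r := by
      intro r
      funext k
      by_cases hk : k = i
      · subst hk; simp
      · simp [hk, e]
    simp only [Pi.sub_apply, sh_apply, this]
    rw [show (x + e i) i = x i + 1 by simp [e], hU]
    simp

theorem detect (T : Finset (Fin d)) : ∀ (n : ℕ)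
    (F : (Fin (n+1) → (Fin d → ℤ)) → (Fin d → ℤ) → A), D (n+1) F = 0 → Inv T F →
    (∀ S : Fin (n+1) → Fin d, (∀ k, S k ∈ T) → ev (n+1) (fun k => e (S k)) F 0 = 0) →
    ∃ H, Inv T H ∧ D n H = F := by
  classical
  induction T using Finset.induction_on with
  | empty =>
    intro n F hF _ _
    refine ⟨ht n F, by simp [Inv], ?_⟩
    have := homotopy n F
    simpa [hF] using this
  | insert i T hi ih =>
    intro n F hF hinv hev
    obtain ⟨H, hH, rfl⟩ := ih n F hF (fun j hj => hinv j (Finset.mem_insert_of_mem hj))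
      (fun S hS => hev S fun k => Finset.mem_insert_of_mem (hS k))
    have hK : D n (sh n (e i) H - H) = 0 := by
      rw [map_sub, D_sh]
      funext g x
      simp [sh_apply, hinv i (Finset.mem_insert_self i T)]
    have hKinv : Inv T (sh n (e i) H - H) := by
      intro j hj g x
      simp only [Pi.sub_apply, sh_apply, hH j hj, add_right_comm x (e j)]
    have hKev : ∀ S : Fin n → Fin d, (∀ k, S k ∈ T) →
        ev n (fun k => e (S k)) (sh n (e i) H - H) 0 = 0 := by
      intro S hS
      rw [← ev_D_cons n (e i) _ H 0 (fun k => hH _ (hS k))]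
      have := hev (Fin.cons i S) (fun k => by
        refine Fin.cases ?_ (fun k => ?_) k
        · simp
        · simp [hS])
      convert this using 2
      congr 1
      funext k
      refine Fin.cases ?_ (fun k => ?_) k <;> simp
    obtain ⟨L', hL', hKL⟩ : ∃ L' : (Fin n → (Fin d → ℤ)) → (Fin d → ℤ) → A,
        Inv T L' ∧ D n L' = 0 ∧ sh n (e i) L' - L' = sh n (e i) H - H := by
      cases n with
      | zero =>
        refine ⟨0, by intro j _ g x; simp, by simp, ?_⟩
        have h0 : ∀ g x, (sh 0 (e i) H - H) g x = 0 := by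
          intro g x
          have h1 := congrFun (congrFun hK (fun _ => x)) 0
          have h2 := hKev (Fin.elim0) (fun k => k.elim0)
          simp only [ev_apply] at h2
          simp only [D_apply] at h1
          rw [Fin.sum_univ_succ] at h1
          have h : ∀ a : Fin 0 → Fin d → ℤ, a = g := fun a => Subsingleton.elim _ _
          simp only [h _] at h1 h2
          simp at h1 h2
          simp only [Pi.sub_apply]
          linear_combination h1 + h2
        symm
        funext g x
        rw [h0]
        simp [sh_apply]
      | succ n =>
        obtain ⟨L, hL, hKL⟩ := ih n _ hK hKinv hKev
        obtain ⟨L', hL', hLL⟩ := exists_prim T i hi L hL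
        refine ⟨D n L', ?_, DD n L', ?_⟩
        · intro j hj g x
          have : sh n (e j) L' = L' := by
            funext g x; exact hL' j hj g x
          rw [← sh_apply n.succ (e j) (D n L') g x, ← D_sh, this]
        · rw [← D_sh, ← map_sub, hLL, hKL]
    refine ⟨H - L', ?_, by rw [map_sub, hKL.1, sub_zero]⟩
    intro j hj g x
    rcases Finset.mem_insert.mp hj with rfl | hj
    · have := congrFun (congrFun hKL.2 g) x
      simp only [Pi.sub_apply, sh_apply] at this ⊢
      linear_combination -this
    · simp [hH j hj, hL' j hj]

end zd
end ExtCoh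
namespace ExtCoh

section coc
variable {G : Type*} [AddCommGroup G] {A : Type*} [CommRing A]

theorem telescope (n : ℕ) : ∀ a : Fin (n+1) → A,
    ∑ j : Fin n, ((-1 : ℤ) ^ ((j : ℕ) + 1)) • (a j.castSucc + a j.succ) =
      ((-1 : ℤ) ^ n) • a (Fin.last n) - a 0 := by
  induction n with
  | zero => intro a; simp
  | succ n ih =>
    intro a
    rw [Fin.sum_univ_castSucc]
    have := ih (fun i => a i.castSucc)
    simp only [Fin.val_castSucc, Fin.val_last, Fin.succ_castSucc, Fin.succ_last,
      Fin.castSucc_zero] at this ⊢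
    rw [this]
    simp [pow_succ]
    ring

theorem contract_update (n : ℕ) (j : Fin n) (g : Fin (n+1) → G) :
    Fin.contractNth j.castSucc (· + ·) g =
      Function.update (g ∘ j.castSucc.succAbove) j (g j.castSucc + g j.succ) := by
  funext i
  rcases lt_trichotomy i j with h | h | h
  · have h' : (i:ℕ) < j := h
    rw [Fin.contractNth_apply_of_lt _ _ _ _ (by simpa using h'), Function.update_of_ne h.ne]
    simp [Fin.succAbove_of_castSucc_lt _ _ (show i.castSucc < j.castSucc from h)]
  · subst h
    rw [Fin.contractNth_apply_of_eq _ _ _ _ (by simp)]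
    simp
  · have h' : (j:ℕ) < i := h
    rw [Fin.contractNth_apply_of_gt _ _ _ _ (by simpa using h'), Function.update_of_ne h.ne']
    simp [Fin.succAbove_of_le_castSucc _ _ (show j.castSucc ≤ i.castSucc from h.le)]

theorem update_castSucc (n : ℕ) (j : Fin n) (g : Fin (n+1) → G) :
    Function.update (g ∘ j.castSucc.succAbove) j (g j.succ) = g ∘ j.castSucc.succAbove := by
  rw [Function.update_eq_self_iff]
  simp

theorem update_succ (n : ℕ) (j : Fin n) (g : Fin (n+1) → G) :
    Function.update (g ∘ j.castSucc.succAbove) j (g j.castSucc) = g ∘ j.succ.succAbove := by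
  funext i
  rcases lt_trichotomy i j with h | h | h
  · rw [Function.update_of_ne h.ne]
    simp [Fin.succAbove_of_castSucc_lt _ _ (show i.castSucc < j.castSucc from h),
      Fin.succAbove_of_castSucc_lt _ _ (show i.castSucc < j.succ from
        lt_trans (show i.castSucc < j.castSucc from h) (Fin.castSucc_lt_succ))]
  · subst h
    simp
  · rw [Function.update_of_ne h.ne']
    simp [Fin.succAbove_of_le_castSucc _ _ (show j.castSucc ≤ i.castSucc from h.le),
      Fin.succAbove_of_le_castSucc _ _ (show j.succ ≤ i.castSucc from h)]

theorem multilinear_cocycle (n : ℕ) (f : MultilinearMap ℤ (fun _ : Fin n => G) A) :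
    dLin G A n f = 0 := by
  funext g
  change f (fun i => g i.succ) +
      ∑ j : Fin (n + 1), ((-1 : ℤ) ^ ((j : ℕ) + 1)) • f (Fin.contractNth j (· + ·) g) = 0
  rw [Fin.sum_univ_castSucc, contract_last]
  have h := telescope n (fun k => f (g ∘ k.succAbove))
  have h2 : ∀ j : Fin n, f (Fin.contractNth j.castSucc (· + ·) g) =
      f (g ∘ j.castSucc.succAbove) + f (g ∘ j.succ.succAbove) := by
    intro j
    rw [contract_update, f.map_update_add, update_castSucc, update_succ, add_comm]
  simp only [h2, Fin.val_castSucc, h, Fin.val_last]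
  have h3 : (g ∘ (Fin.last n).succAbove) = fun i => g i.castSucc := by funext i; simp
  have h4 : (g ∘ (0 : Fin (n+1)).succAbove) = fun i => g i.succ := by funext i; simp
  rw [h3, h4]
  simp [pow_succ]
  ring

theorem cAlt_eq_det {k : ℕ} (φ : Fin k → (G →+ A)) (g : Fin k → G) :
    cAlt φ g = Ring.inverse ((k.factorial : ℕ) : A) *
      Matrix.det (Matrix.of fun j i => φ i (g j)) := by
  rw [cAlt, Matrix.det_apply]
  rfl

noncomputable def rowMap {k : ℕ} (φ : Fin k → (G →+ A)) : G →ₗ[ℤ] (Fin k → A) :=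
  LinearMap.pi fun i => (φ i).toIntLinearMap

noncomputable def cMul {k : ℕ} (φ : Fin k → (G →+ A)) : MultilinearMap ℤ (fun _ : Fin k => G) A :=
  ((Matrix.detRowAlternating (R := A) (n := Fin k)).toMultilinearMap.restrictScalars ℤ).compLinearMap
    (fun _ => rowMap φ)

theorem cAlt_eq_cMul {k : ℕ} (φ : Fin k → (G →+ A)) :
    cAlt φ = Ring.inverse ((k.factorial : ℕ) : A) • (cMul φ : (Fin k → G) → A) := by
  funext g
  rw [cAlt_eq_det]
  rfl

theorem cAlt_mem {k : ℕ} (φ : Fin k → (G →+ A)) :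
    cAlt φ ∈ LinearMap.ker (dLin G A k) := by
  rw [LinearMap.mem_ker, cAlt_eq_cMul, map_smul, multilinear_cocycle, smul_zero]

def evalRow {k : ℕ} (g : Fin k → G) : (G →+ A) →ₗ[A] (Fin k → A) where
  toFun φ := fun j => φ (g j)
  map_add' _ _ := rfl
  map_smul' _ _ := rfl

noncomputable def cAltMap (G A : Type*) [AddCommGroup G] [CommRing A] (k : ℕ) :
    (G →+ A) [⋀^Fin k]→ₗ[A] ((Fin k → G) → A) :=
  AlternatingMap.pi fun g =>
    (Ring.inverse ((k.factorial : ℕ) : A)) •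
      (Matrix.detRowAlternating (R := A) (n := Fin k)).compLinearMap (evalRow g)

theorem cAltMap_apply {k : ℕ} (φ : Fin k → (G →+ A)) : cAltMap G A k φ = cAlt φ := by
  funext g
  rw [cAlt_eq_det, ← Matrix.det_transpose]
  rfl

noncomputable def cAltZ (G A : Type*) [AddCommGroup G] [CommRing A] (k : ℕ) :
    (G →+ A) [⋀^Fin k]→ₗ[A] (LinearMap.ker (dLin G A k)) :=
  (cAltMap G A k).codRestrict _ (fun φ => by rw [cAltMap_apply]; exact cAlt_mem φ)

/-- evaluation -/
noncomputable def ev0 (n : ℕ) (v : Fin n → G) : ((Fin n → G) → A) →ₗ[A] A where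
  toFun f := ∑ σ : Equiv.Perm (Fin n), (Equiv.Perm.sign σ : ℤ) • f (v ∘ σ)
  map_add' _ _ := by
    simp [Finset.sum_add_distrib]
  map_smul' a f := by
    simp only [Pi.smul_apply, RingHom.id_apply, smul_comm a, Finset.smul_sum]

theorem ev0_apply (n : ℕ) (v : Fin n → G) (f : (Fin n → G) → A) :
    ev0 n v f = ∑ σ : Equiv.Perm (Fin n), (Equiv.Perm.sign σ : ℤ) • f (v ∘ σ) := rfl

theorem ev0_dLin (n : ℕ) (v : Fin (n+1) → G) (f : (Fin n → G) → A) :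
    ev0 (n+1) v (dLin G A n f) = 0 :=
  ev_D_inv n v (fun g _ => f g) 0 (fun _ _ _ => rfl)

theorem ev0_perm (n : ℕ) (v : Fin n → G) (τ : Equiv.Perm (Fin n)) (f : (Fin n → G) → A) :
    ev0 n (v ∘ τ) f = (Equiv.Perm.sign τ : ℤ) • ev0 n v f := by
  rw [ev0_apply, ev0_apply, Finset.smul_sum]
  conv_rhs => rw [← Equiv.sum_comp (Equiv.mulLeft τ)]
  refine Finset.sum_congr rfl fun σ _ => ?_
  rw [smul_smul]
  simp only [Equiv.coe_mulLeft, Equiv.Perm.sign_mul, Equiv.Perm.coe_mul, Function.comp_assoc]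
  congr 1
  push_cast
  rw [← mul_assoc, ← Units.val_mul, Int.units_mul_self]
  simp

theorem ev0_cAlt {k : ℕ} (hu : IsUnit ((k.factorial : ℕ) : A)) (φ : Fin k → (G →+ A))
    (v : Fin k → G) :
    ev0 k v (cAlt φ) = ∑ σ : Equiv.Perm (Fin k), (Equiv.Perm.sign σ : ℤ) • ∏ i, φ i (v (σ i)) := by
  rw [ev0_apply]
  have h : ∀ σ : Equiv.Perm (Fin k), (Equiv.Perm.sign σ : ℤ) • cAlt φ (v ∘ σ) = cAlt φ v := by
    intro σ
    rw [cAlt_eq_det, cAlt_eq_det]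
    have := Matrix.det_permute σ (Matrix.of fun j i => φ i (v j))
    have h2 : (Matrix.of fun j i => φ i (v j)).submatrix σ id =
      Matrix.of fun j i => φ i ((v ∘ σ) j) := rfl
    rw [h2] at this
    rw [this, zsmul_eq_mul]
    have h3 : (((Equiv.Perm.sign σ : ℤˣ) : ℤ) : A) * (((Equiv.Perm.sign σ : ℤˣ) : ℤ) : A) = 1 := by
      rw [← Int.cast_mul, ← Units.val_mul, Int.units_mul_self]; simp
    linear_combination (Ring.inverse ((k.factorial : ℕ) : A) *
      Matrix.det (Matrix.of fun j i => φ i (v j))) * h3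
  simp only [h]
  rw [Finset.sum_const, Finset.card_univ, Fintype.card_perm, Fintype.card_fin, nsmul_eq_mul, cAlt,
    ← mul_assoc, Ring.mul_inverse_cancel _ hu, one_mul]

end coc

section fin
variable {d : ℕ} {A : Type*} [CommRing A]

theorem const_of_inv (h : (Fin d → ℤ) → A) (hh : ∀ i x, h (x + e i) = h x) (x : Fin d → ℤ) :
    h x = h 0 := by
  have key : ∀ y : Fin d → ℤ, ∀ x, h (x + y) = h x := by
    let S : AddSubgroup (Fin d → ℤ) :=
      { carrier := {y | ∀ x, h (x + y) = h x}
        zero_mem' := by simp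
        add_mem' := by
          intro a b ha hb x
          rw [← add_assoc, hb, ha]
        neg_mem' := by
          intro a ha x
          have := ha (x + -a)
          rw [← this]; simp }
    intro y
    have hy : y = ∑ i, y i • e i := by
      funext k
      simp [e, Finset.sum_apply, Pi.single_apply]
    have : y ∈ S := by
      rw [hy]
      exact S.sum_mem fun i _ => S.zsmul_mem (fun x => hh i x) _
    exact this
  simpa using key x 0

theorem detect0 (n : ℕ) (f : (Fin (n+1) → (Fin d → ℤ)) → A)
    (hf : dLin (Fin d → ℤ) A (n+1) f = 0)
    (hev : ∀ S : Fin (n+1) → Fin d, ev0 (n+1) (fun k => e (S k)) f = 0) :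
    f ∈ LinearMap.range (dLin (Fin d → ℤ) A n) := by
  obtain ⟨H, hH, hD⟩ := detect Finset.univ n (fun g _ => f g)
    (by funext g x; exact congrFun hf g) (fun _ _ _ _ => rfl) (fun S _ => hev S)
  refine ⟨fun g => H g 0, ?_⟩
  funext g
  rw [← congrFun (congrFun hD g) 0, D_apply]
  rw [const_of_inv (H _) (fun i x => hH i (Finset.mem_univ _) _ x) (0 + g 0)]
  rfl

/-- dual basis -/
def es (i : Fin d) : (Fin d → ℤ) →+ A :=
  (Int.castAddHom A).comp (Pi.evalAddMonoidHom (fun _ => ℤ) i)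

theorem es_e (i j : Fin d) : (es i (e j) : A) = if i = j then 1 else 0 := by
  simp [es, e, Pi.single_apply]

theorem hom_eq (φ : (Fin d → ℤ) →+ A) : ∑ k, φ (e k) • es k = φ := by
  ext k
  simp [es, Pi.single_apply]

noncomputable def Psi0 (d : ℕ) (A : Type*) [CommRing A] (m : ℕ) :
    ((Fin (m+1) → (Fin d → ℤ)) → A) →ₗ[A] (⋀[A]^(m + 1) ((Fin d → ℤ) →+ A)) :=
  Ring.inverse (((m+1).factorial : ℕ) : A) • ∑ S : Fin (m+1) → Fin d,
    (ev0 (m+1) (fun k => e (S k))).smulRight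
      (exteriorPower.ιMulti A (m+1) (fun k => es (S k)))

theorem Psi0_apply (m : ℕ) (f : (Fin (m+1) → (Fin d → ℤ)) → A) :
    Psi0 d A m f = Ring.inverse (((m+1).factorial : ℕ) : A) • ∑ S : Fin (m+1) → Fin d,
    (ev0 (m+1) (fun k => e (S k)) f) • (exteriorPower.ιMulti A (m+1) (fun k => es (S k))) := by
  simp [Psi0, LinearMap.sum_apply]

theorem Psi0_cAlt (m : ℕ) (hu : IsUnit (((m + 1).factorial : ℕ) : A))
    (φ : Fin (m+1) → ((Fin d → ℤ) →+ A)) :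
    Psi0 d A m (cAlt φ) = exteriorPower.ιMulti A (m+1) φ := by
  rw [Psi0_apply]
  simp only [ev0_cAlt hu, Finset.sum_smul]
  rw [Finset.sum_comm]
  have h : ∀ σ : Equiv.Perm (Fin (m+1)), ∑ S : Fin (m+1) → Fin d,
      ((Equiv.Perm.sign σ : ℤ) • ∏ i, φ i (e (S (σ i)))) •
        exteriorPower.ιMulti A (m+1) (fun k => es (A := A) (S k)) =
      exteriorPower.ιMulti A (m+1) φ := by
    intro σ
    have h1 : exteriorPower.ιMulti A (m+1) φ = ∑ S : Fin (m+1) → Fin d,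
        (∏ i, φ i (e (S i))) • exteriorPower.ιMulti A (m+1) (fun k => es (A := A) (S k)) := by
      conv_lhs => rw [show φ = fun i => ∑ k, φ i (e k) • es k from
        funext fun i => (hom_eq (φ i)).symm]
      rw [← AlternatingMap.coe_multilinearMap, MultilinearMap.map_sum]
      refine Finset.sum_congr rfl fun S _ => ?_
      rw [MultilinearMap.map_smul_univ]
    rw [h1, ← Equiv.sum_comp (Equiv.arrowCongr σ (Equiv.refl (Fin d)))]
    refine Finset.sum_congr rfl fun S _ => ?_
    have h2 := AlternatingMap.map_perm (exteriorPower.ιMulti A (m+1))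
      (fun k => es (A := A) (S k)) σ.symm
    have h3 : ((fun k => es (A := A) (S k)) ∘ σ.symm) = fun k => es (A := A)
      ((Equiv.arrowCongr σ (Equiv.refl (Fin d))) S k) := by
      funext k; simp [Equiv.arrowCongr]
    rw [h3] at h2
    rw [h2]
    simp only [Equiv.arrowCongr_apply, Equiv.coe_refl, Function.comp, id, Equiv.symm_apply_apply,
      Equiv.Perm.sign_symm]
    rw [Units.smul_def, smul_assoc, smul_comm _ _ (_ : ⋀[A]^(m + 1) ((Fin d → ℤ) →+ A)), smul_smul,
      ← Units.val_mul, Int.units_mul_self]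
    simp
  simp only [h]
  rw [Finset.sum_const, Finset.card_univ, Fintype.card_perm, Fintype.card_fin,
    ← Nat.cast_smul_eq_nsmul A, smul_smul, Ring.inverse_mul_cancel _ hu, one_smul]

noncomputable def Phi0 (d : ℕ) (A : Type*) [CommRing A] (m : ℕ) :
    (⋀[A]^(m + 1) ((Fin d → ℤ) →+ A)) →ₗ[A] LinearMap.ker (dLin (Fin d → ℤ) A (m+1)) :=
  exteriorPower.alternatingMapLinearEquiv (cAltZ (Fin d → ℤ) A (m+1))

theorem Phi0_ι (m : ℕ) (φ : Fin (m+1) → ((Fin d → ℤ) →+ A)) :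
    Phi0 d A m (exteriorPower.ιMulti A (m+1) φ) = ⟨cAlt φ, cAlt_mem φ⟩ := by
  rw [Phi0, exteriorPower.alternatingMapLinearEquiv_apply_ιMulti]
  exact Subtype.ext (cAltMap_apply φ)

theorem ev_Phi_Psi (m : ℕ) (hu : IsUnit (((m + 1).factorial : ℕ) : A))
    (f : (Fin (m+1) → (Fin d → ℤ)) → A) (T : Fin (m+1) → Fin d) :
    ev0 (m+1) (fun k => e (T k)) (Phi0 d A m (Psi0 d A m f) : (Fin (m+1) → (Fin d → ℤ)) → A) =
      ev0 (m+1) (fun k => e (T k)) f := by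
  rw [Psi0_apply, map_smul, map_sum]
  simp only [map_smul, Phi0_ι, Submodule.coe_smul, Submodule.coe_sum, map_sum, ev0_cAlt hu, es_e]
  simp only [smul_eq_mul, Finset.mul_sum]
  rw [Finset.sum_comm]
  have h : ∀ σ : Equiv.Perm (Fin (m+1)), ∑ S : Fin (m+1) → Fin d,
     Ring.inverse (((m+1).factorial : ℕ) : A) * (ev0 (m+1) (fun k => e (S k)) f *
      ((Equiv.Perm.sign σ : ℤ) • ∏ i, if S i = T (σ i) then (1:A) else 0)) =
      Ring.inverse (((m+1).factorial : ℕ) : A) * ev0 (m+1) (fun k => e (T k)) f := by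
    intro σ
    rw [Finset.sum_eq_single (T ∘ σ)]
    · have := ev0_perm (m+1) (fun k => e (T k)) σ f
      simp only [Function.comp_def] at this ⊢
      rw [this]
      simp only [if_true, Finset.prod_const_one, zsmul_eq_mul, mul_one]
      have h3 : (((Equiv.Perm.sign σ : ℤˣ) : ℤ) : A) * (((Equiv.Perm.sign σ : ℤˣ) : ℤ) : A) = 1 := by
        rw [← Int.cast_mul, ← Units.val_mul, Int.units_mul_self]; simp
      linear_combination (Ring.inverse (((m+1).factorial : ℕ) : A) *
        ev0 (m+1) (fun k => e (T k)) f) * h3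
    · intro S _ hS
      obtain ⟨i, hi⟩ := Function.ne_iff.mp hS
      rw [Finset.prod_eq_zero (Finset.mem_univ i) (if_neg hi)]
      simp
    · simp
  simp only [h]
  rw [Finset.sum_const, Finset.card_univ, Fintype.card_perm, Fintype.card_fin,
    nsmul_eq_mul, ← mul_assoc, Ring.mul_inverse_cancel _ hu, one_mul]

theorem Psi0_dLin (m : ℕ) (h : (Fin m → (Fin d → ℤ)) → A) :
    Psi0 d A m (dLin (Fin d → ℤ) A m h) = 0 := by
  rw [Psi0_apply]
  simp [ev0_dLin]

noncomputable def Psi (d : ℕ) (A : Type*) [CommRing A] (m : ℕ) :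
    cohomologyOfAbelian (Fin d → ℤ) A m →ₗ[A] (⋀[A]^(m + 1) ((Fin d → ℤ) →+ A)) :=
  Submodule.liftQ _ ((Psi0 d A m).comp (Submodule.subtype _)) (by
    rintro ⟨f, hf⟩ ⟨h, hh⟩
    simp only [LinearMap.mem_ker, LinearMap.comp_apply]
    rw [← hh, Psi0_dLin])

noncomputable def Phi (d : ℕ) (A : Type*) [CommRing A] (m : ℕ) :
    (⋀[A]^(m + 1) ((Fin d → ℤ) →+ A)) →ₗ[A] cohomologyOfAbelian (Fin d → ℤ) A m :=
  (Submodule.mkQ _).comp (Phi0 d A m)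

theorem Psi_Phi (m : ℕ) (hu : IsUnit (((m + 1).factorial : ℕ) : A)) :
    (Psi d A m).comp (Phi d A m) = LinearMap.id := by
  apply exteriorPower.linearMap_ext
  ext1 φ
  simp only [LinearMap.compAlternatingMap_apply, LinearMap.comp_apply, LinearMap.id_apply, Phi,
    Phi0_ι, Psi, Submodule.mkQ_apply, Submodule.liftQ_apply, Submodule.subtype_apply]
  exact Psi0_cAlt m hu φ

theorem Phi_Psi (m : ℕ) (hu : IsUnit (((m + 1).factorial : ℕ) : A)) :
    (Phi d A m).comp (Psi d A m) = LinearMap.id := by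
  apply LinearMap.ext
  intro x
  obtain ⟨f, rfl⟩ := Submodule.Quotient.mk_surjective _ x
  simp only [LinearMap.comp_apply, LinearMap.id_apply, Phi, Psi, Submodule.liftQ_apply,
    Submodule.subtype_apply, Submodule.mkQ_apply]
  rw [Submodule.Quotient.eq, Submodule.mem_comap]
  apply detect0
  · exact LinearMap.mem_ker.mp (Subtype.property (Phi0 d A m (Psi0 d A m f) - f))
  · intro S
    rw [map_sub, map_sub, Submodule.subtype_apply, Submodule.subtype_apply, ev_Phi_Psi m hu,
      sub_self]

end fin
end ExtCoh

/-- for `Λ = ℤ^d` (`d ≥ 1`), `n = m + 1 ≥ 1`, and a commutative ring `A` in which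
`n!` is a unit, the `A`-linear map `⋀ⁿ_A Hom_ℤ(Λ, A) → Hⁿ(Λ, A)` determined by the alternating
map sending `(φ₁,…,φ_n)` to the class of the cocycle
`(λ₁,…,λ_n) ↦ (n!)⁻¹ ∑_σ sgn σ · φ₁(λ_{σ1})⋯φ_n(λ_{σn})` is an isomorphism of `A`-modules. -/
theorem exteriorPower_iso_groupCohomology (d m : ℕ) (hd : 1 ≤ d) (A : Type*) [CommRing A]
    (hu : IsUnit (((m + 1).factorial : ℕ) : A)) :
    (∀ φ : Fin (m + 1) → ((Fin d → ℤ) →+ A),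
        cAlt φ ∈ LinearMap.ker (dLin (Fin d → ℤ) A (m + 1))) ∧
    ∃ e : (⋀[A]^(m + 1) ((Fin d → ℤ) →+ A)) ≃ₗ[A] cohomologyOfAbelian (Fin d → ℤ) A m,
      ∀ (φ : Fin (m + 1) → ((Fin d → ℤ) →+ A))
        (h : cAlt φ ∈ LinearMap.ker (dLin (Fin d → ℤ) A (m + 1))),
        e ⟨ExteriorAlgebra.ιMulti A (m + 1) φ,
            ExteriorAlgebra.ιMulti_range A (m + 1) (Set.mem_range_self φ)⟩ =
          Submodule.Quotient.mk ⟨cAlt φ, h⟩ := by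
  refine ⟨fun φ => ExtCoh.cAlt_mem φ,
    LinearEquiv.ofLinear (ExtCoh.Phi d A m) (ExtCoh.Psi d A m) (ExtCoh.Phi_Psi m hu)
      (ExtCoh.Psi_Phi m hu), fun φ h => ?_⟩
  have := ExtCoh.Phi0_ι m φ
  exact congrArg (Submodule.Quotient.mk (p := Submodule.comap
    (LinearMap.ker (dLin (Fin d → ℤ) A (m + 1))).subtype
      (LinearMap.range (dLin (Fin d → ℤ) A m)))) this
end

section
/- Let d ≥ 0 and n ≥ 0. The group cohomology H^n(ℤ^d, ℤ) of the free abelian group ℤ^d with coefficients in ℤ with trivial action is a free abelian group of rank (d choose n); in particular it is isomorphic as an abelian group to ℤ^(d choose n), and it vanishes for n > d. -/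
open CategoryTheory

/-- In a commutative group, the action of an element on the coefficients induces the
identity on cohomology. -/
theorem aux_map_applyAsHom {G : Type} [CommGroup G] (t : G) (n : ℕ) :
    ∀ M : Rep.{0} ℤ G,
      groupCohomology.map (MonoidHom.id G) (M.applyAsHom t) n = 𝟙 (groupCohomology M n) := by
  induction n with
  | zero =>
    intro M
    rw [← cancel_mono (groupCohomology.H0Iso M).hom]
    rw [groupCohomology.map_id_comp_H0Iso_hom, Category.id_comp]
    have : (Rep.invariantsFunctor ℤ G).map (M.applyAsHom t) = 𝟙 _ := by
      ext x
      exact Subtype.ext (x.2 t)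
    rw [this]
    exact Category.comp_id _
  | succ n ih =>
    intro M
    let J : Rep.{0} ℤ G :=
      Rep.coind (⊥ : Subgroup G).subtype (Rep.res (⊥ : Subgroup G).subtype M)
    let f : M ⟶ J := Rep.resCoindToHom (⊥ : Subgroup G).subtype M _ (𝟙 _)
    have hf : Mono f := by
      rw [Rep.mono_iff_injective]
      intro a b hab
      have h1 := congrFun (congrArg Subtype.val hab) (1 : G)
      have h2 : M.ρ 1 a = M.ρ 1 b := h1
      simpa using h2
    let X : ShortComplex (Rep.{0} ℤ G) := ShortComplex.mk f (Limits.cokernel.π f) (by simp)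
    have hX : X.ShortExact := { exact := ShortComplex.exact_cokernel f }
    have hJ : Limits.IsZero (groupCohomology J (n + 1)) :=
      (isZero_groupCohomology_succ_of_subsingleton _ n).of_iso (groupCohomology.coindIso _ _)
    have hepi : Epi (groupCohomology.δ hX n (n + 1) rfl) :=
      groupCohomology.epi_δ_of_isZero hX n hJ
    let F : X ⟶ X :=
      { τ₁ := X.X₁.applyAsHom t
        τ₂ := X.X₂.applyAsHom t
        τ₃ := X.X₃.applyAsHom t
        comm₁₂ := Rep.applyAsHom_comm _ _
        comm₂₃ := Rep.applyAsHom_comm _ _ }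
    have hnat := groupCohomology.δ_naturality hX hX F n (n + 1) rfl
    have h3 : groupCohomology.map (MonoidHom.id G) F.τ₃ n = 𝟙 _ := ih X.X₃
    rw [← cancel_epi (groupCohomology.δ hX n (n + 1) rfl)]
    exact (hnat.trans (congrArg (· ≫ groupCohomology.δ hX n (n + 1) rfl) h3)).trans
      ((Category.id_comp _).trans (Category.comp_id _).symm)

theorem aux_map_zero {G : Type} [CommGroup G] (t : G) (n : ℕ) (M : Rep.{0} ℤ G) :
    (groupCohomology.functor ℤ G n).map (M.applyAsHom t - 𝟙 M) = 0 := by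
  have : (groupCohomology.functor ℤ G n).Additive := by
    change (groupCohomology.cochainsFunctor ℤ G ⋙
      HomologicalComplex.homologyFunctor _ _ n).Additive
    infer_instance
  rw [Functor.map_sub, CategoryTheory.Functor.map_id, sub_eq_zero]
  exact aux_map_applyAsHom t n M

theorem aux_primitive (Y : ℤ → ℤ) : ∃ X : ℤ → ℤ, ∀ k, X (k + 1) - X k = Y k := by
  refine ⟨fun k => ∑ i ∈ Finset.Ico 0 k, Y i - ∑ i ∈ Finset.Ico k 0, Y i, fun k => ?_⟩
  rcases le_or_gt 0 k with h | h
  · have h1 : Finset.Ico (k + 1) 0 = ∅ := Finset.Ico_eq_empty (by omega)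
    have h2 : Finset.Ico k 0 = ∅ := Finset.Ico_eq_empty (by omega)
    have h3 : Finset.Ico 0 (k + 1) = insert k (Finset.Ico 0 k) := by
      ext; simp; omega
    simp [h1, h2, h3]
  · have h1 : Finset.Ico 0 (k + 1) = ∅ := Finset.Ico_eq_empty (by omega)
    have h2 : Finset.Ico 0 k = ∅ := Finset.Ico_eq_empty (by omega)
    have h3 : Finset.Ico k 0 = insert k (Finset.Ico (k + 1) 0) := by
      ext; simp; omega
    simp [h1, h2, h3]

/-- The inclusion of constants in the coinduced representation. -/
noncomputable def auxConst {G : Type} [CommGroup G] (S : Subgroup G) :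
    Rep.trivial ℤ G ℤ ⟶ Rep.coind S.subtype (Rep.trivial ℤ S ℤ) :=
  Rep.resCoindToHom S.subtype _ _ (𝟙 (Rep.trivial ℤ S ℤ))

theorem auxConst_apply {G : Type} [CommGroup G] (S : Subgroup G) (a : ℤ) (g : G) :
    ((auxConst S).hom a).1 g = a := rfl

theorem aux_sub_apply {G : Type} [CommGroup G] (S : Subgroup G) (t : G)
    (y : Rep.coind S.subtype (Rep.trivial ℤ S ℤ)) (g : G) :
    (((Rep.applyAsHom _ t - 𝟙 (Rep.coind S.subtype (Rep.trivial ℤ S ℤ))).hom y).1 g : ℤ)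
      = y.1 (g * t) - y.1 g := rfl

/-- The short complex `ℤ ⟶ Coind ⟶ Coind`. -/
noncomputable def auxX {G : Type} [CommGroup G] (S : Subgroup G) (t : G) :
    ShortComplex (Rep.{0} ℤ G) :=
  ShortComplex.mk (auxConst S)
    (Rep.applyAsHom _ t - 𝟙 (Rep.coind S.subtype (Rep.trivial ℤ S ℤ))) (by
      ext g
      exact (aux_sub_apply S t _ g).trans (sub_self _))

theorem aux_exact {k G : Type} [CommRing k] [Group G] (X : ShortComplex (Rep.{0} k G))
    (h : ∀ y : X.X₂, X.g.hom y = 0 → ∃ x : X.X₁, X.f.hom x = y) : X.Exact := by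
  apply (forget₂ (Rep k G) (ModuleCat k)).reflects_exact_of_faithful
  rw [ShortComplex.moduleCat_exact_iff]
  exact h

theorem auxX_shortExact {G : Type} [CommGroup G] (φ : G →* Multiplicative ℤ) (t : G)
    (ht : φ t = Multiplicative.ofAdd 1) : (auxX φ.ker t).ShortExact := by
  have hinv : ∀ (y : Rep.coind φ.ker.subtype (Rep.trivial ℤ φ.ker ℤ)) (a b : G),
      φ a = φ b → y.1 a = y.1 b := by
    intro y a b hab
    have h := y.2 ⟨a * b⁻¹, by rw [MonoidHom.mem_ker]; simp [hab]⟩ b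
    have h' : y.1 (a * b⁻¹ * b) = y.1 b := h
    simpa using h'
  have hφ : ∀ k : ℤ, φ (t ^ k) = Multiplicative.ofAdd k := by
    intro k
    rw [map_zpow, ht, ← ofAdd_zsmul]; simp
  have hrep : ∀ (y : Rep.coind φ.ker.subtype (Rep.trivial ℤ φ.ker ℤ)) (a : G),
      y.1 a = y.1 (t ^ (φ a).toAdd) := fun y a => hinv y _ _ (by rw [hφ]; rfl)
  have hmono : Mono (auxX φ.ker t).f := by
    rw [Rep.mono_iff_injective]
    intro a b hab
    exact congrFun (congrArg Subtype.val hab) (1 : G)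
  have hepi : Epi (auxX φ.ker t).g := by
    rw [Rep.epi_iff_surjective]
    intro y
    obtain ⟨X, hX⟩ := aux_primitive (fun k => y.1 (t ^ k))
    refine ⟨⟨fun g => X (φ g).toAdd, ?_⟩, ?_⟩
    · rintro ⟨s, hs⟩ g
      rw [MonoidHom.mem_ker] at hs
      simp [hs]
    · refine Subtype.ext (funext fun g => ?_)
      refine (aux_sub_apply φ.ker t _ g).trans ?_
      refine Eq.trans ?_ (hrep y g).symm
      refine Eq.trans ?_ (hX _)
      simp [ht]
  refine { exact := ?_, mono_f := hmono, epi_g := hepi }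
  apply aux_exact
  intro y hy
  have hy' : ∀ g : G, y.1 (g * t) = y.1 g := fun g => by
    have h1 := congrFun (congrArg Subtype.val hy) g
    exact sub_eq_zero.1 h1
  refine ⟨(y.1 1 : ℤ), ?_⟩
  refine Subtype.ext (funext fun g => ?_)
  change y.1 1 = y.1 g
  rw [hrep y g]
  generalize (φ g).toAdd = k
  induction k using Int.induction_on with
  | zero => simp
  | succ i ih => rw [zpow_add_one, hy']; exact ih
  | pred i ih =>
    rw [ih, ← hy' (t ^ (-(i : ℤ) - 1)), ← zpow_add_one]; simp

theorem aux_split {A B C : Type} [AddCommGroup A] [AddCommGroup B] [AddCommGroup C]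
    [Module ℤ A] [Module ℤ B] [Module ℤ C]
    (f : A →ₗ[ℤ] B) (g : B →ₗ[ℤ] C) (hf : Function.Injective f) (hg : Function.Surjective g)
    (h : Function.Exact f g) (a c : ℕ) (eA : A ≃ₗ[ℤ] (Fin a → ℤ)) (eC : C ≃ₗ[ℤ] (Fin c → ℤ)) :
    Nonempty (B ≃ₗ[ℤ] (Fin (a + c) → ℤ)) := by
  have : Module.Projective ℤ C := Module.Projective.of_equiv eC.symm
  obtain ⟨l, hl⟩ := Module.projective_lifting_property g LinearMap.id hg
  let e := (h.splitSurjectiveEquiv hf ⟨l, hl⟩).1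
  exact ⟨e ≪≫ₗ (eA.prodCongr eC) ≪≫ₗ (LinearEquiv.sumArrowLequivProdArrow _ _ ℤ ℤ).symm ≪≫ₗ
    LinearEquiv.funCongrLeft ℤ ℤ finSumFinEquiv.symm⟩

theorem aux_main (d : ℕ) : ∀ (G : Type) [CommGroup G] (_ : G ≃* Multiplicative (Fin d → ℤ))
    (n : ℕ), Nonempty ((groupCohomology (Rep.trivial ℤ G ℤ) n) ≃ₗ[ℤ]
      (Fin (d.choose n) → ℤ)) := by
  have h0 : ∀ (d : ℕ) (G : Type) [CommGroup G], 
      Nonempty ((groupCohomology (Rep.trivial ℤ G ℤ) 0) ≃ₗ[ℤ] (Fin (d.choose 0) → ℤ)) := by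
    intro d G _
    rw [Nat.choose_zero_right]
    exact ⟨(groupCohomology.H0IsoOfIsTrivial (Rep.trivial ℤ G ℤ)).toLinearEquiv ≪≫ₗ
      (LinearEquiv.funUnique (Fin 1) ℤ ℤ).symm⟩
  induction d with
  | zero =>
    intro G _ e n
    cases n with
    | zero => exact h0 0 G
    | succ n =>
      have : Subsingleton G := e.toEquiv.subsingleton
      have hz := isZero_groupCohomology_succ_of_subsingleton (Rep.trivial ℤ G ℤ) n
      have := ModuleCat.subsingleton_of_isZero hz
      have : IsEmpty (Fin (Nat.choose 0 (n + 1))) := by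
        rw [Nat.choose_zero_succ]; infer_instance
      exact ⟨0, 0, fun _ => Subsingleton.elim _ _, fun _ => Subsingleton.elim _ _⟩
  | succ d ih =>
    intro G _ e n
    cases n with
    | zero => exact h0 _ G
    | succ n =>
      let φ : G →* Multiplicative ℤ :=
        (AddMonoidHom.toMultiplicative (Pi.evalAddMonoidHom (fun _ : Fin (d + 1) => ℤ) 0)).comp
          e.toMonoidHom
      let t : G := e.symm (Multiplicative.ofAdd (Pi.single 0 1))
      have ht : φ t = Multiplicative.ofAdd 1 := by
        simp [φ, t]
      have hφ : ∀ g, (φ g).toAdd = (e g).toAdd 0 := fun g => rfl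
      let eK : φ.ker ≃* Multiplicative (Fin d → ℤ) :=
        { toFun := fun s => Multiplicative.ofAdd (fun i => (e s.1).toAdd i.succ)
          invFun := fun v => ⟨e.symm (Multiplicative.ofAdd (Fin.cons 0 v.toAdd)), by
            rw [MonoidHom.mem_ker]
            apply Multiplicative.toAdd.injective
            rw [hφ]; simp⟩
          left_inv := by
            rintro ⟨s, hs⟩
            rw [MonoidHom.mem_ker] at hs
            have h1 := hφ s
            rw [hs] at h1
            apply Subtype.ext
            apply e.injective
            apply Multiplicative.toAdd.injective
            funext i
            refine Fin.cases ?_ (fun j => ?_) i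
            · simpa using h1
            · simp
          right_inv := by
            intro v
            apply Multiplicative.toAdd.injective
            funext i
            simp
          map_mul' := by
            intro a b
            apply Multiplicative.toAdd.injective
            funext i
            simp }
      have hX := auxX_shortExact φ t ht
      obtain ⟨eA⟩ := ih φ.ker eK n
      obtain ⟨eC⟩ := ih φ.ker eK (n + 1)
      let sA : groupCohomology (auxX φ.ker t).X₃ n ≃ₗ[ℤ] _ :=
        (groupCohomology.coindIso (Rep.trivial ℤ φ.ker ℤ) n).toLinearEquiv ≪≫ₗ eA
      let sC : groupCohomology (auxX φ.ker t).X₂ (n + 1) ≃ₗ[ℤ] _ :=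
        (groupCohomology.coindIso (Rep.trivial ℤ φ.ker ℤ) (n + 1)).toLinearEquiv ≪≫ₗ eC
      have hz : ∀ m, (groupCohomology.functor ℤ G m).map (auxX φ.ker t).g = 0 :=
        fun m => aux_map_zero t m _
      have e1 := groupCohomology.mapShortComplex₁_exact hX (i := n) rfl
      have e2 := groupCohomology.mapShortComplex₂_exact hX (n + 1)
      have e3 := groupCohomology.mapShortComplex₃_exact hX (i := n) rfl
      rw [ShortComplex.ShortExact.moduleCat_exact_iff_function_exact] at e1 e2 e3
      refine aux_split (groupCohomology.δ hX n (n + 1) rfl).hom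
        ((groupCohomology.functor ℤ G (n + 1)).map (auxX φ.ker t).f).hom ?_ ?_ e1 _ _ sA sC
      · rw [injective_iff_map_eq_zero]
        intro a ha
        obtain ⟨b, hb⟩ := (e3 a).1 ha
        rw [← hb]
        exact congrArg (fun q => q.hom b) (hz n)
      · intro c
        exact (e2 c).1 (congrArg (fun q => q.hom c) (hz (n + 1)))

/-- the group cohomology `H^n(ℤ^d, ℤ)` (trivial action) is a free abelian group
of rank `d.choose n`: it is isomorphic as an abelian group to `ℤ^(d choose n)`, and in
particular it vanishes for `n > d`. -/
theorem groupCohomology_zpow_trivial_int (d n : ℕ) :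
    Nonempty
      ((groupCohomology (Rep.trivial ℤ (Multiplicative (Fin d → ℤ)) ℤ) n : Type) ≃+
        (Fin (d.choose n) → ℤ)) ∧
    (d < n → ∀ x : groupCohomology (Rep.trivial ℤ (Multiplicative (Fin d → ℤ)) ℤ) n, x = 0) := by
  obtain ⟨e⟩ := aux_main d (Multiplicative (Fin d → ℤ)) (MulEquiv.refl _) n
  refine ⟨⟨e.toAddEquiv⟩, fun h x => ?_⟩
  have : IsEmpty (Fin (d.choose n)) := by
    rw [Nat.choose_eq_zero_of_lt h]; infer_instance
  exact e.injective (Subsingleton.elim _ _)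
end

section
/- Let R be a commutative ring in which 6 is a unit, and let M be any representation of SL(2,ℤ) on an R-module. Then for every n ≥ 2 the group cohomology H^n(SL(2,ℤ), M) vanishes. -/
namespace SLtwoZ
open Matrix

abbrev G := Matrix.SpecialLinearGroup (Fin 2) ℤ

def S : G := ⟨!![0, -1; 1, 0], by simp [Matrix.det_fin_two]⟩
def V : G := ⟨!![0, 1; -1, -1], by simp [Matrix.det_fin_two]⟩
def U : G := ⟨!![0, -1; 1, 1], by simp [Matrix.det_fin_two]⟩

lemma cS : (S : Matrix (Fin 2) (Fin 2) ℤ) = !![0, -1; 1, 0] := rfl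
lemma cV : (V : Matrix (Fin 2) (Fin 2) ℤ) = !![0, 1; -1, -1] := rfl
lemma cU : (U : Matrix (Fin 2) (Fin 2) ℤ) = !![0, -1; 1, 1] := rfl
lemma S00 (x : G) : (S * x) 0 0 = - x 1 0 := by simp [cS, Matrix.mul_apply, Fin.sum_univ_two]
lemma S01 (x : G) : (S * x) 0 1 = - x 1 1 := by simp [cS, Matrix.mul_apply, Fin.sum_univ_two]
lemma S10 (x : G) : (S * x) 1 0 = x 0 0 := by simp [cS, Matrix.mul_apply, Fin.sum_univ_two]
lemma S11 (x : G) : (S * x) 1 1 = x 0 1 := by simp [cS, Matrix.mul_apply, Fin.sum_univ_two]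
lemma V00 (x : G) : (V * x) 0 0 = x 1 0 := by simp [cV, Matrix.mul_apply, Fin.sum_univ_two]
lemma V01 (x : G) : (V * x) 0 1 = x 1 1 := by simp [cV, Matrix.mul_apply, Fin.sum_univ_two]
lemma V10 (x : G) : (V * x) 1 0 = - x 0 0 - x 1 0 := by
  simp [cV, Matrix.mul_apply, Fin.sum_univ_two]; ring
lemma V11 (x : G) : (V * x) 1 1 = - x 0 1 - x 1 1 := by
  simp [cV, Matrix.mul_apply, Fin.sum_univ_two]; ring
lemma N (x : G) (i j) : (-x : G) i j = - x i j := by simp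

lemma SS : S * S = -1 := by
  ext i j; fin_cases i <;> fin_cases j <;> simp [cS, Matrix.mul_apply, Fin.sum_univ_two]
lemma VVV : V * (V * V) = 1 := by
  ext i j; fin_cases i <;> fin_cases j <;> simp [cV, Matrix.mul_apply, Fin.sum_univ_two]
lemma U_eq : U = -V := by
  ext i j; fin_cases i <;> fin_cases j <;> simp [cV, cU]
lemma T_eq : S⁻¹ * U = ModularGroup.T := by
  rw [inv_mul_eq_iff_eq_mul]
  ext i j; fin_cases i <;> fin_cases j <;>
    simp [cS, cU, ModularGroup.coe_T, Matrix.mul_apply, Fin.sum_univ_two]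
lemma S_eq : S = ModularGroup.S := rfl

lemma S4 : S ^ 4 = 1 := by
  rw [show 4 = 2 * 2 from rfl, pow_mul, sq S, SS]; simp
lemma U6 : U ^ 6 = 1 := by
  rw [show 6 = 3 * 2 from rfl, pow_mul, pow_succ' U, sq U, U_eq]; simp [VVV]

lemma det (x : G) : x 0 0 * x 1 1 - x 0 1 * x 1 0 = 1 := by
  have := x.2; rwa [Matrix.det_fin_two] at this

def B (x : G) : ℤ := 2 * x 0 0 * x 1 0 + x 0 0 * x 1 1 + x 0 1 * x 1 0 + 2 * x 0 1 * x 1 1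
def q (a b : ℤ) : ℤ := a ^ 2 + a * b + b ^ 2
def h (x : G) : ℤ := q (x 0 0) (x 0 1) + q (x 1 0) (x 1 1) + q (x 0 0 + x 1 0) (x 0 1 + x 1 1)

lemma q_nonneg (a b : ℤ) : 0 ≤ q a b := by unfold q; nlinarith [sq_nonneg (a + b), sq_nonneg a, sq_nonneg b]
lemma h_nonneg (x : G) : 0 ≤ h x :=
  add_nonneg (add_nonneg (q_nonneg _ _) (q_nonneg _ _)) (q_nonneg _ _)
lemma h_V (x : G) : h (V * x) = h x := by
  simp only [h, q, V00, V01, V10, V11]; ring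
lemma h_N (x : G) : h (-x) = h x := by
  simp only [h, q, N]; ring
lemma h_S (x : G) : h (S * x) = h x - 2 * B x := by
  simp only [h, q, B, S00, S01, S10, S11]; ring
lemma B_S (x : G) : B (S * x) = - B x := by
  simp only [B, S00, S01, S10, S11]; ring
lemma B_N (x : G) : B (-x) = B x := by
  simp only [B, N]; ring
lemma B_ne (x : G) : B x ≠ 0 := by
  have := det x
  intro h0
  have h1 : B x = 2 * (x 0 0 * x 1 0 + x 0 1 * x 1 1 + x 0 1 * x 1 0) + 1 := by
    unfold B; linear_combination this
  omega
lemma B_V (x : G) : B (V * x) + B x = - 2 * q (x 1 0) (x 1 1) := by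
  simp only [B, q, V00, V01, V10, V11]; ring
lemma B_V_le (x : G) : B (V * x) + B x ≤ 0 := by
  rw [B_V]; linarith [q_nonneg (x 1 0) (x 1 1)]
lemma B_VV_le (x : G) : B (V * (V * x)) + B x ≤ 0 := by
  have := B_V_le (V * (V * x))
  rw [show V * (V * (V * x)) = x by rw [← mul_assoc V V, ← mul_assoc, mul_assoc V V, VVV, one_mul]] at this
  linarith
lemma lt_of_B {x y : G} (hB : 0 < B x) (hy : h x = h y) : (h (S * x)).toNat < (h y).toNat := by
  have := h_S x
  have := h_nonneg (S * x)
  omega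

open Classical in
noncomputable def bf {A : Type*} [AddCommGroup A] (c : G → A) (x : G) : A :=
  if h0 : 0 < B x then bf c (S * x) - c x
  else if h1 : 0 < B (V * x) then bf c (S * (V * x)) - c (V * x)
  else if h2 : 0 < B (V * (V * x)) then bf c (S * (V * (V * x))) - c (V * (V * x))
  else 0
termination_by (h x).toNat
decreasing_by
  · exact lt_of_B h0 rfl
  · exact lt_of_B h1 (h_V x)
  · exact lt_of_B h2 (by rw [h_V, h_V])

section
variable {A : Type*} [AddCommGroup A] (c : G → A)

lemma VVVx (x : G) : V * (V * (V * x)) = x := by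
  rw [← mul_assoc V V, ← mul_assoc, mul_assoc V V, VVV, one_mul]

lemma bf_V (x : G) : bf c (V * x) = bf c x := by
  have e0 := B_V_le x
  have e1 := B_V_le (V * x)
  have e2 := B_VV_le x
  rw [bf, bf.eq_1 c x, VVVx]
  split_ifs <;> first | rfl | omega

lemma bf_N (hc : ∀ x, c (-x) = c x) (x : G) : bf c (-x) = bf c x := by
  induction hn : (h x).toNat using Nat.strong_induction_on generalizing x with
  | _ n ih =>
  subst hn
  rw [bf, bf.eq_1 c x]
  simp only [mul_neg, B_N, hc]
  split_ifs with h0 h1 h2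
  · rw [ih _ (lt_of_B h0 rfl) _ rfl]
  · rw [ih _ (lt_of_B h1 (h_V x)) _ rfl]
  · rw [ih _ (lt_of_B h2 (by rw [h_V, h_V])) _ rfl]
  · rfl

lemma bf_S (hc : ∀ x, c (-x) = c x) (hS : ∀ x, c (S * x) = - c x) (x : G) :
    bf c (S * x) = bf c x + c x := by
  by_cases h0 : 0 < B x
  · rw [bf.eq_1 c x, dif_pos h0]; abel
  · have : 0 < B (S * x) := by have := B_ne x; rw [B_S]; omega
    rw [bf, dif_pos this, ← mul_assoc, SS, neg_one_mul, bf_N c hc, hS]; abel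
end

lemma forest {A : Type*} [AddCommGroup A] (f : G → A) (hf : ∀ x, f (-x) = f x) :
    ∃ b : G → A, (∀ x, b (U * x) = b x) ∧ ∀ x, b (S * x) + f (S * x) = b x + f x := by
  have hc : ∀ x, (fun x => f x - f (S * x)) (-x) = (fun x => f x - f (S * x)) x := by
    intro x; simp only [mul_neg, hf]
  refine ⟨bf (fun x => f x - f (S * x)), fun x => ?_, fun x => ?_⟩
  · rw [U_eq, neg_mul, bf_N _ hc, bf_V]
  · rw [bf_S _ hc]
    · abel
    · intro x
      simp only [← mul_assoc S S, SS, neg_one_mul, hf]; abel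

lemma gen (P : G → Prop) (h1 : P 1) (hS : ∀ x, P (S * x) ↔ P x) (hU : ∀ x, P (U * x) ↔ P x)
    (x : G) : P x := by
  have hT : ∀ x, P (ModularGroup.T * x) ↔ P x := by
    intro x
    rw [← T_eq, mul_assoc, ← hS, mul_inv_cancel_left, hU]
  have hx : x ∈ Subgroup.closure {ModularGroup.S, ModularGroup.T} := by
    rw [SpecialLinearGroup.SL2Z_generators]; trivial
  induction hx using Subgroup.closure_induction_left with
  | one => exact h1
  | mul_left y hy z hz ih =>
    rcases hy with rfl | rfl
    · exact (hS z).2 ih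
    · exact (hT z).2 ih
  | inv_mul_cancel y hy z hz ih =>
    rcases hy with rfl | rfl
    · rw [← hS, ← S_eq, mul_inv_cancel_left]; exact ih
    · rw [← hT, mul_inv_cancel_left]; exact ih


open CategoryTheory CategoryTheory.Limits

section coh
variable {R : Type} [CommRing R]

/-- right translation -/
def rt (N : Type) [AddCommGroup N] [Module R N] : Representation R G (G → N) where
  toFun g := LinearMap.funLeft R N (· * g)
  map_one' := by ext; simp
  map_mul' _ _ := by ext; simp [mul_assoc]

lemma rt_apply (N : Type) [AddCommGroup N] [Module R N] (g : G) (f : G → N) (x : G) :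
    rt (R := R) N g f x = f (x * g) := rfl

lemma vanish_of_retract {X Y : Rep.{0} R G} (i : X ⟶ Y) (r : Y ⟶ X) (hir : i ≫ r = 𝟙 X) (n : ℕ)
    (hY : IsZero (groupCohomology Y n)) : IsZero (groupCohomology X n) := by
  have h2 := groupCohomology.map_id_comp i r n
  rw [hir, groupCohomology.map_id] at h2
  refine (IsZero.iff_id_eq_zero _).2 (h2.trans ?_)
  have h3 : groupCohomology.map (MonoidHom.id G) i n = 0 := hY.eq_of_tgt _ _
  exact (congrArg (· ≫ groupCohomology.map (MonoidHom.id G) r n) h3).trans zero_comp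

lemma vanish_rt (N : Type) [AddCommGroup N] [Module R N] (n : ℕ) :
    IsZero (groupCohomology (Rep.of (rt (R := R) N)) (n + 1)) := by
  let A : Rep R (⊥ : Subgroup G) := Rep.trivial R (⊥ : Subgroup G) N
  have h0 : IsZero (groupCohomology A (n + 1)) := isZero_groupCohomology_succ_of_subsingleton A n
  have h1 : IsZero (groupCohomology (Rep.coind (⊥ : Subgroup G).subtype A) (n + 1)) :=
    h0.of_iso (groupCohomology.coindIso A (n + 1))
  let l : (G → N) →ₗ[R] A.ρ.coindV (⊥ : Subgroup G).subtype :=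
    LinearMap.codRestrict _ LinearMap.id (fun f g x => by
      have : g = 1 := Subsingleton.elim _ _
      subst this; simp [A])
  let i : Rep.of (rt (R := R) N) ⟶ Rep.coind (⊥ : Subgroup G).subtype A :=
    Rep.ofHom ⟨l, fun g => by ext; rfl⟩
  let r : Rep.coind (⊥ : Subgroup G).subtype A ⟶ Rep.of (rt (R := R) N) :=
    Rep.ofHom ⟨Submodule.subtype _, fun g => by ext; rfl⟩
  have hir : i ≫ r = 𝟙 _ := by ext; rfl
  exact vanish_of_retract i r hir _ h1

lemma vanish_retract {X : Rep.{0} R G} (N : Type) [AddCommGroup N] [Module R N]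
    (i : X ⟶ Rep.of (rt (R := R) N)) (r : Rep.of (rt (R := R) N) ⟶ X) (hir : i ≫ r = 𝟙 X) (n : ℕ) :
    IsZero (groupCohomology X (n + 1)) :=
  vanish_of_retract i r hir _ (vanish_rt N n)

section avg
variable {M : Type} [AddCommGroup M] [Module R M] (ρ : Representation R G M)

/-- averaging -/
def avg (c : R) (s : G) (m : ℕ) : (G → M) →ₗ[R] (G → M) :=
  c • ∑ i ∈ Finset.range m, LinearMap.pi fun x => ρ (s⁻¹ ^ i) ∘ₗ LinearMap.proj (s ^ i * x)

lemma avg_apply (c : R) (s : G) (m : ℕ) (f : G → M) (x : G) :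
    avg ρ c s m f x = c • ∑ i ∈ Finset.range m, ρ (s⁻¹ ^ i) (f (s ^ i * x)) := by
  simp [avg]

lemma avg_rt (c : R) (s : G) (m : ℕ) (f : G → M) (g : G) :
    avg ρ c s m (rt (R := R) M g f) = rt (R := R) M g (avg ρ c s m f) := by
  ext x
  simp only [avg_apply, rt_apply, mul_assoc]

lemma avg_mem (c : R) (s : G) (m : ℕ) (hs : s ^ m = 1) (f : G → M) (x : G) :
    avg ρ c s m f (s * x) = ρ s (avg ρ c s m f x) := by
  simp only [avg_apply, map_smul, map_sum]
  congr 1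
  have key : ∀ i, ρ (s⁻¹ ^ i) (f (s ^ i * (s * x))) =
      ρ s (ρ (s⁻¹ ^ (i + 1)) (f (s ^ (i + 1) * x))) := by
    intro i
    rw [← Module.End.mul_apply, ← map_mul, pow_succ' s⁻¹, mul_inv_cancel_left, pow_succ, mul_assoc]
  simp only [key]
  have := Finset.sum_range_succ (fun i => ρ s (ρ (s⁻¹ ^ i) (f (s ^ i * x)))) m
  rw [Finset.sum_range_succ'] at this
  simpa [hs] using this

lemma avg_id (c : R) (s : G) (m : ℕ) (hc : c * m = 1) (f : G → M)
    (hf : ∀ x, f (s * x) = ρ s (f x)) : avg ρ c s m f = f := by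
  have key : ∀ (i : ℕ) x, f (s ^ i * x) = ρ (s ^ i) (f x) := by
    intro i
    induction i with
    | zero => simp
    | succ i ih => intro x; rw [pow_succ, mul_assoc, ih, hf, ← Module.End.mul_apply, ← map_mul]
  ext x
  rw [avg_apply]
  have : ∀ i ∈ Finset.range m, ρ (s⁻¹ ^ i) (f (s ^ i * x)) = f x := by
    intro i _
    rw [key, ← Module.End.mul_apply, ← map_mul]; simp
  rw [Finset.sum_congr rfl this]
  simp [← Nat.cast_smul_eq_nsmul R, smul_smul, hc]

def W3 : Submodule R (G → M) where
  carrier := {f | ∀ x, f (-1 * x) = ρ (-1) (f x)}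
  add_mem' h1 h2 x := by simp only [Pi.add_apply, map_add, h1 x, h2 x]
  zero_mem' x := by simp
  smul_mem' r f h x := by simp only [Pi.smul_apply, map_smul, h x]

def W2 : Submodule R (G → M × M) where
  carrier := {f | ∀ x, (f (S * x)).1 = ρ S (f x).1 ∧ (f (U * x)).2 = ρ U (f x).2}
  add_mem' h1 h2 x := by simp [h1 x, h2 x]
  zero_mem' x := by simp
  smul_mem' r f h x := by simp [h x]

def X3 : Rep.{0} R G := Rep.of ((rt (R := R) M).subrepresentation (W3 ρ) (fun g f hf x => by
  have := hf (x * g)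
  simpa [rt_apply, mul_assoc] using this))

def X2 : Rep.{0} R G := Rep.of ((rt (R := R) (M × M)).subrepresentation (W2 ρ) (fun g f hf x => by
  have := hf (x * g)
  simpa [rt_apply, mul_assoc] using this))

lemma vanish3 (h6 : IsUnit (6 : R)) (n : ℕ) : IsZero (groupCohomology (X3 ρ) (n + 1)) := by
  obtain ⟨d, hd⟩ := h6.exists_left_inv
  have hc : (3 * d) * ((2 : ℕ) : R) = 1 := by rw [← hd]; push_cast; ring
  refine vanish_retract M
    (Rep.ofHom ⟨(W3 ρ).subtype, fun g => by ext; rfl⟩)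
    (Rep.ofHom ⟨LinearMap.codRestrict (W3 ρ) (avg ρ (3 * d) (-1) 2)
      (fun f x => avg_mem ρ _ _ 2 (by simp) f x), fun g => ?_⟩) ?_ n
  · refine LinearMap.ext fun f => Subtype.ext ?_
    exact avg_rt ρ _ _ _ f g
  · refine Rep.hom_ext ?_
    refine Representation.IntertwiningMap.ext (LinearMap.ext fun f => Subtype.ext ?_)
    exact avg_id ρ _ _ _ hc _ f.2

def avg2 (c c' : R) : (G → M × M) →ₗ[R] (G → M × M) :=
  LinearMap.pi fun x => LinearMap.prod
    (LinearMap.proj x ∘ₗ avg ρ c S 4 ∘ₗ (LinearMap.fst R M M).compLeft G)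
    (LinearMap.proj x ∘ₗ avg ρ c' U 6 ∘ₗ (LinearMap.snd R M M).compLeft G)

lemma avg2_apply (c c' : R) (f : G → M × M) (x : G) : avg2 ρ c c' f x =
    (avg ρ c S 4 (fun y => (f y).1) x, avg ρ c' U 6 (fun y => (f y).2) x) := rfl

lemma vanish2 (h6 : IsUnit (6 : R)) (n : ℕ) : IsZero (groupCohomology (X2 ρ) (n + 1)) := by
  obtain ⟨d, hd⟩ := h6.exists_left_inv
  have hc : (9 * d ^ 2) * ((4 : ℕ) : R) = 1 := by
    push_cast; linear_combination (d * 6 + 1) * hd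
  have hc' : d * ((6 : ℕ) : R) = 1 := by rw [← hd]; push_cast; ring
  refine vanish_retract (M × M)
    (Rep.ofHom ⟨(W2 ρ).subtype, fun g => by ext <;> rfl⟩)
    (Rep.ofHom ⟨LinearMap.codRestrict (W2 ρ) (avg2 ρ (9 * d ^ 2) d)
      (fun f x => ⟨avg_mem ρ _ _ 4 S4 _ x, avg_mem ρ _ _ 6 U6 _ x⟩), fun g => ?_⟩) ?_ n
  · refine LinearMap.ext fun f => Subtype.ext ?_
    funext x
    exact Prod.ext (congrFun (avg_rt ρ _ _ _ (fun y => (f y).1) g) x)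
      (congrFun (avg_rt ρ _ _ _ (fun y => (f y).2) g) x)
  · refine Rep.hom_ext ?_
    refine Representation.IntertwiningMap.ext (LinearMap.ext fun f => Subtype.ext ?_)
    funext x
    exact Prod.ext (congrFun (avg_id ρ _ _ _ hc (fun y => (f.1 y).1) (fun y => (f.2 y).1)) x)
      (congrFun (avg_id ρ _ _ _ hc' (fun y => (f.1 y).2) (fun y => (f.2 y).2)) x)

def mapF : M →ₗ[R] W2 ρ :=
  LinearMap.codRestrict (W2 ρ) (LinearMap.pi fun x => LinearMap.prod (ρ x) (ρ x))
    (fun m x => by simp)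

lemma inv_S {f : G → M} (hf : ∀ x, f (S * x) = ρ S (f x)) (x : G) :
    f (-1 * x) = ρ (-1) (f x) := by
  rw [← SS, mul_assoc, hf, hf, map_mul]; rfl

lemma UUU : U * (U * U) = -1 := by rw [U_eq]; simp [VVV]

lemma inv_U {f : G → M} (hf : ∀ x, f (U * x) = ρ U (f x)) (x : G) :
    f (-1 * x) = ρ (-1) (f x) := by
  rw [← UUU, mul_assoc, mul_assoc, hf, hf, hf, map_mul, map_mul]; rfl

def mapG : W2 ρ →ₗ[R] W3 ρ :=
  LinearMap.codRestrict (W3 ρ)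
    ((LinearMap.fst R M M - LinearMap.snd R M M).compLeft G ∘ₗ (W2 ρ).subtype)
    (fun f x => by
      have h1 := inv_S ρ (f := fun y => (f.1 y).1) (fun y => (f.2 y).1) x
      have h2 := inv_U ρ (f := fun y => (f.1 y).2) (fun y => (f.2 y).2) x
      change (f.1 (-1 * x)).1 - (f.1 (-1 * x)).2 = ρ (-1) ((f.1 x).1 - (f.1 x).2)
      rw [map_sub]; exact congrArg₂ (· - ·) h1 h2)

lemma mapF_inj : Function.Injective (mapF ρ) := by
  intro a b hab
  have : (mapF ρ a).1 1 = (mapF ρ b).1 1 := by rw [hab]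
  have : ρ 1 a = ρ 1 b := congrArg Prod.fst this
  simpa using this

lemma mapG_surj : Function.Surjective (mapG ρ) := by
  intro f
  obtain ⟨b, hU, hS⟩ := forest (fun x => ρ x⁻¹ (f.1 x)) (fun x => by
    have := f.2 x
    rw [neg_one_mul] at this
    rw [this, ← Module.End.mul_apply, ← map_mul]
    congr 2
    rw [inv_mul_eq_iff_eq_mul.2]
    simp)
  refine ⟨⟨fun x => (ρ x (b x + ρ x⁻¹ (f.1 x)), ρ x (b x)), fun x => ⟨?_, ?_⟩⟩, ?_⟩
  · simp only at hS ⊢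
    rw [hS, map_mul]; rfl
  · simp only
    rw [hU, map_mul]; rfl
  · refine Subtype.ext (funext fun x => ?_)
    change ρ x (b x + ρ x⁻¹ (f.1 x)) - ρ x (b x) = f.1 x
    simp

lemma map_exact (f : W2 ρ) (hf : mapG ρ f = 0) : ∃ m, mapF ρ m = f := by
  have e : ∀ x, (f.1 x).1 = (f.1 x).2 := fun x =>
    sub_eq_zero.1 (congrFun (congrArg Subtype.val hf) x)
  have hS : ∀ x, (f.1 (S * x)).1 = ρ S (f.1 x).1 := fun x => (f.2 x).1
  have hU : ∀ x, (f.1 (U * x)).1 = ρ U (f.1 x).1 := fun x => by rw [e, e]; exact (f.2 x).2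
  have inj : ∀ g : G, Function.Injective (ρ g) := fun g a b hab => by
    simpa using congrArg (ρ g⁻¹) hab
  have key : ∀ x, (f.1 x).1 = ρ x (f.1 1).1 := gen _ (by simp)
    (fun x => by rw [hS, map_mul, Module.End.mul_apply, (inj S).eq_iff])
    (fun x => by rw [hU, map_mul, Module.End.mul_apply, (inj U).eq_iff])
  refine ⟨(f.1 1).1, Subtype.ext (funext fun x => Prod.ext ?_ ?_)⟩
  · exact (key x).symm
  · rw [← e]; exact (key x).symm

end avg

def sc (M : Rep.{0} R G) : ShortComplex (Rep.{0} R G) where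
  X₁ := M
  X₂ := X2 M.ρ
  X₃ := X3 M.ρ
  f := Rep.ofHom ⟨mapF M.ρ, fun g => by
    refine LinearMap.ext fun m => Subtype.ext (funext fun x => ?_)
    change (M.ρ x (M.ρ g m), M.ρ x (M.ρ g m)) = (M.ρ (x * g) m, M.ρ (x * g) m)
    rw [map_mul]; rfl⟩
  g := Rep.ofHom ⟨mapG M.ρ, fun g => rfl⟩
  zero := by
    refine Rep.hom_ext (Representation.IntertwiningMap.ext
      (LinearMap.ext fun m => Subtype.ext (funext fun x => ?_)))
    exact sub_self (M.ρ x m)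

lemma sc_exact (M : Rep.{0} R G) : (sc M).ShortExact where
  exact := by
    rw [← ShortComplex.exact_map_iff_of_faithful _ (forget₂ (Rep.{0} R G) (ModuleCat R))]
    rw [ShortComplex.moduleCat_exact_iff]
    exact fun f hf => map_exact M.ρ f hf
  mono_f := (Rep.mono_iff_injective _).2 (mapF_inj M.ρ)
  epi_g := (Rep.epi_iff_surjective _).2 (mapG_surj M.ρ)

end coh

end SLtwoZ

/-- if `R` is a commutative ring in which `6` is a unit and `M` is any
representation of `SL(2,ℤ)` on an `R`-module, then `H^n(SL(2,ℤ), M) = 0` for all `n ≥ 2`. -/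
theorem groupCohomology_SL2Z_vanishes_of_isUnit_six (R : Type) [CommRing R]
    (h6 : IsUnit (6 : R)) (M : Rep R (Matrix.SpecialLinearGroup (Fin 2) ℤ))
    (n : ℕ) (hn : 2 ≤ n) :
    ∀ x : groupCohomology M n, x = 0 := by
  obtain ⟨n, rfl⟩ := Nat.exists_eq_add_of_le' hn
  have e := groupCohomology.epi_δ_of_isZero (SLtwoZ.sc_exact M) (n + 1)
    (SLtwoZ.vanish2 M.ρ h6 (n + 1))
  have z : CategoryTheory.Limits.IsZero (groupCohomology M (n + 2)) :=
    @CategoryTheory.Limits.IsZero.of_epi _ _ _ _ _ _ e (SLtwoZ.vanish3 M.ρ h6 n)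
  intro x
  have := ModuleCat.subsingleton_of_isZero z
  exact Subsingleton.elim _ _
end

section
/- Let SL(2,ℤ) act trivially on ℤ. Then the group cohomology groups H^n(SL(2,ℤ), ℤ) satisfy: H^0 ≅ ℤ, H^1 = 0, H^2 ≅ ℤ/12ℤ, H^3 = 0, H^4 ≅ ℤ/12ℤ, and H^5 = 0. -/
namespace SL2Zcoh

abbrev G := Matrix.SpecialLinearGroup (Fin 2) ℤ

def s : G := ⟨!![0, -1; 1, 0], by decide⟩
def t : G := ⟨!![0, -1; 1, 1], by decide⟩
def z : G := ⟨!![-1, 0; 0, -1], by decide⟩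
def u : G := ⟨!![1, 1; 0, 1], by decide⟩
def v : G := ⟨!![1, 0; 1, 1], by decide⟩

lemma mul_s_0 (x : G) (i : Fin 2) : (x * s).1 i 0 = x.1 i 1 := by
  rw [Matrix.SpecialLinearGroup.coe_mul, Matrix.mul_apply, Fin.sum_univ_two]; simp [s]
lemma mul_s_1 (x : G) (i : Fin 2) : (x * s).1 i 1 = - x.1 i 0 := by
  rw [Matrix.SpecialLinearGroup.coe_mul, Matrix.mul_apply, Fin.sum_univ_two]; simp [s]
lemma t_mul_0 (x : G) (i : Fin 2) : (t * x).1 0 i = - x.1 1 i := by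
  rw [Matrix.SpecialLinearGroup.coe_mul, Matrix.mul_apply, Fin.sum_univ_two]; simp [t]
lemma t_mul_1 (x : G) (i : Fin 2) : (t * x).1 1 i = x.1 0 i + x.1 1 i := by
  rw [Matrix.SpecialLinearGroup.coe_mul, Matrix.mul_apply, Fin.sum_univ_two]; simp [t]
lemma z_mul_0 (x : G) (i : Fin 2) : (z * x).1 0 i = - x.1 0 i := by
  rw [Matrix.SpecialLinearGroup.coe_mul, Matrix.mul_apply, Fin.sum_univ_two]; simp [z]
lemma z_mul_1 (x : G) (i : Fin 2) : (z * x).1 1 i = - x.1 1 i := by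
  rw [Matrix.SpecialLinearGroup.coe_mul, Matrix.mul_apply, Fin.sum_univ_two]; simp [z]
lemma mul_u_0 (x : G) (i : Fin 2) : (x * u).1 i 0 = x.1 i 0 := by
  rw [Matrix.SpecialLinearGroup.coe_mul, Matrix.mul_apply, Fin.sum_univ_two]; simp [u]
lemma mul_u_1 (x : G) (i : Fin 2) : (x * u).1 i 1 = x.1 i 0 + x.1 i 1 := by
  rw [Matrix.SpecialLinearGroup.coe_mul, Matrix.mul_apply, Fin.sum_univ_two]; simp [u]
lemma mul_v_0 (x : G) (i : Fin 2) : (x * v).1 i 0 = x.1 i 0 + x.1 i 1 := by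
  rw [Matrix.SpecialLinearGroup.coe_mul, Matrix.mul_apply, Fin.sum_univ_two]; simp [v]
lemma mul_v_1 (x : G) (i : Fin 2) : (x * v).1 i 1 = x.1 i 1 := by
  rw [Matrix.SpecialLinearGroup.coe_mul, Matrix.mul_apply, Fin.sum_univ_two]; simp [v]

lemma s_sq : s ^ 2 = z := by decide
lemma t_cube : t ^ 3 = z := by decide
lemma s_four : s ^ 4 = 1 := by decide
lemma t_six : t ^ 6 = 1 := by decide

lemma gen : Subgroup.closure {s, t} = (⊤ : Subgroup G) := by
  rw [eq_top_iff, ← _root_.SpecialLinearGroup.SL2Z_generators, Subgroup.closure_le]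
  have hs : s ∈ Subgroup.closure {s, t} := Subgroup.subset_closure (by simp)
  have ht : t ∈ Subgroup.closure {s, t} := Subgroup.subset_closure (by simp)
  rintro x (rfl | rfl)
  · exact hs
  · have : ModularGroup.T = s⁻¹ * t := by decide
    rw [this]
    exact mul_mem (inv_mem hs) ht

inductive W {Γ : Type*} [Group Γ] (S T : Γ) : Γ → Prop
  | one : W S T 1
  | mulU (w : Γ) : W S T w → W S T (w * (S ^ 2 * S * T))
  | mulV (w : Γ) : W S T w → W S T (w * (S ^ 2 * S * T ^ 2))

lemma W_mat {Γ : Type*} [Group Γ] {S T : Γ} (π : Γ →* G) (hs : π S = s) (ht : π T = t)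
    {w : Γ} (h : W S T w) :
    0 ≤ (π w).1 0 0 ∧ 0 ≤ (π w).1 0 1 ∧ 0 ≤ (π w).1 1 0 ∧ 0 ≤ (π w).1 1 1 ∧
    (w = 1 ∨ 3 ≤ (π w).1 0 0 + (π w).1 0 1 + (π w).1 1 0 + (π w).1 1 1) := by
  have key : ∀ w : Γ, (0 ≤ (π w).1 0 0 ∧ 0 ≤ (π w).1 0 1 ∧ 0 ≤ (π w).1 1 0 ∧ 0 ≤ (π w).1 1 1) →
      1 ≤ (π w).1 0 0 + (π w).1 1 0 ∧ 1 ≤ (π w).1 0 1 + (π w).1 1 1 := by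
    rintro w ⟨h1, h2, h3, h4⟩
    have hd := (π w).2
    rw [Matrix.det_fin_two] at hd
    constructor
    · by_contra hc
      have e1 : (π w).1 0 0 = 0 := by omega
      have e2 : (π w).1 1 0 = 0 := by omega
      rw [e1, e2] at hd
      simp at hd
    · by_contra hc
      have e1 : (π w).1 0 1 = 0 := by omega
      have e2 : (π w).1 1 1 = 0 := by omega
      rw [e1, e2] at hd
      simp at hd
  induction h with
  | one => simp
  | mulU w _ ih =>
    obtain ⟨h1, h2, h3, h4, -⟩ := ih
    obtain ⟨k1, k2⟩ := key w ⟨h1, h2, h3, h4⟩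
    have hu : s ^ 2 * s * t = u := by decide
    simp only [map_mul, map_pow, hs, ht, hu]
    simp only [mul_u_0, mul_u_1, mul_v_0, mul_v_1]
    refine ⟨?_, ?_, ?_, ?_, Or.inr ?_⟩ <;> omega
  | mulV w _ ih =>
    obtain ⟨h1, h2, h3, h4, -⟩ := ih
    obtain ⟨k1, k2⟩ := key w ⟨h1, h2, h3, h4⟩
    have hu : s ^ 2 * s * t ^ 2 = v := by decide
    simp only [map_mul, map_pow, hs, ht, hu]
    simp only [mul_u_0, mul_u_1, mul_v_0, mul_v_1]
    refine ⟨?_, ?_, ?_, ?_, Or.inr ?_⟩ <;> omega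

def NF {Γ : Type*} [Group Γ] (S T : Γ) (g : Γ) : Prop :=
  ∃ (e i j : ℕ) (w : Γ), e < 2 ∧ i < 3 ∧ j < 2 ∧ W S T w ∧ g = (S ^ 2) ^ e * (T ^ i * w * S ^ j)

section
variable {Γ : Type*} [Group Γ] {S T : Γ} (hS : S ^ 4 = 1) (hST : S ^ 2 = T ^ 3)
include hS hST

lemma NF_z {g : Γ} (h : NF S T g) : NF S T (S ^ 2 * g) := by
  obtain ⟨e, i, j, w, he, hi, hj, hw, rfl⟩ := h
  interval_cases e
  · exact ⟨1, i, j, w, by simp, hi, hj, hw, by simp⟩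
  · exact ⟨0, i, j, w, by simp, hi, hj, hw, by rw [← mul_assoc, ← pow_succ', ← pow_mul]; simp [hS]⟩

omit hS in
lemma z_comm_S : Commute (S ^ 2) S := (Commute.refl S).pow_left 2
omit hS in
lemma z_comm_T : Commute (S ^ 2) T := hST ▸ (Commute.refl T).pow_left 3

omit hS in
lemma z_comm_W {w : Γ} (h : W S T w) : Commute (S ^ 2) w := by
  have h1 := z_comm_S hST
  have h2 := z_comm_T hST
  induction h with
  | one => exact Commute.one_right _
  | mulU w _ ih => exact ih.mul_right ((((Commute.refl _).mul_right h1)).mul_right h2)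
  | mulV w _ ih => exact ih.mul_right ((((Commute.refl _).mul_right h1)).mul_right (h2.pow_right 2))

lemma NF_pow_z {g : Γ} (e : ℕ) (h : NF S T g) : NF S T ((S ^ 2) ^ e * g) := by
  induction e with
  | zero => simpa
  | succ n ih => rw [pow_succ', mul_assoc]; exact NF_z hS hST ih

lemma NF_S {g : Γ} (h : NF S T g) : NF S T (g * S) := by
  obtain ⟨e, i, j, w, he, hi, hj, hw, rfl⟩ := h
  rw [mul_assoc]
  apply NF_pow_z hS hST
  interval_cases j
  · exact ⟨0, i, 1, w, by simp, hi, by simp, hw, by simp⟩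
  · have : T ^ i * w * S ^ 1 * S = S ^ 2 * (T ^ i * w) := by
      have := (((z_comm_T hST).pow_right i).mul_right (z_comm_W hST hw)).eq
      rw [this, pow_one, mul_assoc _ S S, ← sq]
    rw [this]
    exact NF_z hS hST ⟨0, i, 0, w, by simp, hi, by simp, hw, by simp⟩

lemma NF_T {g : Γ} (h : NF S T g) : NF S T (g * T) := by
  obtain ⟨e, i, j, w, he, hi, hj, hw, rfl⟩ := h
  rw [mul_assoc]
  apply NF_pow_z hS hST
  have z2 : S ^ 2 * S ^ 2 = 1 := by rw [← pow_add, hS]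
  interval_cases j
  · cases hw with
    | one =>
      by_cases h2 : i = 2
      · subst h2
        have : T ^ 2 * 1 * S ^ 0 * T = S ^ 2 * 1 := by rw [hST]; simp [pow_succ]
        rw [this]
        exact NF_z hS hST ⟨0, 0, 0, 1, by simp, by simp, by simp, .one, by simp⟩
      · exact ⟨0, i + 1, 0, 1, by simp, by omega, by simp, .one, by simp [pow_succ]⟩
    | mulU w hw =>
      exact ⟨0, i, 0, _, by simp, hi, by simp, .mulV w hw, by simp [pow_succ, mul_assoc]⟩
    | mulV w hw =>
      refine ⟨0, i, 1, w, by simp, hi, by simp, hw, ?_⟩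
      have : S ^ 2 * S * T ^ 2 * T = S := by
        rw [mul_assoc _ (T ^ 2), ← pow_succ T, ← hST, mul_assoc, ← (z_comm_S hST).eq, ← mul_assoc, z2, one_mul]
      simp only [pow_zero, mul_one, one_mul, pow_one]
      rw [mul_assoc, mul_assoc w, this, mul_assoc]
  · have : T ^ i * w * S ^ 1 * T = S ^ 2 * (T ^ i * (w * (S ^ 2 * S * T))) := by
      have h1 := (((z_comm_T hST).pow_right i).mul_right (z_comm_W hST hw)).eq
      rw [← mul_assoc (T ^ i), ← mul_assoc, h1, mul_assoc _ (S ^ 2), ← mul_assoc (S ^ 2),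
        ← mul_assoc (S ^ 2), z2]
      simp [mul_assoc]
    rw [this]
    exact NF_z hS hST ⟨0, i, 0, _, by simp, hi, by simp, .mulU w hw, by simp⟩

lemma NF_all (hgen : Subgroup.closure {S, T} = ⊤) (g : Γ) : NF S T g := by
  have hT : T ^ 6 = 1 := by
    have : T ^ 6 = (T ^ 3) ^ 2 := by rw [← pow_mul]
    rw [this, ← hST, ← pow_mul, hS]
  have hg : g ∈ Subgroup.closure {S, T} := hgen ▸ Subgroup.mem_top g
  induction hg using Subgroup.closure_induction_right with
  | one => exact ⟨0, 0, 0, 1, by simp, by simp, by simp, .one, by simp⟩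
  | mul_right x _ y hy ih =>
    rcases hy with rfl | rfl
    · exact NF_S hS hST ih
    · exact NF_T hS hST ih
  | mul_inv_cancel x _ y hy ih =>
    rcases hy with rfl | rfl
    · have : y⁻¹ = y * y * y := by
        rw [inv_eq_iff_mul_eq_one, ← hS]; simp [pow_succ, mul_assoc]
      rw [this]; simp only [← mul_assoc]
      exact NF_S hS hST (NF_S hS hST (NF_S hS hST ih))
    · have : y⁻¹ = y * y * y * y * y := by
        rw [inv_eq_iff_mul_eq_one, ← hT]; simp [pow_succ, mul_assoc]
      rw [this]; simp only [← mul_assoc]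
      exact NF_T hS hST (NF_T hS hST (NF_T hS hST (NF_T hS hST (NF_T hS hST ih))))

lemma pres_inj (hgen : Subgroup.closure {S, T} = ⊤) (π : Γ →* G) (hs : π S = s) (ht : π T = t) :
    Function.Injective π := by
  rw [injective_iff_map_eq_one]
  intro g hg
  obtain ⟨e, i, j, w, he, hi, hj, hw, rfl⟩ := NF_all hS hST hgen g
  obtain ⟨h1, h2, h3, h4, h5⟩ := W_mat π hs ht hw
  simp only [map_mul, map_pow, hs, ht] at hg
  generalize π w = m at *
  have a00 := congrArg (fun x : G => x.1 0 0) hg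
  have a01 := congrArg (fun x : G => x.1 0 1) hg
  have a10 := congrArg (fun x : G => x.1 1 0) hg
  have a11 := congrArg (fun x : G => x.1 1 1) hg
  rw [s_sq] at a00 a01 a10 a11
  clear hg
  have one00 : (1 : G).1 0 0 = 1 := rfl
  have one01 : (1 : G).1 0 1 = 0 := rfl
  have one10 : (1 : G).1 1 0 = 0 := rfl
  have one11 : (1 : G).1 1 1 = 1 := rfl
  have main : e = 0 ∧ i = 0 ∧ j = 0 ∧ w = 1 := by
    interval_cases e <;> interval_cases i <;> interval_cases j <;>
      simp only [pow_zero, pow_one, pow_two, one_mul, mul_one, mul_assoc t t, t_mul_0, t_mul_1, z_mul_0,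
        z_mul_1, mul_s_0, mul_s_1, one00, one01, one10, one11] at a00 a01 a10 a11 <;>
      rcases h5 with h5 | h5 <;> first | (exfalso; omega) | skip
    all_goals simp_all
  obtain ⟨rfl, rfl, rfl, rfl⟩ := main
  simp
end

lemma exists_hom {K : Type*} [Group K] {S T : K} (hS : S ^ 4 = 1) (hST : S ^ 2 = T ^ 3) :
    ∃ f : G →* K, f s = S ∧ f t = T := by
  let Γ : Subgroup (K × G) := Subgroup.closure {(S, s), (T, t)}
  let S' : Γ := ⟨(S, s), Subgroup.subset_closure (by simp)⟩
  let T' : Γ := ⟨(T, t), Subgroup.subset_closure (by simp)⟩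
  let π : Γ →* G := (MonoidHom.snd K G).comp Γ.subtype
  have hgen : Subgroup.closure {S', T'} = ⊤ := by
    have := Subgroup.closure_closure_coe_preimage (k := ({(S, s), (T, t)} : Set (K × G)))
    rw [← this]
    congr 1
    ext ⟨x, hx⟩
    simp [S', T']
  have hinj : Function.Injective π := by
    apply pres_inj (S := S') (T := T') _ _ hgen π rfl rfl
    · ext <;> simp [S', hS, s_four]
    · ext <;> simp [S', T', hST, s_sq, t_cube]
  have hsurj : Function.Surjective π := by
    rw [← MonoidHom.range_eq_top, eq_top_iff, ← gen, Subgroup.closure_le]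
    rintro x (rfl | rfl)
    · exact ⟨S', rfl⟩
    · exact ⟨T', rfl⟩
  let E := MulEquiv.ofBijective π ⟨hinj, hsurj⟩
  refine ⟨((MonoidHom.fst K G).comp Γ.subtype).comp E.symm.toMonoidHom, ?_, ?_⟩
  · have : E.symm s = S' := by rw [MulEquiv.symm_apply_eq]; rfl
    simp [this, S']
  · have : E.symm t = T' := by rw [MulEquiv.symm_apply_eq]; rfl
    simp [this, T']

end SL2Zcoh

namespace SL2Zcoh

abbrev A := MonoidAlgebra ℤ G

noncomputable def o (g : G) : A := MonoidAlgebra.of ℤ G g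

lemma o_mul (g h : G) : o (g * h) = o g * o h := map_mul _ _ _
lemma o_one : o 1 = 1 := map_one _
lemma o_pow (g : G) (n : ℕ) : o (g ^ n) = o g ^ n := map_pow _ _ _

lemma A_ind {P : A → Prop} (h1 : ∀ g, P (o g)) (h2 : ∀ a b, P a → P b → P (a + b))
    (h3 : ∀ a, P a → P (-a)) (a : A) : P a := by
  induction a using MonoidAlgebra.induction_on with
  | of g => exact h1 g
  | add a b ha hb => exact h2 a b ha hb
  | smul r f hf =>
    have h0 : P 0 := by simpa using h2 _ _ hf (h3 _ hf)
    induction r with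
    | zero => simpa using h0
    | succ n ih => rw [add_smul, one_smul]; exact h2 _ _ ih hf
    | pred n ih => rw [sub_smul, one_smul, sub_eq_add_neg]; exact h2 _ _ ih (h3 _ hf)

lemma hom_ext' {M : Type*} [AddCommGroup M] {f f' : A →+ M} (h : ∀ g, f (o g) = f' (o g)) :
    f = f' := by
  refine DFunLike.ext _ _ fun a => ?_
  induction a using A_ind with
  | h1 g => exact h g
  | h2 a b ha hb => simp [ha, hb]
  | h3 a ha => simp [ha]

lemma exists_lift {M : Type*} [AddCommGroup M] (F : G → M) : ∃ f : A →+ M, ∀ g, f (o g) = F g := by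
  refine ⟨((Finsupp.linearCombination ℤ F) ∘ₗ
        (MonoidAlgebra.coeffLinearEquiv ℤ).toLinearMap).toAddMonoidHom, fun g => ?_⟩
  simp [o]

section cyc
variable (x : G)

noncomputable def rep (g : G) : G := (QuotientGroup.mk g : G ⧸ Subgroup.zpowers x).out

lemma rep_mul (g : G) (n : ℕ) : rep x (g * x ^ n) = rep x g := by
  unfold rep
  congr 1
  rw [QuotientGroup.eq]
  simp [Subgroup.npow_mem_zpowers]

lemma rep_spec (hx : IsOfFinOrder x) (g : G) : ∃ n < orderOf x, rep x g = g * x ^ n := by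
  obtain ⟨⟨h, hh⟩, h2⟩ := QuotientGroup.mk_out_eq_mul (Subgroup.zpowers x) g
  obtain ⟨n, hn, rfl⟩ := (hx.mem_zpowers_iff_mem_range_orderOf).1 hh |> Finset.mem_image.1
  exact ⟨n, by simpa using hn, h2⟩

open Classical in
lemma sum_rep (hx : IsOfFinOrder x) (g : G) :
    ∑ i ∈ Finset.range (orderOf x),
      (if rep x (g * x ^ i) = g * x ^ i then o (g * x ^ i) else 0) = o (rep x g) := by
  obtain ⟨n, hn, h⟩ := rep_spec x hx g
  rw [Finset.sum_eq_single n]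
  · rw [rep_mul, if_pos h, h]
  · intro b hb hbn
    rw [rep_mul, if_neg]
    intro h'
    rw [h] at h'
    exact hbn (pow_injOn_Iio_orderOf (by simpa using hb) (by simpa using hn)
      (mul_left_cancel h').symm)
  · intro h'; simp at h'; omega

lemma sub_pow_mem (g : G) (n : ℕ) : ∃ y, o g - o (g * x ^ n) = y * (o x - 1) := by
  refine ⟨-(o g * ∑ i ∈ Finset.range n, o x ^ i), ?_⟩
  rw [neg_mul, mul_assoc, geom_sum_mul, o_mul, o_pow]
  noncomm_ring

lemma ker_norm (hx : IsOfFinOrder x) (a : A)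
    (ha : a * ∑ i ∈ Finset.range (orderOf x), o x ^ i = 0) : ∃ y, a = y * (o x - 1) := by
  classical
  obtain ⟨Q, hQ⟩ := exists_lift (fun g => if rep x g = g then o g else 0)
  obtain ⟨R, hR⟩ := exists_lift (fun g => o (rep x g))
  have e : Q.comp (AddMonoidHom.mulRight (∑ i ∈ Finset.range (orderOf x), o x ^ i)) = R := by
    apply hom_ext'
    intro g
    rw [hR, ← sum_rep x hx g]
    simp only [AddMonoidHom.comp_apply, AddMonoidHom.coe_mulRight, Finset.mul_sum, map_sum,
      ← o_pow, ← o_mul, hQ]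
  have h0 : R a = 0 := by rw [← e]; simp [ha]
  have h1 : ∀ a, ∃ y, a - R a = y * (o x - 1) := by
    intro a
    induction a using A_ind with
    | h1 g =>
      obtain ⟨n, hn, h⟩ := rep_spec x hx g
      rw [hR, h]; exact sub_pow_mem x g n
    | h2 a b ha hb =>
      obtain ⟨y, hy⟩ := ha
      obtain ⟨y', hy'⟩ := hb
      exact ⟨y + y', by rw [add_mul, ← hy, ← hy', map_add]; abel⟩
    | h3 a ha =>
      obtain ⟨y, hy⟩ := ha
      exact ⟨-y, by rw [neg_mul, ← hy, map_neg]; abel⟩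
  simpa [h0] using h1 a

lemma inv_two (hx : orderOf x = 2) (a : A) (ha : a * (o x - 1) = 0) :
    ∃ y, a = y * (1 + o x) := by
  classical
  obtain ⟨Q, hQ⟩ := exists_lift (fun g => if rep x g = g then o g else 0)
  have hfin : IsOfFinOrder x := orderOf_pos_iff.1 (by omega)
  have e : (AddMonoidHom.mulRight (o x)).comp Q + Q.comp (AddMonoidHom.mulRight (o x)) =
      AddMonoidHom.mulRight (o x) := by
    apply hom_ext'
    intro g
    have hxx : x * x = 1 := by
      have := pow_orderOf_eq_one x
      rwa [hx, sq] at this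
    have hx1 : x ≠ 1 := by rintro rfl; simp at hx
    obtain ⟨n, hn, h⟩ := rep_spec x hfin g
    have h2 := rep_mul x g 1
    rw [pow_one] at h2
    rw [hx] at hn
    simp only [AddMonoidHom.add_apply, AddMonoidHom.comp_apply, AddMonoidHom.coe_mulRight,
      ← o_mul, hQ, h2, h]
    interval_cases n
    · simp [hx1, o_mul]
    · simp [hx1, o_mul]
  have h1 := DFunLike.congr_fun e a
  simp only [AddMonoidHom.add_apply, AddMonoidHom.comp_apply, AddMonoidHom.coe_mulRight] at h1
  have h2 : a * o x = a := by rw [mul_sub, mul_one, sub_eq_zero] at ha; exact ha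
  rw [h2] at h1
  exact ⟨Q a, by rw [mul_add, mul_one, add_comm]; exact h1.symm⟩
end cyc

lemma ord_s : orderOf s = 4 := by
  rw [orderOf_eq_iff (by norm_num)]
  refine ⟨by decide, fun m h1 h2 => ?_⟩
  interval_cases m <;> decide
lemma ord_t : orderOf t = 6 := by
  rw [orderOf_eq_iff (by norm_num)]
  refine ⟨by decide, fun m h1 h2 => ?_⟩
  interval_cases m <;> decide
lemma ord_z : orderOf z = 2 := by
  rw [orderOf_eq_iff (by norm_num)]
  refine ⟨by decide, fun m h1 h2 => ?_⟩
  interval_cases m <;> decide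

noncomputable def N4 : A := 1 + o s + o s ^ 2 + o s ^ 3

noncomputable def d1 : A × A →ₗ[A] A where
  toFun p := p.1 * (o s - 1) + p.2 * (o t - 1)
  map_add' p q := by simp only [Prod.fst_add, Prod.snd_add, add_mul]; abel
  map_smul' r p := by simp [mul_assoc, mul_add]

noncomputable def d2 : A × A →ₗ[A] A × A where
  toFun p := (p.1 * N4 + p.2 * (1 + o s), - (p.2 * (1 + o t + o t ^ 2)))
  map_add' p q := by
    simp only [Prod.fst_add, Prod.snd_add, add_mul, Prod.mk_add_mk, Prod.mk.injEq]
    constructor <;> abel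
  map_smul' r p := by simp [mul_assoc, mul_add]

noncomputable def d3 : A × A →ₗ[A] A × A where
  toFun p := (p.1 * (o s - 1) + p.2 * (o t - 1), - (p.2 * ((o t - 1) * (1 + o t ^ 3))))
  map_add' p q := by
    simp only [Prod.fst_add, Prod.snd_add, add_mul, Prod.mk_add_mk, Prod.mk.injEq]
    constructor <;> abel
  map_smul' r p := by simp [mul_assoc, mul_add]

noncomputable def ε : A →+ ℤ := (exists_lift (fun _ => (1 : ℤ))).choose
lemma ε_o (g : G) : ε (o g) = 1 := (exists_lift (fun _ => (1 : ℤ))).choose_spec g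

lemma os4 : o s ^ 4 = 1 := by rw [← o_pow, s_four, o_one]
lemma ot6 : o t ^ 6 = 1 := by rw [← o_pow, t_six, o_one]
lemma os2 : o s ^ 2 = o t ^ 3 := by rw [← o_pow, ← o_pow, s_sq, t_cube]

lemma N4s : N4 * (o s - 1) = 0 := by
  have : N4 * (o s - 1) = o s ^ 4 - 1 := by unfold N4; noncomm_ring
  rw [this, os4, sub_self]

lemma d1d2 (p : A × A) : d1 (d2 p) = 0 := by
  obtain ⟨a, c⟩ := p
  have : d1 (d2 (a, c)) = a * (N4 * (o s - 1)) + c * (o s ^ 2 - o t ^ 3) := by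
    simp only [d1, d2, LinearMap.coe_mk, AddHom.coe_mk]; noncomm_ring
  rw [this, N4s, os2]; simp

lemma key34 : (1 + o t ^ 3) * (1 + o s) = N4 := by
  rw [← os2]; unfold N4; noncomm_ring

lemma d2d3 (p : A × A) : d2 (d3 p) = 0 := by
  obtain ⟨x, y⟩ := p
  have : d2 (d3 (x, y)) = (x * ((o s - 1) * N4) + y * (o t - 1) * (N4 - (1 + o t ^ 3) * (1 + o s)),
      y * (o t ^ 6 - 1)) := by
    simp only [d3, d2, LinearMap.coe_mk, AddHom.coe_mk, Prod.mk.injEq]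
    constructor <;> noncomm_ring
  have h : (o s - 1) * N4 = 0 := by
    have : (o s - 1) * N4 = o s ^ 4 - 1 := by unfold N4; noncomm_ring
    rw [this, os4, sub_self]
  rw [this, key34, h, ot6]; simp

lemma d3d2 (p : A × A) : d3 (d2 p) = 0 := by
  obtain ⟨a, c⟩ := p
  have : d3 (d2 (a, c)) = (a * (N4 * (o s - 1)) + c * (o s ^ 2 - o t ^ 3),
      c * (o t ^ 6 - 1)) := by
    simp only [d3, d2, LinearMap.coe_mk, AddHom.coe_mk, Prod.mk.injEq]
    constructor <;> noncomm_ring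
  rw [this, N4s, os2, ot6]; simp

lemma ε_d1 (p : A × A) : ε (d1 p) = 0 := by
  obtain ⟨x, y⟩ := p
  have h : ∀ (g : G) (x : A), ε (x * (o g - 1)) = 0 := by
    intro g x
    induction x using A_ind with
    | h1 h => rw [mul_sub, mul_one, map_sub, ← o_mul, ε_o, ε_o, sub_self]
    | h2 a b ha hb => rw [add_mul, map_add, ha, hb, add_zero]
    | h3 a ha => rw [neg_mul, map_neg, ha, neg_zero]
  simp only [d1, LinearMap.coe_mk, AddHom.coe_mk]
  rw [map_add, h, h, add_zero]

lemma ex0 (a : A) (ha : ε a = 0) : ∃ p, d1 p = a := by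
  have h1 : ∀ g : G, o g - 1 ∈ LinearMap.range d1 := by
    intro g
    have hg : g ∈ Subgroup.closure {s, t} := gen ▸ Subgroup.mem_top g
    have hsub : ∀ y ∈ ({s, t} : Set G), o y - 1 ∈ LinearMap.range d1 := by
      rintro y (rfl | rfl)
      · exact ⟨(1, 0), by simp [d1]⟩
      · exact ⟨(0, 1), by simp [d1]⟩
    induction hg using Subgroup.closure_induction_right with
    | one => simp [o_one]
    | mul_right x _ y hy ih =>
      have : o (x * y) - 1 = o x • (o y - 1) + (o x - 1) := by
        rw [o_mul, smul_eq_mul]; noncomm_ring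
      rw [this]
      exact add_mem (Submodule.smul_mem _ _ (hsub y hy)) ih
    | mul_inv_cancel x _ y hy ih =>
      have : o (x * y⁻¹) - 1 = (o x - 1) - o (x * y⁻¹) • (o y - 1) := by
        rw [smul_eq_mul, mul_sub, ← o_mul]; simp
      rw [this]
      exact sub_mem ih (Submodule.smul_mem _ _ (hsub y hy))
  have h2 : ∀ a : A, a - ε a • (1 : A) ∈ LinearMap.range d1 := by
    intro a
    induction a using A_ind with
    | h1 g => simpa [ε_o] using h1 g
    | h2 a b ha hb =>
      have := add_mem ha hb
      rw [map_add, add_smul]; convert this using 1; abel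
    | h3 a ha =>
      have := neg_mem ha
      rw [map_neg, neg_smul]; convert this using 1; abel
  simpa [ha] using h2 a

lemma ex2 (p : A × A) (hp : d2 p = 0) : ∃ q, d3 q = p := by
  obtain ⟨a, c⟩ := p
  simp only [d2, LinearMap.coe_mk, AddHom.coe_mk, Prod.mk_eq_zero, neg_eq_zero] at hp
  obtain ⟨h1, h2⟩ := hp
  obtain ⟨w, rfl⟩ : ∃ w, c = w * (o t - 1) := by
    apply ker_norm
    · exact orderOf_pos_iff.1 (by rw [ord_t]; norm_num)
    · rw [ord_t]
      have : c * ∑ i ∈ Finset.range 6, o t ^ i = c * (1 + o t + o t ^ 2) * (1 + o t ^ 3) := by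
        simp only [Finset.sum_range_succ, Finset.sum_range_zero]; noncomm_ring
      rw [this, h2, zero_mul]
  obtain ⟨v, rfl⟩ : ∃ v, w = v * (1 + o z) := by
    apply inv_two _ ord_z
    rw [← t_cube, o_pow, ← h2]; noncomm_ring
  rw [← t_cube, o_pow] at h1 ⊢
  obtain ⟨x, hx⟩ : ∃ x, a + v * (o t - 1) = x * (o s - 1) := by
    apply ker_norm
    · exact orderOf_pos_iff.1 (by rw [ord_s]; norm_num)
    · rw [ord_s]
      have : ∑ i ∈ Finset.range 4, o s ^ i = N4 := by
        simp [Finset.sum_range_succ, N4]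
      rw [this, ← h1, add_mul, mul_assoc, ← key34]; noncomm_ring
  refine ⟨(x, -v), ?_⟩
  simp only [d3, LinearMap.coe_mk, AddHom.coe_mk, Prod.mk.injEq]
  constructor
  · rw [← hx]; noncomm_ring
  · noncomm_ring

lemma ex1 (p : A × A) (hp : d1 p = 0) : ∃ q, d2 q = p := by
  let M := (A × A) ⧸ LinearMap.range d2
  let mk : A × A →ₗ[A] M := (LinearMap.range d2).mkQ
  let es : M := mk (1, 0)
  let et : M := mk (0, 1)
  have oinv : ∀ g : G, ∀ m : M, o g⁻¹ • o g • m = m := fun g m => by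
    rw [smul_smul, ← o_mul]; simp [o_one]
  have oinv' : ∀ g : G, ∀ m : M, o g • o g⁻¹ • m = m := fun g m => by
    rw [smul_smul, ← o_mul]; simp [o_one]
  let aff (g : G) (e : M) : Equiv.Perm M :=
    { toFun := fun m => o g • m + e
      invFun := fun m => o g⁻¹ • (m - e)
      left_inv := fun m => by simp [oinv]
      right_inv := fun m => by simp [oinv'] }
  have aff_apply : ∀ g e m, aff g e m = o g • m + e := fun _ _ _ => rfl
  have r1 : N4 • es = 0 := by
    rw [← map_smul, ← LinearMap.mem_ker, Submodule.ker_mkQ]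
    exact ⟨(1, 0), by simp [d2]⟩
  have r2 : (1 + o s) • es = (1 + o t + o t ^ 2) • et := by
    rw [← sub_eq_zero, ← map_smul, ← map_smul, ← map_sub, ← LinearMap.mem_ker, Submodule.ker_mkQ]
    exact ⟨(0, 1), by simp [d2]⟩
  obtain ⟨f, fs, ft⟩ := exists_hom (S := aff s es) (T := aff t et) (by
      ext m
      have : (aff s es ^ 4) m = o s ^ 4 • m + N4 • es := by
        simp only [pow_succ, pow_zero, one_mul, Equiv.Perm.mul_apply, aff_apply, N4, smul_add, add_smul, smul_smul, one_smul,
          mul_assoc]; abel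
      rw [this, r1, os4]; simp) (by
      ext m
      have h1 : (aff s es ^ 2) m = o s ^ 2 • m + (1 + o s) • es := by
        simp only [pow_succ, pow_zero, one_mul, Equiv.Perm.mul_apply, aff_apply, smul_add, add_smul, smul_smul, one_smul,
          mul_assoc]; abel
      have h2 : (aff t et ^ 3) m = o t ^ 3 • m + (1 + o t + o t ^ 2) • et := by
        simp only [pow_succ, pow_zero, one_mul, Equiv.Perm.mul_apply, aff_apply, smul_add, add_smul, smul_smul, one_smul,
          mul_assoc]; abel
      rw [h1, h2, r2, os2])
  have hf : ∀ g : G, ∀ m, f g m = o g • m + f g 0 := by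
    intro g
    have hg : g ∈ Subgroup.closure {s, t} := gen ▸ Subgroup.mem_top g
    induction hg using Subgroup.closure_induction with
    | mem x hx =>
      rcases hx with rfl | rfl
      · intro m; rw [fs]; simp [aff_apply]
      · intro m; rw [ft]; simp [aff_apply]
    | one => intro m; simp [o_one]
    | mul x y _ _ hx hy =>
      intro m
      rw [map_mul, Equiv.Perm.mul_apply, Equiv.Perm.mul_apply, hx (f y m), hy m, hx (f y 0), o_mul, smul_add, smul_smul, add_assoc]
    | inv x _ hx =>
      intro m
      rw [map_inv, Equiv.Perm.inv_eq_iff_eq, hx, smul_add, oinv']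
      have := hx ((f x)⁻¹ 0)
      rw [← Equiv.Perm.mul_apply, mul_inv_cancel, Equiv.Perm.one_apply] at this
      rw [add_assoc, ← this, add_zero]
  obtain ⟨D, hD⟩ := exists_lift (fun g => f g 0)
  have Ds : D.comp (AddMonoidHom.mulRight (o s - 1)) =
      mk.toAddMonoidHom.comp (AddMonoidHom.inl A A) := by
    apply hom_ext'
    intro g
    have : mk (o g, 0) = o g • es := by rw [← map_smul]; simp
    simp only [AddMonoidHom.comp_apply, AddMonoidHom.coe_mulRight, mul_sub, mul_one, ← o_mul,
      map_sub, hD, map_mul, Equiv.Perm.mul_apply, fs, aff_apply, smul_zero, zero_add]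
    rw [hf g es]
    simp [this]
  have Dt : D.comp (AddMonoidHom.mulRight (o t - 1)) =
      mk.toAddMonoidHom.comp (AddMonoidHom.inr A A) := by
    apply hom_ext'
    intro g
    have : mk (0, o g) = o g • et := by rw [← map_smul]; simp
    simp only [AddMonoidHom.comp_apply, AddMonoidHom.coe_mulRight, mul_sub, mul_one, ← o_mul,
      map_sub, hD, map_mul, Equiv.Perm.mul_apply, ft, aff_apply, smul_zero, zero_add]
    rw [hf g et]
    simp [this]
  obtain ⟨x, y⟩ := p
  have h1 := DFunLike.congr_fun Ds x
  have h2 := DFunLike.congr_fun Dt y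
  simp only [AddMonoidHom.comp_apply, AddMonoidHom.coe_mulRight, LinearMap.toAddMonoidHom_coe,
    AddMonoidHom.inl_apply, AddMonoidHom.inr_apply] at h1 h2
  have h3 : mk (x, y) = 0 := by
    have : (x, y) = (x, 0) + ((0, y) : A × A) := by simp
    rw [this, map_add, ← h1, ← h2, ← map_add]
    have : x * (o s - 1) + y * (o t - 1) = 0 := hp
    rw [this, map_zero]
  rwa [← LinearMap.mem_ker, Submodule.ker_mkQ] at h3

end SL2Zcoh

namespace SL2Zcoh
open CategoryTheory

noncomputable def rho (M : Type) [AddCommGroup M] [Module A M] : Representation ℤ G M where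
  toFun g := (Module.toAddMonoidEnd A M (o g)).toIntLinearMap
  map_one' := by ext x; change o 1 • x = x; simp [o_one]
  map_mul' g h := by ext x; change o (g * h) • x = o g • o h • x; simp [o_mul, mul_smul]

lemma rho_apply (M : Type) [AddCommGroup M] [Module A M] (g : G) (x : M) :
    rho M g x = o g • x := rfl

noncomputable abbrev R (M : Type) [AddCommGroup M] [Module A M] : Rep ℤ G := Rep.of (rho M)

noncomputable def F {M N : Type} [AddCommGroup M] [Module A M] [AddCommGroup N] [Module A N]
    (f : M →ₗ[A] N) : R M ⟶ R N :=
  Rep.ofHom ⟨f.toAddMonoidHom.toIntLinearMap, fun g => by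
    ext x; exact f.map_smul (o g) x⟩

lemma F_apply {M N : Type} [AddCommGroup M] [Module A M] [AddCommGroup N] [Module A N]
    (f : M →ₗ[A] N) (x : M) : (F f).hom x = f x := rfl

lemma F_comp {M N K : Type} [AddCommGroup M] [Module A M] [AddCommGroup N] [Module A N]
    [AddCommGroup K] [Module A K]
    (f : M →ₗ[A] N) (g : N →ₗ[A] K) (h : ∀ x, g (f x) = 0) : F f ≫ F g = 0 := by
  ext x
  exact h x

abbrev Z : Rep ℤ G := Rep.trivial ℤ G ℤ

noncomputable def eps : R A ⟶ Z :=
  Rep.ofHom ⟨ε.toIntLinearMap, fun g => by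
    have : (ε.comp (AddMonoidHom.mulLeft (o g))) = ε := hom_ext' fun h => by
      simp [← o_mul, ε_o]
    refine LinearMap.ext fun x => ?_; exact DFunLike.congr_fun this x⟩

lemma eps_apply (x : A) : eps.hom x = ε x := rfl

lemma lift_aux {V : Type} [i : AddCommGroup V] (m : Module ℤ V)
    (σ : @Representation ℤ G V _ _ _ m) (w : V) :
    ∃ φ : R A ⟶ @Rep.of ℤ G _ _ V _ m σ, φ.hom (1 : A) = w := by
  obtain rfl : m = AddCommGroup.toIntModule V := Subsingleton.elim _ _
  obtain ⟨l, hl⟩ := exists_lift (fun g => σ g w)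
  refine ⟨Rep.ofHom ⟨l.toIntLinearMap, fun g => ?_⟩, ?_⟩
  · have : (l.comp (AddMonoidHom.mulLeft (o g))) = ((σ g).toAddMonoidHom).comp l :=
      hom_ext' fun h => by
        simp [← o_mul, hl]
    refine LinearMap.ext fun x => ?_
    exact DFunLike.congr_fun this x
  · change l 1 = w
    rw [← o_one, hl]; simp

lemma RA_ext {X : Rep ℤ G} (f f' : R A ⟶ X) (h : f.hom (1 : A) = f'.hom (1 : A)) : f = f' := by
  have key : ∀ (f : R A ⟶ X) (g : G), f.hom (o g) = X.ρ g (f.hom (1 : A)) := fun f g => by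
    have h1 := Rep.hom_comm_apply f g (1 : A)
    have h2 : (R A).ρ g (1 : A) = o g := mul_one (o g)
    rwa [h2] at h1
  have : (⟨⟨f.hom, map_zero f.hom⟩, map_add f.hom⟩ : A →+ X.V) =
      ⟨⟨f'.hom, map_zero f'.hom⟩, map_add f'.hom⟩ :=
    hom_ext' fun g => (key f g).trans ((congrArg _ h).trans (key f' g).symm)
  refine Rep.hom_ext (DFunLike.ext _ _ fun x => ?_)
  exact DFunLike.congr_fun this x

instance projA : Projective (R A) where
  factors {E X} f e he := by
    rw [Rep.epi_iff_surjective] at he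
    obtain ⟨w, hw⟩ := he (f.hom (1 : A))
    obtain ⟨l, hl⟩ := lift_aux E.hV2 E.ρ w
    refine ⟨l, RA_ext _ _ ?_⟩
    exact (congrArg e.hom hl).trans hw

instance projAA : Projective (R (A × A)) where
  factors {E X} f e he := by
    refine ⟨F (LinearMap.fst A A A) ≫ Projective.factorThru (F (LinearMap.inl A A A) ≫ f) e +
      F (LinearMap.snd A A A) ≫ Projective.factorThru (F (LinearMap.inr A A A) ≫ f) e, ?_⟩
    rw [Preadditive.add_comp, Category.assoc, Category.assoc, Projective.factorThru_comp,
      Projective.factorThru_comp]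
    refine Rep.hom_ext (DFunLike.ext _ _ fun x => ?_)
    have : x = ((x.1, 0) : A × A) + (0, x.2) := by simp
    refine Eq.trans ?_ (congrArg f.hom this.symm)
    exact (map_add f.hom _ _).symm

noncomputable def cX : ℕ → Rep ℤ G
  | 0 => R A
  | _ + 1 => R (A × A)

noncomputable def cd : (n : ℕ) → (cX (n + 1) ⟶ cX n)
  | 0 => F d1
  | n + 1 => if Even n then F d2 else F d3

lemma cd_even {n : ℕ} (h : Even n) : cd (n + 1) = F d2 := if_pos h
lemma cd_odd {n : ℕ} (h : ¬ Even n) : cd (n + 1) = F d3 := if_neg h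

lemma cd_sq (n : ℕ) : cd (n + 1) ≫ cd n = 0 := by
  cases n with
  | zero =>
    rw [cd_even (by simp)]
    exact F_comp _ _ d1d2
  | succ n =>
    by_cases h : Even n
    · rw [cd_even h, cd_odd (by simpa [Nat.even_add_one] using h)]
      exact F_comp _ _ d2d3
    · rw [cd_odd h, cd_even (by simpa [Nat.even_add_one] using h)]
      exact F_comp _ _ d3d2

noncomputable def C : ChainComplex (Rep ℤ G) ℕ := ChainComplex.of cX cd cd_sq

lemma C_d (n : ℕ) : C.d (n + 1) n = cd n := ChainComplex.of_d _ _ _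

lemma C_eps : C.d 1 0 ≫ eps = 0 := by
  rw [C_d 0]
  refine Rep.hom_ext (DFunLike.ext _ _ fun x => ?_)
  exact ε_d1 x

noncomputable def piC : C ⟶ (ChainComplex.single₀ (Rep ℤ G)).obj Z :=
  (C.toSingle₀Equiv Z).symm ⟨eps, C_eps⟩

lemma exact_of {k H : Type} [CommRing k] [Group H] {X Y W : Rep.{0} k H}
    (f : X ⟶ Y) (g : Y ⟶ W) (w : f ≫ g = 0)
    (h : ∀ y, g.hom y = 0 → ∃ x, f.hom x = y) : (ShortComplex.mk f g w).Exact := by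
  apply (forget₂ _ (ModuleCat k)).reflects_exact_of_faithful
  rw [ShortComplex.moduleCat_exact_iff]
  exact h

lemma cd_exact (n : ℕ) (y : cX (n + 1)) (hy : (cd n).hom y = 0) :
    ∃ x, (cd (n + 1)).hom x = y := by
  cases n with
  | zero =>
    rw [cd_even (by simp)]
    exact ex1 y hy
  | succ n =>
    by_cases h : Even n
    · rw [cd_even h] at hy
      rw [cd_odd (by simpa [Nat.even_add_one] using h)]
      exact ex2 y hy
    · rw [cd_odd h] at hy
      rw [cd_even (by simpa [Nat.even_add_one] using h)]
      exact ex1 y (congrArg Prod.fst hy)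

lemma C_exact (n : ℕ) : (C.sc' (n + 2) (n + 1) n).Exact := by
  refine exact_of _ _ _ ?_
  change ∀ y, (C.d (n + 1) n).hom y = 0 → ∃ x, (C.d (n + 2) (n + 1)).hom x = y
  rw [C_d n, C_d (n + 1)]
  exact cd_exact n

lemma quasi : QuasiIso piC where
  quasiIsoAt m := by
    induction m with
    | zero =>
      rw [ChainComplex.quasiIsoAt₀_iff, ShortComplex.quasiIso_iff_of_zeros' _ rfl rfl rfl]
      have hp : piC.f 0 = eps := ChainComplex.toSingle₀Equiv_symm_apply_f_zero _ _
      constructor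
      · refine exact_of _ _ _ ?_
        change ∀ y, (piC.f 0).hom y = 0 → ∃ x, (C.d 1 0).hom x = y
        rw [hp, C_d 0]
        exact ex0
      · change Epi (piC.f 0)
        rw [hp]
        refine (Rep.epi_iff_surjective eps).2 ?_
        intro x
        refine ⟨(x • (1 : A) : A), ?_⟩
        change ε (x • (1 : A)) = x
        rw [map_zsmul, ← o_one, ε_o]
        simp
    | succ m _ =>
      rw [quasiIsoAt_iff_exactAt' (hL := ChainComplex.exactAt_succ_single_obj ..),
          HomologicalComplex.exactAt_iff' _ (m + 2) (m + 1) m (by simp) (by simp)]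
      exact C_exact m

lemma proj_cX (n : ℕ) : Projective (cX n) := by
  cases n with
  | zero => exact projA
  | succ n => exact projAA

noncomputable def res : ProjectiveResolution Z where
  complex := C
  projective n := proj_cX n
  π := piC
  quasiIso := quasi

end SL2Zcoh

namespace SL2Zcoh
open CategoryTheory

lemma homology_equiv {k B : Type} [CommRing k] [AddCommGroup B] [Module k B]
    (S : ShortComplex (ModuleCat.{0} k)) (hg : ∀ x, S.g.hom x = 0)
    (φ : S.X₂ →ₗ[k] B) (hs : Function.Surjective φ)
    (h1 : ∀ x, φ (S.f.hom x) = 0) (h2 : ∀ y, φ y = 0 → ∃ x, S.f.hom x = y) :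
    Nonempty (S.homology ≃+ B) := by
  let ψ : LinearMap.ker S.g.hom →ₗ[k] B := φ ∘ₗ (LinearMap.ker S.g.hom).subtype
  have hψ : Function.Surjective ψ := fun c => by
    obtain ⟨y, hy⟩ := hs c
    exact ⟨⟨y, hg y⟩, hy⟩
  have hk : LinearMap.range S.moduleCatToCycles = LinearMap.ker ψ := by
    ext y
    constructor
    · rintro ⟨x, rfl⟩
      exact h1 x
    · intro hy
      obtain ⟨x, hx⟩ := h2 y.1 hy
      exact ⟨x, Subtype.ext hx⟩
  let e1 : S.homology ≃ₗ[k] (LinearMap.ker S.g.hom ⧸ LinearMap.range S.moduleCatToCycles) :=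
    S.moduleCatHomologyIso.toLinearEquiv
  exact ⟨(e1.trans ((Submodule.quotEquivOfEq _ _ hk).trans
    (LinearMap.quotKerEquivOfSurjective ψ hψ))).toAddEquiv⟩

lemma hom_one (f : R A ⟶ Z) (x : A) : f.hom x = ε x * f.hom (1 : A) := by
  have h : f = (f.hom (1 : A) : ℤ) • eps := RA_ext _ _ (by
    change f.hom (1 : A) = (f.hom (1 : A) : ℤ) • ε 1
    rw [← o_one, ε_o]; exact (mul_one _).symm)
  have h3 := congrArg (fun k : R A ⟶ Z => k.hom x) h
  exact h3.trans (mul_comm _ _)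

lemma hom_two (f : R (A × A) ⟶ Z) (x : A × A) :
    f.hom x = ε x.1 * f.hom ((1, 0) : A × A) + ε x.2 * f.hom ((0, 1) : A × A) := by
  have h1 := hom_one (F (LinearMap.inl A A A) ≫ f) x.1
  have h2 := hom_one (F (LinearMap.inr A A A) ≫ f) x.2
  have h3 : f.hom x = f.hom ((x.1, 0) : A × A) + f.hom ((0, x.2) : A × A) := by
    refine Eq.trans (congrArg f.hom ?_) (map_add f.hom _ _)
    change x = ((x.1, 0) : A × A) + (0, x.2)
    simp
  rw [h3]
  exact congrArg₂ (· + ·) h1 h2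

noncomputable def mk2 (p q : ℤ) : R (A × A) ⟶ Z :=
  p • (F (LinearMap.fst A A A) ≫ eps) + q • (F (LinearMap.snd A A A) ≫ eps)

lemma ε_one : ε 1 = 1 := by rw [← o_one, ε_o]

lemma mk2_1 (p q : ℤ) : (mk2 p q).hom ((1, 0) : A × A) = p := by
  change p • ε 1 + q • ε 0 = p
  rw [ε_one, map_zero]; simp

lemma mk2_2 (p q : ℤ) : (mk2 p q).hom ((0, 1) : A × A) = q := by
  change p • ε 0 + q • ε 1 = q
  rw [ε_one, map_zero]; simp

lemma hom_ext2 (f f' : R (A × A) ⟶ Z)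
    (h1 : (f.hom ((1, 0) : A × A) : ℤ) = f'.hom ((1, 0) : A × A))
    (h2 : (f.hom ((0, 1) : A × A) : ℤ) = f'.hom ((0, 1) : A × A)) : f = f' := by
  refine Rep.hom_ext (DFunLike.ext _ _ fun x => ?_)
  refine (hom_two f x).trans (Eq.trans ?_ (hom_two f' x).symm)
  exact congrArg₂ (· + ·) (congrArg (ε x.1 * ·) h1) (congrArg (ε x.2 * ·) h2)

lemma ε_op (g : G) (n : ℕ) : ε (o g ^ n) = 1 := by rw [← o_pow, ε_o]

lemma d2_1 (f : R (A × A) ⟶ Z) :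
    (F d2 ≫ f).hom ((1, 0) : A × A) = (4 * f.hom ((1, 0) : A × A) : ℤ) := by
  refine (hom_two f (d2 (1, 0))).trans ?_
  have h1 : ε (d2 (1, 0)).1 = 4 := by
    simp [d2, N4, ε_one, ε_o, ε_op]
  have h2 : ε (d2 (1, 0)).2 = 0 := by
    simp [d2]
  rw [h1, h2, zero_mul, add_zero]

lemma d2_2 (f : R (A × A) ⟶ Z) :
    (F d2 ≫ f).hom ((0, 1) : A × A) =
      (2 * f.hom ((1, 0) : A × A) - 3 * f.hom ((0, 1) : A × A) : ℤ) := by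
  refine (hom_two f (d2 (0, 1))).trans ?_
  have h1 : ε (d2 (0, 1)).1 = 2 := by
    simp [d2, ε_one, ε_o]
  have h2 : ε (d2 (0, 1)).2 = -3 := by
    simp [d2, ε_one, ε_o, ε_op]
  rw [h1, h2]
  rw [neg_mul, ← sub_eq_add_neg]

lemma d3_0 (f : R (A × A) ⟶ Z) : F d3 ≫ f = 0 := by
  refine Rep.hom_ext (DFunLike.ext _ _ fun x => ?_)
  refine (hom_two f (d3 x)).trans ?_
  have h1 : ε (d3 x).1 = 0 := ε_d1 x
  have h2 : ε (d3 x).2 = 0 := by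
    have : (d3 x).2 = d1 (0, - (x.2 * (1 + o t ^ 3))) := by
      simp only [d3, d1, LinearMap.coe_mk, AddHom.coe_mk]
      noncomm_ring
    rw [this, ε_d1]
  rw [h1, h2, zero_mul, zero_mul, add_zero]
  rfl

lemma d2_inj (f : R (A × A) ⟶ Z) (h : F d2 ≫ f = 0) : f = 0 := by
  have h1 := d2_1 f
  have h2 := d2_2 f
  rw [h] at h1 h2
  change (0 : ℤ) = _ at h1
  change (0 : ℤ) = _ at h2
  apply hom_ext2
  · change _ = (0 : ℤ)
    omega
  · change _ = (0 : ℤ)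
    omega

noncomputable abbrev K : CochainComplex (ModuleCat ℤ) ℕ := C.linearYonedaObj ℤ Z

lemma K_exact (n : ℕ) (hn : Even n) : (K.sc' n (n + 1) (n + 2)).Exact := by
  rw [ShortComplex.moduleCat_exact_iff]
  intro f hf
  refine ⟨0, ?_⟩
  have h : C.d (n + 2) (n + 1) ≫ f = 0 := hf
  rw [C_d (n + 1), cd_even hn] at h
  rw [map_zero]
  exact (d2_inj f h).symm

noncomputable def phi : (R (A × A) ⟶ Z) →ₗ[ℤ] ZMod 12 where
  toFun f := ((f.hom ((1, 0) : A × A) + 4 * f.hom ((0, 1) : A × A) : ℤ) : ZMod 12)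
  map_add' f g := by
    rw [← Int.cast_add]
    refine congrArg Int.cast ?_
    change ((f.hom ((1, 0) : A × A) + g.hom ((1, 0) : A × A)) +
      4 * (f.hom ((0, 1) : A × A) + g.hom ((0, 1) : A × A)) : ℤ) = _
    ring
  map_smul' r f := by
    rw [zsmul_eq_mul]
    simp only [RingHom.id_apply, eq_intCast, Int.cast_id]
    rw [← Int.cast_mul]
    refine congrArg Int.cast ?_
    change (r * (f.hom ((1, 0) : A × A)) + 4 * (r * f.hom ((0, 1) : A × A)) : ℤ) = _
    ring

lemma phi_apply (f : R (A × A) ⟶ Z) :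
    phi f = ((f.hom ((1, 0) : A × A) + 4 * f.hom ((0, 1) : A × A) : ℤ) : ZMod 12) := rfl

lemma phi_surj : Function.Surjective phi := by
  intro c
  obtain ⟨m, rfl⟩ := ZMod.intCast_surjective c
  refine ⟨mk2 m 0, ?_⟩
  rw [phi_apply, mk2_1, mk2_2]; simp

lemma phi_d2 (f : R (A × A) ⟶ Z) : phi (F d2 ≫ f) = 0 := by
  rw [phi_apply, d2_1, d2_2]
  generalize (f.hom ((1, 0) : A × A) : ℤ) = a
  generalize (f.hom ((0, 1) : A × A) : ℤ) = b
  refine (ZMod.intCast_zmod_eq_zero_iff_dvd _ 12).2 ⟨a - b, ?_⟩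
  push_cast; ring

lemma phi_ker (f : R (A × A) ⟶ Z) (hf : phi f = 0) : ∃ x : R (A × A) ⟶ Z, F d2 ≫ x = f := by
  rw [phi_apply] at hf
  obtain ⟨w, hw⟩ := (ZMod.intCast_zmod_eq_zero_iff_dvd _ 12).1 hf
  push_cast at hw
  refine ⟨mk2 (3 * w - f.hom ((0, 1) : A × A)) (2 * w - f.hom ((0, 1) : A × A)), ?_⟩
  apply hom_ext2
  · rw [d2_1, mk2_1]
    linarith
  · rw [d2_2, mk2_1, mk2_2]
    linarith

lemma K_even (n : ℕ) (hn : Even n) :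
    Nonempty ((K.sc' (n + 1) (n + 2) (n + 3)).homology ≃+ ZMod 12) := by
  refine homology_equiv _ ?_ phi phi_surj ?_ ?_
  · intro f
    change C.d (n + 3) (n + 2) ≫ f = 0
    rw [C_d (n + 2), cd_odd (by simpa [Nat.even_add_one] using hn)]
    exact d3_0 f
  · intro f
    change phi (C.d (n + 2) (n + 1) ≫ f) = 0
    rw [C_d (n + 1), cd_even hn]
    exact phi_d2 f
  · intro f hf
    change ∃ x : R (A × A) ⟶ Z, C.d (n + 2) (n + 1) ≫ x = f
    rw [C_d (n + 1), cd_even hn]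
    exact phi_ker f hf

noncomputable def isoH (i j k : ℕ) (h1 : (ComplexShape.up ℕ).prev j = i)
    (h2 : (ComplexShape.up ℕ).next j = k) : groupCohomology Z j ≅ (K.sc' i j k).homology :=
  groupCohomologyIso Z j res ≪≫ ShortComplex.homologyMapIso (K.isoSc' i j k h1 h2)

lemma H_odd (n : ℕ) (hn : Even n) (x : groupCohomology Z (n + 1)) : x = 0 := by
  have hz := ((ShortComplex.exact_iff_isZero_homology _).1 (K_exact n hn)).of_iso (isoH n (n + 1) (n + 2) (by simp) (by simp))
  exact (ModuleCat.subsingleton_of_isZero hz).elim _ _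

lemma H_even (n : ℕ) (hn : Even n) : Nonempty (groupCohomology Z (n + 2) ≃+ ZMod 12) := by
  obtain ⟨e⟩ := K_even n hn
  exact ⟨(isoH (n + 1) (n + 2) (n + 3) (by simp) (by simp)).toLinearEquiv.toAddEquiv.trans e⟩

lemma H_zero : Nonempty (groupCohomology Z 0 ≃+ ℤ) :=
  ⟨(groupCohomology.H0IsoOfIsTrivial Z).toLinearEquiv.toAddEquiv⟩

end SL2Zcoh


/-- for the trivial action of `SL(2,ℤ)` on `ℤ`, one has
`H^0 ≅ ℤ`, `H^1 = 0`, `H^2 ≅ ℤ/12`, `H^3 = 0`, `H^4 ≅ ℤ/12`, `H^5 = 0`. -/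
theorem groupCohomology_SL2Z_trivial_int_low_degree :
    Nonempty
      ((groupCohomology (Rep.trivial ℤ (Matrix.SpecialLinearGroup (Fin 2) ℤ) ℤ) 0 : Type) ≃+ ℤ) ∧
    (∀ x : groupCohomology (Rep.trivial ℤ (Matrix.SpecialLinearGroup (Fin 2) ℤ) ℤ) 1, x = 0) ∧
    Nonempty
      ((groupCohomology (Rep.trivial ℤ (Matrix.SpecialLinearGroup (Fin 2) ℤ) ℤ) 2 : Type) ≃+
        ZMod 12) ∧
    (∀ x : groupCohomology (Rep.trivial ℤ (Matrix.SpecialLinearGroup (Fin 2) ℤ) ℤ) 3, x = 0) ∧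
    Nonempty
      ((groupCohomology (Rep.trivial ℤ (Matrix.SpecialLinearGroup (Fin 2) ℤ) ℤ) 4 : Type) ≃+
        ZMod 12) ∧
    (∀ x : groupCohomology (Rep.trivial ℤ (Matrix.SpecialLinearGroup (Fin 2) ℤ) ℤ) 5, x = 0) := by
  exact ⟨SL2Zcoh.H_zero, SL2Zcoh.H_odd 0 (by decide), SL2Zcoh.H_even 0 (by decide),
    SL2Zcoh.H_odd 2 (by decide), SL2Zcoh.H_even 2 (by decide), SL2Zcoh.H_odd 4 (by decide)⟩
end

section
/- Let SL(2,ℤ) act on (ℤ/2ℤ)² through reduction of matrix entries modulo 2 followed by matrix–vector multiplication. Then the first group cohomology H^1(SL(2,ℤ), (ℤ/2ℤ)²) is isomorphic to ℤ/2ℤ; equivalently, it has exactly 2 elements. -/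
/-- The representation of `SL(2,ℤ)` on `(ℤ/2ℤ)²` given by reducing matrix entries modulo `2`
and then acting by matrix–vector multiplication. -/
noncomputable def sl2zModTwoRep :
    Representation (ZMod 2) (Matrix.SpecialLinearGroup (Fin 2) ℤ) (Fin 2 → ZMod 2) :=
  (LinearEquiv.automorphismGroup.toLinearMapMonoidHom).comp
    ((Matrix.SpecialLinearGroup.toLin').comp
      (Matrix.SpecialLinearGroup.map (Int.castRingHom (ZMod 2))))

namespace SL2ZAux

open Matrix ModularGroup groupCohomology

/-- The group. -/
abbrev G := Matrix.SpecialLinearGroup (Fin 2) ℤ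

/-- low bit -/
def lo (x : ZMod 4) : ZMod 2 := (x.val : ZMod 2)
/-- high bit -/
def hi (x : ZMod 4) : ZMod 2 := ((x.val / 2 : ℕ) : ZMod 2)

/-- first coordinate of the cocycle -/
def p (a b c d : ZMod 4) : ZMod 2 :=
  1 + lo a + lo c + lo d + lo a * hi b + lo a * lo d + hi a * lo b
/-- second coordinate of the cocycle -/
def q (a b c d : ZMod 4) : ZMod 2 :=
  lo b + lo c + lo d + lo a * hi b + lo a * hi c + lo a * lo d + lo a * hi d + hi a * lo b
    + hi a * lo c + hi a * lo d + lo b * hi d + hi b * lo d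

set_option maxRecDepth 100000 in
lemma pq : ∀ a b c d : ZMod 4, a * d - b * c = 1 →
    p (-c) (-d) a b = q a b c d ∧ q (-c) (-d) a b = p a b c d ∧
    p (a + c) (b + d) c d = p a b c d + q a b c d ∧ q (a + c) (b + d) c d = q a b c d + 1 := by
  decide

/-- the cocycle -/
def coc (g : G) : Fin 2 → ZMod 2 :=
  ![p (g 0 0) (g 0 1) (g 1 0) (g 1 1), q (g 0 0) (g 0 1) (g 1 0) (g 1 1)]

lemma rho_apply (g : G) (v : Fin 2 → ZMod 2) :
    sl2zModTwoRep g v = ![(g 0 0 : ZMod 2) * v 0 + (g 0 1 : ZMod 2) * v 1,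
      (g 1 0 : ZMod 2) * v 0 + (g 1 1 : ZMod 2) * v 1] := by
  have : sl2zModTwoRep g v = (g.1.map (Int.castRingHom (ZMod 2))) *ᵥ v := rfl
  rw [this]
  ext i
  fin_cases i <;> simp [Matrix.mulVec, dotProduct, Fin.sum_univ_two]

lemma rho_S (v : Fin 2 → ZMod 2) : sl2zModTwoRep S v = ![v 1, v 0] := by
  rw [rho_apply]
  simp [coe_S]

lemma rho_T (v : Fin 2 → ZMod 2) : sl2zModTwoRep T v = ![v 0 + v 1, v 1] := by
  rw [rho_apply]
  simp [coe_T]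

lemma det4 (h : G) : ((h 0 0 : ℤ) : ZMod 4) * (h 1 1 : ℤ) - (h 0 1 : ℤ) * (h 1 0 : ℤ) = 1 := by
  have := h.2
  rw [Matrix.det_fin_two] at this
  exact_mod_cast congrArg (Int.cast : ℤ → ZMod 4) this

lemma coc_S_mul (h : G) : coc (S * h) = sl2zModTwoRep S (coc h) + coc S := by
  obtain ⟨h1, h2, -, -⟩ := pq _ _ _ _ (det4 h)
  have h0 : coc S = 0 := by
    simp only [coc, coe_S]; decide
  rw [rho_S, h0, add_zero]
  simp [coc, coe_S, Matrix.mul_apply, Fin.sum_univ_two, h1, h2]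

lemma coc_T : coc T = ![0, 1] := by
  simp only [coc, coe_T]; decide

lemma coc_T_mul (h : G) : coc (T * h) = sl2zModTwoRep T (coc h) + coc T := by
  obtain ⟨-, -, h1, h2⟩ := pq _ _ _ _ (det4 h)
  rw [rho_T, coc_T]
  simp [coc, coe_T, Matrix.mul_apply, Fin.sum_univ_two, h1, h2]

lemma coc_one : coc 1 = 0 := by
  simp only [coc]; decide

lemma mem_gen (g : G) : g ∈ Subgroup.closure {S, T} := by
  simp [SpecialLinearGroup.SL2Z_generators]

lemma coc_mul (g : G) : ∀ h : G, coc (g * h) = sl2zModTwoRep g (coc h) + coc g := by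
  induction mem_gen g using Subgroup.closure_induction with
  | mem x hx =>
    rcases hx with rfl | rfl
    · exact coc_S_mul
    · exact coc_T_mul
  | one => simp [coc_one]
  | mul x y _ _ hx hy =>
    intro h
    rw [mul_assoc, hx, hy, hx y, map_mul, map_add, Module.End.mul_apply, add_assoc]
  | inv x _ hx =>
    intro h
    have e1 := hx (x⁻¹ * h)
    have e2 := hx x⁻¹
    rw [mul_inv_cancel_left] at e1
    rw [mul_inv_cancel, coc_one] at e2
    have e3 : ∀ v, sl2zModTwoRep x⁻¹ (sl2zModTwoRep x v) = v := by
      intro v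
      rw [← Module.End.mul_apply, ← map_mul]; simp
    have e4 : coc h = sl2zModTwoRep x (coc (x⁻¹ * h) - coc x⁻¹) := by
      rw [map_sub, eq_neg_of_add_eq_zero_left e2.symm, sub_neg_eq_add]
      exact e1
    rw [e4, e3]; abel

/-- the rep -/
noncomputable abbrev A := Rep.of sl2zModTwoRep

lemma cmul (f : cocycles₁ A) (g h : G) : (f (g * h) : Fin 2 → ZMod 2) = sl2zModTwoRep g (f h) + f g :=
  (mem_cocycles₁_iff f).1 f.2 g h

lemma two_zmod : ∀ x y : ZMod 2, x + y = 0 → x = y := by decide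

lemma c_S (f : cocycles₁ A) : (f S : Fin 2 → ZMod 2) 0 = (f S : Fin 2 → ZMod 2) 1 := by
  have hr : ∀ v, sl2zModTwoRep (-1) v = v := by
    intro v; rw [rho_apply]; ext i; fin_cases i <;> simp
  have hc : ∀ g : G, sl2zModTwoRep g (f (-1)) = f (-1) := by
    intro g
    have h1 := cmul f g (-1)
    have h2 := cmul f (-1) g
    rw [hr] at h2
    rw [show g * (-1 : G) = -1 * g by simp, h2] at h1
    rw [add_comm] at h1
    exact (add_right_cancel h1).symm
  have hS := hc S
  have hT := hc T
  rw [rho_S] at hS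
  rw [rho_T] at hT
  have hS0 := congrFun hS 0
  have hT0 := congrFun hT 0
  have h := cmul f S S
  rw [show (S * S : G) = -1 by ext i j; fin_cases i <;> fin_cases j <;> simp [coe_S], rho_S] at h
  have h0 := congrFun h 0
  simp at hS0 hT0 h0
  rw [← hS0, hT0] at h0
  exact (two_zmod _ _ h0.symm).symm

/-- the invariant -/
noncomputable def phi : cocycles₁ A →ₗ[ZMod 2] ZMod 2 where
  toFun f := (f T : Fin 2 → ZMod 2) 1
  map_add' _ _ := rfl
  map_smul' _ _ := rfl

lemma phi_surj : Function.Surjective phi := by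
  intro x
  let c : cocycles₁ A := ⟨coc, (mem_cocycles₁_iff (A := A) coc).2 coc_mul⟩
  have hc : phi c = 1 := by
    change coc T 1 = 1
    rw [coc_T]; rfl
  exact ⟨x • c, by rw [map_smul, hc]; simp⟩

lemma d_apply (x : Fin 2 → ZMod 2) (g : G) : (d₀₁ A).hom x g = sl2zModTwoRep g x - x := rfl

lemma ext_gen (f f' : cocycles₁ A) (hS : f S = f' S) (hT : f T = f' T) : f = f' := by
  ext1 g
  induction mem_gen g using Subgroup.closure_induction with
  | mem x hx =>
    rcases hx with rfl | rfl
    · exact hS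
    · exact hT
  | one => simp
  | mul x y _ _ hx hy =>
    have h1 := cmul f x y
    have h2 := cmul f' x y
    rw [hx, hy] at h1
    exact h1.trans h2.symm
  | inv x _ hx =>
    have h1 := cocycles₁_map_inv f x
    have h2 := cocycles₁_map_inv f' x
    rw [hx, ← h2] at h1
    have := congrArg (A.ρ x⁻¹) h1
    simpa using this

lemma fin_aux : ∀ s t : Fin 2 → ZMod 2, s 0 = s 1 → t 1 = 0 →
    s = ![t 0, s 0 + t 0] - ![s 0 + t 0, t 0] ∧
    t = ![s 0 + t 0 + t 0, t 0] - ![s 0 + t 0, t 0] := by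
  decide

lemma phi_ker (f : cocycles₁ A) : phi f = 0 ↔ ⇑f ∈ coboundaries₁ A := by
  constructor
  · intro h
    have h : (f T : Fin 2 → ZMod 2) 1 = 0 := h
    have hS := c_S f
    let x : Fin 2 → ZMod 2 :=
      ![(f S : Fin 2 → ZMod 2) 0 + (f T : Fin 2 → ZMod 2) 0, (f T : Fin 2 → ZMod 2) 0]
    let f' : cocycles₁ A := ⟨(d₀₁ A).hom x, d₀₁_apply_mem_cocycles₁ (A := A) x⟩
    have key : f = f' := by
      apply ext_gen
      · change (f S : Fin 2 → ZMod 2) = sl2zModTwoRep S x - x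
        rw [rho_S]
        exact (fin_aux (f S) (f T) hS h).1
      · change (f T : Fin 2 → ZMod 2) = sl2zModTwoRep T x - x
        rw [rho_T]
        exact (fin_aux (f S) (f T) hS h).2
    rw [key]
    exact ⟨x, rfl⟩
  · rintro ⟨x, hx⟩
    change (f T : Fin 2 → ZMod 2) 1 = 0
    have : (f T : Fin 2 → ZMod 2) = sl2zModTwoRep T x - x := (congrFun hx T).symm
    rw [this, rho_T]
    simp

noncomputable def equiv : (groupCohomology A 1 : Type) ≃ₗ[ZMod 2] ZMod 2 :=
  have hs : Function.Surjective (H1π A).hom := (ModuleCat.epi_iff_surjective _).1 inferInstance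
  ((H1π A).hom.quotKerEquivOfSurjective hs).symm ≪≫ₗ
    (Submodule.quotEquivOfEq _ _ (by
      ext f
      rw [LinearMap.mem_ker, LinearMap.mem_ker, phi_ker]
      exact H1π_eq_zero_iff f)) ≪≫ₗ
    phi.quotKerEquivOfSurjective phi_surj

end SL2ZAux

/-- `H^1(SL(2,ℤ), (ℤ/2ℤ)²) ≅ ℤ/2ℤ`; equivalently it has exactly `2` elements. -/
theorem groupCohomology_one_SL2Z_mod_two :
    Nonempty ((groupCohomology (Rep.of sl2zModTwoRep) 1 : Type) ≃+ ZMod 2) ∧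
    Nat.card (groupCohomology (Rep.of sl2zModTwoRep) 1 : Type) = 2 := by
  refine ⟨⟨SL2ZAux.equiv.toAddEquiv⟩, ?_⟩
  rw [Nat.card_congr SL2ZAux.equiv.toEquiv]
  simp
end

section
/- Let GL(2, ℤ/4ℤ) act on (ℤ/2ℤ)² through entrywise reduction modulo 2 (along the ring map ℤ/4ℤ → ℤ/2ℤ) followed by matrix–vector multiplication. Then the first group cohomology H^1(GL(2, ℤ/4ℤ), (ℤ/2ℤ)²) is isomorphic to ℤ/2ℤ; equivalently, it has exactly 2 elements. -/
/-- The representation of `GL(2, ℤ/4ℤ)` on `(ℤ/2ℤ)²` given by reducing matrix entries modulo `2`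
(along `ℤ/4ℤ → ℤ/2ℤ`) and then acting by matrix–vector multiplication. -/
noncomputable def gl2ZMod4Rep :
    Representation (ZMod 2) (Matrix.GeneralLinearGroup (Fin 2) (ZMod 4)) (Fin 2 → ZMod 2) :=
  (Matrix.toLinAlgEquiv' : Matrix (Fin 2) (Fin 2) (ZMod 2) ≃ₐ[ZMod 2]
      ((Fin 2 → ZMod 2) →ₗ[ZMod 2] (Fin 2 → ZMod 2))).toMonoidHom.comp
    ((Units.coeHom (Matrix (Fin 2) (Fin 2) (ZMod 2))).comp
      (Units.map (RingHom.toMonoidHom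
        (RingHom.mapMatrix (ZMod.castHom (show (2:ℕ) ∣ 4 by norm_num) (ZMod 2))))))

open groupCohomology

namespace GL2Aux

abbrev G := Matrix.GeneralLinearGroup (Fin 2) (ZMod 4)

def uu : G := ⟨!![1, 1; 0, 1], !![1, 3; 0, 1], by decide, by decide⟩
def ll : G := ⟨!![1, 0; 1, 1], !![1, 0; 3, 1], by decide, by decide⟩
def dd : G := ⟨!![1, 0; 0, 3], !![1, 0; 0, 3], by decide, by decide⟩

def lo (a : ZMod 4) : ZMod 2 := (ZMod.castHom (show (2:ℕ) ∣ 4 by norm_num) (ZMod 2)) a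
def hi (a : ZMod 4) : ZMod 2 := if a = 2 ∨ a = 3 then 1 else 0

def F1 (a b c d : ZMod 4) : ZMod 2 :=
  1 + lo c + lo d + lo a * hi d + lo b * hi a + lo a * hi b + lo b * hi c + lo c * hi b
    + lo d * hi a
def F2 (a b c d : ZMod 4) : ZMod 2 :=
  1 + lo b + lo c * hi d + lo a + lo d * hi c + lo a * hi d + lo b * hi c + lo c * hi b
    + lo d * hi a

def cc (g : G) : Fin 2 → ZMod 2 :=
  ![F1 (g.1 0 0) (g.1 0 1) (g.1 1 0) (g.1 1 1), F2 (g.1 0 0) (g.1 0 1) (g.1 1 0) (g.1 1 1)]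

lemma rep_apply (g : G) (v : Fin 2 → ZMod 2) : gl2ZMod4Rep g v =
    ![lo (g.1 0 0) * v 0 + lo (g.1 0 1) * v 1, lo (g.1 1 0) * v 0 + lo (g.1 1 1) * v 1] := by
  have : gl2ZMod4Rep g v = Matrix.mulVec
    ((RingHom.mapMatrix (ZMod.castHom (show (2:ℕ) ∣ 4 by norm_num) (ZMod 2))) g.1) v := rfl
  rw [this]
  ext i
  fin_cases i <;> simp [Matrix.mulVec, dotProduct, Fin.sum_univ_two, lo]

lemma unit_sq : ∀ e : ZMod 4, ∀ e' : ZMod 4, e * e' = 1 → e = 1 ∨ e = 3 := by decide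

lemma det_cases (g : G) : g.1 0 0 * g.1 1 1 - g.1 0 1 * g.1 1 0 = 1 ∨
    g.1 0 0 * g.1 1 1 - g.1 0 1 * g.1 1 0 = 3 := by
  rw [← Matrix.det_fin_two]
  refine unit_sq _ (g⁻¹).1.det ?_
  rw [← Matrix.det_mul]
  simp

set_option maxRecDepth 100000 in
lemma decomp : ∀ a b c d : ZMod 4, a * d - b * c = 1 → ∃ i j k m : ZMod 4,
    a = (1 + i * j) * (1 + k * m) + i * m ∧ b = (1 + i * j) * k + i ∧
    c = j * (1 + k * m) + m ∧ d = j * k + 1 := by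
  decide +kernel

lemma upow (n : ℕ) : ((uu ^ n : G)).1 = !![1, (n : ZMod 4); 0, 1] := by
  induction n with
  | zero => ext i j; fin_cases i <;> fin_cases j <;> simp
  | succ n ih =>
    rw [pow_succ, Units.val_mul, ih]
    ext i j; fin_cases i <;> fin_cases j <;> simp [uu, Matrix.mul_apply, Fin.sum_univ_two, add_comm]

lemma lpow (n : ℕ) : ((ll ^ n : G)).1 = !![1, 0; (n : ZMod 4), 1] := by
  induction n with
  | zero => ext i j; fin_cases i <;> fin_cases j <;> simp
  | succ n ih =>
    rw [pow_succ, Units.val_mul, ih]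
    ext i j; fin_cases i <;> fin_cases j <;> simp [ll, Matrix.mul_apply, Fin.sum_univ_two]

lemma ncast : ∀ i : ZMod 4, ((i.val : ℕ) : ZMod 4) = i := by decide

lemma decomp1 (g : G) (h : g.1 0 0 * g.1 1 1 - g.1 0 1 * g.1 1 0 = 1) :
    ∃ i j k m : ℕ, g = uu ^ i * (ll ^ j * (uu ^ k * ll ^ m)) := by
  obtain ⟨i, j, k, m, h1, h2, h3, h4⟩ := decomp _ _ _ _ h
  refine ⟨i.val, j.val, k.val, m.val, Units.ext ?_⟩
  simp only [Units.val_mul, upow, lpow, ncast]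
  ext x y
  fin_cases x <;> fin_cases y <;>
    simp [Matrix.mul_apply, Fin.sum_univ_two, h1, h2, h3, h4] <;> ring

lemma decomp2 (g : G) : ∃ i j k m l : ℕ, g = dd ^ l * (uu ^ i * (ll ^ j * (uu ^ k * ll ^ m))) := by
  rcases det_cases g with h | h
  · obtain ⟨i, j, k, m, e⟩ := decomp1 g h
    exact ⟨i, j, k, m, 0, by simpa using e⟩
  · have h' : (dd * g).1 0 0 * (dd * g).1 1 1 - (dd * g).1 0 1 * (dd * g).1 1 0 = 1 := by
      simp only [Units.val_mul, dd, Matrix.mul_apply, Fin.sum_univ_two]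
      simp
      have h8 : (3 * 3 - 1 : ZMod 4) = 0 := by decide
      linear_combination 3 * h + h8
    obtain ⟨i, j, k, m, e⟩ := decomp1 _ h'
    refine ⟨i, j, k, m, 1, ?_⟩
    rw [← e, pow_one, ← mul_assoc]
    have : dd * dd = 1 := Units.ext (by decide)
    rw [this, one_mul]

lemma gen_induction {P : G → Prop} (h1 : P 1) (hu : ∀ g, P g → P (uu * g))
    (hl : ∀ g, P g → P (ll * g)) (hd : ∀ g, P g → P (dd * g)) (g : G) : P g := by
  have hp : ∀ s : G, (∀ g, P g → P (s * g)) → ∀ n : ℕ, ∀ g, P g → P (s ^ n * g) := by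
    intro s hs n
    induction n with
    | zero => intro g hg; simpa using hg
    | succ n ih => intro g hg; rw [pow_succ, mul_assoc]; exact ih _ (hs _ hg)
  obtain ⟨i, j, k, m, l, rfl⟩ := decomp2 g
  have := hp ll hl m 1 h1
  rw [mul_one] at this
  exact hp _ hd _ _ (hp _ hu _ _ (hp _ hl _ _ (hp _ hu _ _ this)))

lemma ck_u : ∀ a b c d : ZMod 4, (a * d - b * c = 1 ∨ a * d - b * c = 3) →
    F1 (a + c) (b + d) c d = F1 a b c d + F2 a b c d ∧
    F2 (a + c) (b + d) c d = F2 a b c d + 1 := by decide +kernel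
lemma ck_l : ∀ a b c d : ZMod 4, (a * d - b * c = 1 ∨ a * d - b * c = 3) →
    F1 a b (a + c) (b + d) = F1 a b c d + 1 ∧
    F2 a b (a + c) (b + d) = F1 a b c d + F2 a b c d := by decide +kernel
lemma ck_d : ∀ a b c d : ZMod 4, (a * d - b * c = 1 ∨ a * d - b * c = 3) →
    F1 a b (3 * c) (3 * d) = F1 a b c d + 1 ∧
    F2 a b (3 * c) (3 * d) = F2 a b c d + 1 := by decide +kernel

lemma lo0 : lo 0 = 0 := by decide
lemma lo1 : lo 1 = 1 := by decide
lemma lo3 : lo 3 = 1 := by decide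

lemma rep_u (v : Fin 2 → ZMod 2) : gl2ZMod4Rep uu v = ![v 0 + v 1, v 1] := by
  rw [rep_apply]; simp [uu, lo0, lo1]
lemma rep_l (v : Fin 2 → ZMod 2) : gl2ZMod4Rep ll v = ![v 0, v 0 + v 1] := by
  rw [rep_apply]; simp [ll, lo0, lo1]
lemma rep_d (v : Fin 2 → ZMod 2) : gl2ZMod4Rep dd v = ![v 0, v 1] := by
  rw [rep_apply]; simp [dd, lo0, lo1, lo3]

lemma cc_one : cc 1 = 0 := by decide
lemma cc_uu : cc uu = ![0, 1] := by decide
lemma cc_ll : cc ll = ![1, 0] := by decide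
lemma cc_dd : cc dd = ![1, 1] := by decide

lemma cc_u (g : G) : cc (uu * g) = gl2ZMod4Rep uu (cc g) + cc uu := by
  have := ck_u _ _ _ _ (det_cases g)
  rw [rep_u, cc_uu]
  ext i
  fin_cases i <;> simp [cc, uu, Matrix.mul_apply, Fin.sum_univ_two, this]
lemma cc_l (g : G) : cc (ll * g) = gl2ZMod4Rep ll (cc g) + cc ll := by
  have := ck_l _ _ _ _ (det_cases g)
  rw [rep_l, cc_ll]
  ext i
  fin_cases i <;> simp [cc, ll, Matrix.mul_apply, Fin.sum_univ_two, this]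
lemma cc_d (g : G) : cc (dd * g) = gl2ZMod4Rep dd (cc g) + cc dd := by
  have := ck_d _ _ _ _ (det_cases g)
  rw [rep_d, cc_dd]
  ext i
  fin_cases i <;> simp [cc, dd, Matrix.mul_apply, Fin.sum_univ_two, this]

lemma cc_mul (g h : G) : cc (g * h) = gl2ZMod4Rep g (cc h) + cc g := by
  have key : ∀ s : G, (∀ g, cc (s * g) = gl2ZMod4Rep s (cc g) + cc s) → ∀ g,
      cc (g * h) = gl2ZMod4Rep g (cc h) + cc g →
      cc (s * g * h) = gl2ZMod4Rep (s * g) (cc h) + cc (s * g) := by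
    intro s hs g hg
    rw [mul_assoc, hs, hg, hs g, map_mul, map_add, Module.End.mul_apply, add_assoc]
  induction g using gen_induction with
  | h1 => rw [one_mul, cc_one, map_one]; simp
  | hu g ih => exact key _ cc_u g ih
  | hl g ih => exact key _ cc_l g ih
  | hd g ih => exact key _ cc_d g ih

/-- A cocycle vanishing on generators vanishes. -/
lemma eq_of_gens {f f' : G → Fin 2 → ZMod 2}
    (hf : ∀ g h, f (g * h) = gl2ZMod4Rep g (f h) + f g)
    (hf' : ∀ g h, f' (g * h) = gl2ZMod4Rep g (f' h) + f' g)
    (eu : f uu = f' uu) (el : f ll = f' ll) (ed : f dd = f' dd) : f = f' := by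
  have one : ∀ f : G → Fin 2 → ZMod 2,
      (∀ g h, f (g * h) = gl2ZMod4Rep g (f h) + f g) → f 1 = 0 := by
    intro f hf
    have := hf 1 1
    rw [mul_one, map_one] at this
    simpa using this
  funext g
  induction g using gen_induction with
  | h1 => rw [one f hf, one f' hf']
  | hu g ih => rw [hf, hf', ih, eu]
  | hl g ih => rw [hf, hf', ih, el]
  | hd g ih => rw [hf, hf', ih, ed]

lemma rel1 : dd * uu = uu * (uu * (uu * dd)) := Units.ext (by decide)
lemma rel2 : dd * ll = ll * (ll * (ll * dd)) := Units.ext (by decide)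
lemma rel3 : ll * (uu * (ll * (ll * (ll * (uu * ll))))) = uu := Units.ext (by decide)

def au (v : Fin 2 → ZMod 2) : Fin 2 → ZMod 2 := ![v 0 + v 1, v 1]
def al (v : Fin 2 → ZMod 2) : Fin 2 → ZMod 2 := ![v 0, v 0 + v 1]
def ad (v : Fin 2 → ZMod 2) : Fin 2 → ZMod 2 := ![v 0, v 1]

set_option synthInstance.maxHeartbeats 400000 in
set_option synthInstance.maxSize 2000 in
lemma solve : ∀ x y z : Fin 2 → ZMod 2,
    (ad x + z = au (au (au z + x) + x) + x) →
    (ad y + z = al (al (al z + y) + y) + y) →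
    (al (au (al (al (al (au y + x) + y) + y) + y) + x) + y = x) →
    ∃ (v : Fin 2 → ZMod 2) (e : ZMod 2),
      x = (au v - v) + e • ![0, 1] ∧ y = (al v - v) + e • ![1, 0] ∧
      z = (ad v - v) + e • ![1, 1] := by decide +kernel

lemma classify (f : G → Fin 2 → ZMod 2)
    (hf : ∀ g h, f (g * h) = gl2ZMod4Rep g (f h) + f g) :
    ∃ (v : Fin 2 → ZMod 2) (e : ZMod 2), f = fun g => (gl2ZMod4Rep g v - v) + e • cc g := by
  have h1 := congrArg f rel1
  have h2 := congrArg f rel2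
  have h3 := congrArg f rel3
  simp only [hf, rep_u, rep_l, rep_d] at h1 h2 h3
  obtain ⟨v, e, hx, hy, hz⟩ := solve (f uu) (f ll) (f dd) h1 h2 h3
  refine ⟨v, e, eq_of_gens hf ?_ ?_ ?_ ?_⟩
  · intro g h
    simp only [map_mul, Module.End.mul_apply, map_add, map_sub, map_smul, cc_mul, smul_add]
    abel
  · rw [hx, rep_u, cc_uu]; rfl
  · rw [hy, rep_l, cc_ll]; rfl
  · rw [hz, rep_d, cc_dd]; rfl

noncomputable def cz : cocycles₁ (Rep.of gl2ZMod4Rep) :=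
  ⟨cc, (mem_cocycles₁_iff (A := Rep.of gl2ZMod4Rep) cc).2 cc_mul⟩

lemma cz_ne : H1π (Rep.of gl2ZMod4Rep) cz ≠ 0 := by
  intro h
  rw [H1π_eq_zero_iff] at h
  obtain ⟨v, hv⟩ := h
  have h' : gl2ZMod4Rep dd v - v = cc dd := congrFun hv dd
  rw [rep_d, cc_dd] at h'
  have := congrFun h' 0
  simp at this

lemma all (x : H1 (Rep.of gl2ZMod4Rep)) : x = 0 ∨ x = H1π (Rep.of gl2ZMod4Rep) cz := by
  induction x using H1_induction_on with
  | h f =>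
    obtain ⟨v, e, h⟩ := classify f ((mem_cocycles₁_iff (A := Rep.of gl2ZMod4Rep) f.1).1 f.2)
    have he : e = 0 ∨ e = 1 := by clear h; revert e; decide
    rcases he with rfl | rfl
    · left
      rw [H1π_eq_zero_iff]
      refine ⟨v, ?_⟩
      funext g
      have := congrFun h g
      simp only [zero_smul, add_zero] at this
      exact this.symm
    · right
      rw [H1π_eq_iff]
      refine ⟨v, ?_⟩
      funext g
      have := congrFun h g
      simp only [one_smul] at this
      exact (sub_eq_of_eq_add this).symm

lemma card : Nat.card (groupCohomology (Rep.of gl2ZMod4Rep) 1 : Type) = 2 := by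
  rw [Nat.card_eq_two_iff]
  refine ⟨0, H1π (Rep.of gl2ZMod4Rep) cz, cz_ne.symm, ?_⟩
  ext x
  simpa using all x

noncomputable def equiv2 {M : Type} [AddCommGroup M] (h : Nat.card M = 2) : M ≃+ ZMod 2 :=
  have : Fact (Nat.Prime 2) := ⟨Nat.prime_two⟩
  have : IsAddCyclic M := isAddCyclic_of_prime_card h
  ((ZMod.ringEquivCongr h.symm).toAddEquiv.trans (zmodAddCyclicAddEquiv this)).symm

end GL2Aux

/-- `H^1(GL(2, ℤ/4ℤ), (ℤ/2ℤ)²) ≅ ℤ/2ℤ`; equivalently it has exactly `2`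
elements. -/
theorem groupCohomology_one_GL2_ZMod4_mod_two :
    Nonempty ((groupCohomology (Rep.of gl2ZMod4Rep) 1 : Type) ≃+ ZMod 2) ∧
    Nat.card (groupCohomology (Rep.of gl2ZMod4Rep) 1 : Type) = 2 := by
  have h := GL2Aux.card
  refine ⟨?_, h⟩
  exact ⟨GL2Aux.equiv2 h⟩
end

section
/- Let p be a prime. For every g ∈ SL(2, ℤ/pℤ), the ℤ/pℤ-algebra endomorphism σ_g of the polynomial ring (ℤ/pℤ)[X, Y] determined by the linear substitution σ_g(X) = g₁₁·X + g₂₁·Y and σ_g(Y) = g₁₂·X + g₂₂·Y fixes the polynomial X^p·Y − X·Y^p, i.e. σ_g(X^p·Y − X·Y^p) = X^p·Y − X·Y^p. -/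
open MvPolynomial

/-- for a prime `p` and `g ∈ SL(2, ℤ/pℤ)`, the algebra endomorphism of
`(ℤ/pℤ)[X, Y]` given by the linear substitution `X ↦ g₁₁X + g₂₁Y`, `Y ↦ g₁₂X + g₂₂Y`
fixes the polynomial `X^p·Y − X·Y^p`. Here `X = X 0` and `Y = X 1` in
`MvPolynomial (Fin 2) (ZMod p)`. -/
theorem sl2_fixes_XpY_sub_XYp (p : ℕ) [Fact p.Prime]
    (g : Matrix.SpecialLinearGroup (Fin 2) (ZMod p)) :
    MvPolynomial.aeval
        (fun i : Fin 2 =>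
          MvPolynomial.C ((g : Matrix (Fin 2) (Fin 2) (ZMod p)) 0 i) * MvPolynomial.X 0 +
            MvPolynomial.C ((g : Matrix (Fin 2) (Fin 2) (ZMod p)) 1 i) * MvPolynomial.X 1)
        ((MvPolynomial.X 0 : MvPolynomial (Fin 2) (ZMod p)) ^ p * MvPolynomial.X 1 -
          MvPolynomial.X 0 * MvPolynomial.X 1 ^ p) =
      (MvPolynomial.X 0 : MvPolynomial (Fin 2) (ZMod p)) ^ p * MvPolynomial.X 1 -
        MvPolynomial.X 0 * MvPolynomial.X 1 ^ p := by
  have hdet := g.det_coe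
  rw [Matrix.det_fin_two] at hdet
  have h := congrArg (MvPolynomial.C (σ := Fin 2)) hdet
  simp only [map_sub, map_mul, map_one] at h
  have key : ∀ a c : ZMod p,
      ((MvPolynomial.C a * MvPolynomial.X 0 + MvPolynomial.C c * MvPolynomial.X 1 :
        MvPolynomial (Fin 2) (ZMod p))) ^ p =
      MvPolynomial.C a * MvPolynomial.X 0 ^ p + MvPolynomial.C c * MvPolynomial.X 1 ^ p := by
    intro a c
    rw [add_pow_char, mul_pow, mul_pow, ← map_pow, ← map_pow, ZMod.pow_card, ZMod.pow_card]
  simp only [map_sub, map_mul, map_pow, MvPolynomial.aeval_X]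
  rw [key, key]
  linear_combination ((MvPolynomial.X 0 : MvPolynomial (Fin 2) (ZMod p)) ^ p * MvPolynomial.X 1 -
        MvPolynomial.X 0 * MvPolynomial.X 1 ^ p) * h
end

section
/- Let p be a prime. Let Sym^{p+1} denote the SL(2,ℤ)-representation on the ℤ-module of homogeneous polynomials of degree p+1 in ℤ[X, Y], where g ∈ SL(2,ℤ) acts by the linear substitution X ↦ g₁₁·X + g₂₁·Y, Y ↦ g₁₂·X + g₂₂·Y. Then the first group cohomology H^1(SL(2,ℤ), Sym^{p+1}) contains a nonzero element x with p·x = 0; in other words, it contains nontrivial p-torsion. -/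
open MvPolynomial in
/-- the substitution -/
noncomputable def subst2 (g : Matrix.SpecialLinearGroup (Fin 2) ℤ) :
    MvPolynomial (Fin 2) ℤ →ₐ[ℤ] MvPolynomial (Fin 2) ℤ :=
  MvPolynomial.aeval (fun i : Fin 2 =>
    MvPolynomial.C ((g : Matrix (Fin 2) (Fin 2) ℤ) 0 i) * MvPolynomial.X 0 +
      MvPolynomial.C ((g : Matrix (Fin 2) (Fin 2) ℤ) 1 i) * MvPolynomial.X 1)

open MvPolynomial in
lemma subst2_one : subst2 1 = AlgHom.id ℤ _ := by
  apply MvPolynomial.algHom_ext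
  intro i
  fin_cases i <;> simp [subst2]

open MvPolynomial in
lemma subst2_mul (g h : Matrix.SpecialLinearGroup (Fin 2) ℤ) :
    subst2 (g * h) = (subst2 g).comp (subst2 h) := by
  apply MvPolynomial.algHom_ext
  intro i
  simp only [subst2, AlgHom.comp_apply, aeval_X, map_add, map_mul, algHom_C,
    MvPolynomial.algebraMap_eq, Matrix.SpecialLinearGroup.coe_mul, Matrix.mul_apply,
    Fin.sum_univ_two]
  ring

open MvPolynomial in
lemma subst2_hom (g : Matrix.SpecialLinearGroup (Fin 2) ℤ) (n : ℕ)
    (f : MvPolynomial (Fin 2) ℤ) (hf : f.IsHomogeneous n) : (subst2 g f).IsHomogeneous n := by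
  have := hf.aeval (n := 1) (S := ℤ) (fun i : Fin 2 =>
    MvPolynomial.C ((g : Matrix (Fin 2) (Fin 2) ℤ) 0 i) * MvPolynomial.X 0 +
      MvPolynomial.C ((g : Matrix (Fin 2) (Fin 2) ℤ) 1 i) * (MvPolynomial.X 1 :
        MvPolynomial (Fin 2) ℤ)) (fun i => by
      apply IsHomogeneous.add
      · simpa using (isHomogeneous_C (Fin 2) _).mul (isHomogeneous_X ℤ (0 : Fin 2))
      · simpa using (isHomogeneous_C (Fin 2) _).mul (isHomogeneous_X ℤ (1 : Fin 2)))
  rwa [one_mul] at this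

/-- the representation -/
noncomputable def symRep (n : ℕ) : Representation ℤ (Matrix.SpecialLinearGroup (Fin 2) ℤ)
    (MvPolynomial.homogeneousSubmodule (Fin 2) ℤ n) where
  toFun g := (subst2 g).toLinearMap.restrict (fun f hf => subst2_hom g n f hf)
  map_one' := by
    ext1 f
    apply Subtype.ext
    simp [subst2_one]
  map_mul' g h := by
    ext1 f
    apply Subtype.ext
    simp only [subst2_mul]
    rfl

open MvPolynomial in
lemma dickson_dvd (p : ℕ) (hp : p.Prime) (g : Matrix.SpecialLinearGroup (Fin 2) ℤ) :
    (C (p : ℤ) : MvPolynomial (Fin 2) ℤ) ∣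
      subst2 g (X 0 ^ p * X 1 - X 0 * X 1 ^ p) - (X 0 ^ p * X 1 - X 0 * X 1 ^ p) := by
  have : Fact p.Prime := ⟨hp⟩
  rw [C_dvd_iff_map_hom_eq_zero (Int.castRingHom (ZMod p)) (p : ℤ)
    (fun r => by simpa using ZMod.intCast_zmod_eq_zero_iff_dvd r p)]
  have hdet := congrArg (Int.cast : ℤ → ZMod p) (g.det_coe)
  rw [Matrix.det_fin_two] at hdet
  push_cast at hdet
  have hC := congrArg (C (σ := Fin 2)) hdet
  simp only [map_sub, map_mul, map_one] at hC
  have hfer : ∀ a : ℤ, (C (a : ZMod p) : MvPolynomial (Fin 2) (ZMod p)) ^ p = C (a : ZMod p) := by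
    intro a
    rw [← C_pow, ZMod.pow_card]
  simp only [subst2, map_sub, map_mul, map_pow, map_add, aeval_X, map_X, map_C, add_pow_char,
    mul_pow, Int.coe_castRingHom, hfer]
  linear_combination (X 0 ^ p * X 1 - X 0 * X 1 ^ p) * hC

open MvPolynomial in
lemma no_inv (p : ℕ) (hp : p.Prime) (h : MvPolynomial (Fin 2) ℤ)
    (hinv : ∀ g, subst2 g ((X 0 ^ p * X 1 - X 0 * X 1 ^ p) - C (p : ℤ) * h) =
      (X 0 ^ p * X 1 - X 0 * X 1 ^ p) - C (p : ℤ) * h) : False := by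
  set F := (X 0 ^ p * X 1 - X 0 * X 1 ^ p) - C (p : ℤ) * h with hF
  set Q : Polynomial ℤ := aeval ![1, Polynomial.X] F with hQ
  have hev : ∀ m : ℤ, Q.eval m = MvPolynomial.eval ![1, m] F := by
    intro m
    have : ((Polynomial.aeval m).comp (aeval ![1, Polynomial.X]) :
        MvPolynomial (Fin 2) ℤ →ₐ[ℤ] ℤ) = aeval ![1, m] := by
      apply MvPolynomial.algHom_ext
      intro i
      fin_cases i <;> simp
    have := congrArg (fun φ => φ F) this
    simpa [hQ, Polynomial.aeval_def, MvPolynomial.aeval_eq_eval] using this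
  have hconst : ∀ m : ℤ, MvPolynomial.eval ![1, m] F = MvPolynomial.eval ![1, 0] F := by
    intro m
    let g : Matrix.SpecialLinearGroup (Fin 2) ℤ := ⟨!![1, m; 0, 1], by simp⟩
    have : ((aeval ![1, 0]).comp (subst2 g) : MvPolynomial (Fin 2) ℤ →ₐ[ℤ] ℤ)
        = aeval ![1, m] := by
      apply MvPolynomial.algHom_ext
      intro i
      fin_cases i <;> simp [subst2, g]
    have := congrArg (fun φ => φ F) this
    simp only [AlgHom.comp_apply, hinv g] at this
    simpa [MvPolynomial.aeval_eq_eval] using this.symm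
  have hQC : Q = Polynomial.C (MvPolynomial.eval ![1, 0] F) := by
    apply Polynomial.funext
    intro m
    rw [hev, hconst, Polynomial.eval_C]
  have h1 : Q.coeff 1 = 0 := by rw [hQC, Polynomial.coeff_C]; simp
  have hQ2 : Q = Polynomial.X - Polynomial.X ^ p -
      Polynomial.C (p : ℤ) * aeval ![1, Polynomial.X] h := by
    simp [hQ, hF]
  rw [hQ2, Polynomial.coeff_sub, Polynomial.coeff_sub, Polynomial.coeff_C_mul,
    Polynomial.coeff_X_one, Polynomial.coeff_X_pow, if_neg hp.one_lt.ne] at h1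
  have : (p : ℤ) ∣ 1 := ⟨_, by linarith⟩
  have h2 : p ∣ 1 := by exact_mod_cast this
  exact hp.one_lt.ne' (Nat.dvd_one.mp h2)

open groupCohomology in
lemma H1_torsion_aux {G V : Type} [Group G] [AddCommGroup V] (ρ : Representation ℤ G V)
    (p : ℕ) (htf : ∀ v w : V, p • v = p • w → v = w) (f : V) (c : G → V)
    (hc : ∀ g, p • c g = ρ g f - f)
    (hno : ∀ h : V, ¬ ∀ g, ρ g (f - p • h) = f - p • h) :
    ∃ x : groupCohomology (Rep.of ρ) 1, x ≠ 0 ∧ p • x = 0 := by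
  have hcoc : c ∈ cocycles₁ (Rep.of ρ) := by
    rw [mem_cocycles₁_iff]
    intro g h
    apply htf
    change p • c (g * h) = p • (ρ g (c h) + c g)
    rw [smul_add, ← map_nsmul, hc, hc, hc, map_sub, map_mul]
    simp
  refine ⟨H1π (Rep.of ρ) ⟨c, hcoc⟩, ?_, ?_⟩
  · intro h0
    rw [H1π_eq_zero_iff] at h0
    obtain ⟨h, hh⟩ := h0
    apply hno h
    intro g
    have hg : ρ g h - h = c g := congrFun hh g
    have := hc g
    rw [← hg] at this
    rw [map_sub, map_nsmul]
    rw [smul_sub] at this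
    rw [sub_eq_sub_iff_sub_eq_sub, ← this]
  · rw [← map_nsmul, H1π_eq_zero_iff]
    refine ⟨f, ?_⟩
    funext g
    exact (hc g).symm


/-- let `p` be a prime and let `Sym^{p+1}` be the `SL(2,ℤ)`-representation on the
ℤ-module of homogeneous polynomials of degree `p+1` in `ℤ[X,Y]` (here `X = X 0`, `Y = X 1` in
`MvPolynomial (Fin 2) ℤ`), where `g` acts by the substitution `X ↦ g₁₁X + g₂₁Y`,
`Y ↦ g₁₂X + g₂₂Y`. Then `H^1(SL(2,ℤ), Sym^{p+1})` contains a nonzero element killed by `p`,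
i.e. nontrivial `p`-torsion. -/
theorem H1_SL2Z_sym_p_add_one_has_p_torsion (p : ℕ) (hp : p.Prime) :
    ∃ ρ : Representation ℤ (Matrix.SpecialLinearGroup (Fin 2) ℤ)
        (MvPolynomial.homogeneousSubmodule (Fin 2) ℤ (p + 1)),
      (∀ (g : Matrix.SpecialLinearGroup (Fin 2) ℤ)
          (f : MvPolynomial.homogeneousSubmodule (Fin 2) ℤ (p + 1)),
          (ρ g f : MvPolynomial (Fin 2) ℤ) =
            MvPolynomial.aeval
              (fun i : Fin 2 =>
                MvPolynomial.C ((g : Matrix (Fin 2) (Fin 2) ℤ) 0 i) * MvPolynomial.X 0 +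
                  MvPolynomial.C ((g : Matrix (Fin 2) (Fin 2) ℤ) 1 i) * MvPolynomial.X 1)
              (f : MvPolynomial (Fin 2) ℤ)) ∧
      ∃ x : groupCohomology (Rep.of ρ) 1, x ≠ 0 ∧ p • x = 0 := by
  have hpz : (p : ℤ) ≠ 0 := by exact_mod_cast hp.ne_zero
  refine ⟨symRep (p + 1), fun g f => rfl, ?_⟩
  have hf : (MvPolynomial.X 0 ^ p * MvPolynomial.X 1 -
      MvPolynomial.X 0 * MvPolynomial.X 1 ^ p : MvPolynomial (Fin 2) ℤ).IsHomogeneous (p + 1) := by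
    apply MvPolynomial.IsHomogeneous.sub
    · exact (MvPolynomial.isHomogeneous_X_pow _ _).mul (MvPolynomial.isHomogeneous_X _ _)
    · rw [add_comm p 1]
      exact (MvPolynomial.isHomogeneous_X _ _).mul (MvPolynomial.isHomogeneous_X_pow _ _)
  have hq : ∀ g, ∃ q : MvPolynomial.homogeneousSubmodule (Fin 2) ℤ (p + 1),
      p • q = symRep (p + 1) g ⟨_, hf⟩ - ⟨_, hf⟩ := by
    intro g
    obtain ⟨q, hq⟩ := dickson_dvd p hp g
    have hh := (subst2_hom g _ _ hf).sub hf
    rw [hq] at hh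
    refine ⟨⟨q, fun d hd => hh ?_⟩, Subtype.ext ?_⟩
    · rw [MvPolynomial.coeff_C_mul]
      exact mul_ne_zero hpz hd
    · refine Eq.trans ?_ hq.symm
      simp [nsmul_eq_mul]
  choose c hc using hq
  refine H1_torsion_aux _ p ?_ ⟨_, hf⟩ c hc ?_
  · intro v w hvw
    exact smul_right_injective _ hp.ne_zero hvw
  · intro h hinv
    apply no_inv p hp h.1
    intro g
    have := congrArg Subtype.val (hinv g)
    have e : ((p • h : MvPolynomial.homogeneousSubmodule (Fin 2) ℤ (p + 1)) :
      MvPolynomial (Fin 2) ℤ) = MvPolynomial.C (p : ℤ) * h.1 := by simp [nsmul_eq_mul]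
    rw [← e]
    exact this
end

section
/- For a ∈ M[2], the translation x ↦ x + a preserves M* and descends to a well-defined permutation of Q commuting with φ; it carries sections of φ to sections and hence induces an action of the group M[2] on the 4-element set T. This action is transitive (and hence, since |M[2]| = |T| = 4, simply transitive). -/
/-! Common setup: `M = (ℤ/4ℤ)²`, the sets `M*` and `M[2]*`, the quotient `Q` of `M*` by
`x ∼ −x`, and the doubling map `φ : Q → M`. -/

/-- `M = (ℤ/4ℤ)²`. -/
abbrev Mfour := ZMod 4 × ZMod 4

/-- `M* ⊆ M`, the set of elements of additive order exactly `4`. -/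
def MstarSet : Set Mfour := {x | addOrderOf x = 4}

/-- `M[2]* ⊆ M`, the set of elements of additive order exactly `2`. -/
def M2starSet : Set Mfour := {x | addOrderOf x = 2}

/-- The subtype of elements of `M` of additive order exactly `4`. -/
abbrev Mstar := {x : Mfour // x ∈ MstarSet}

/-- The equivalence relation `x ∼ y ↔ y = x ∨ y = −x` on `M*`. -/
instance negSetoid : Setoid Mstar where
  r x y := (y : Mfour) = x ∨ (y : Mfour) = -x
  iseqv := by
    constructor
    · exact fun x => Or.inl rfl
    · rintro x y (h | h)
      · exact Or.inl h.symm
      · right; rw [h, neg_neg]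
    · rintro x y z (h | h) (h' | h')
      · exact Or.inl (h'.trans h)
      · exact Or.inr (by rw [h', h])
      · exact Or.inr (h'.trans h)
      · exact Or.inl (by rw [h', h, neg_neg])

/-- `Q`, the quotient of `M*` by `x ∼ −x`. -/
abbrev Qneg := Quotient negSetoid

/-- The map `φ : Q → M` induced by `x ↦ x + x`; it takes values in `M[2]*`. -/
def phiQ : Qneg → Mfour :=
  Quotient.lift (fun x : Mstar => (x : Mfour) + (x : Mfour)) (by
    have key : ∀ v : Mfour, -v + -v = v + v := by decide
    rintro x y (h | h)
    · show (x : Mfour) + x = (y : Mfour) + y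
      rw [h]
    · show (x : Mfour) + x = (y : Mfour) + y
      rw [h]; exact (key x).symm)

/-- A subset `S ⊆ Q` is a section of `φ` if `φ` restricted to `S` is a bijection from `S`
onto `M[2]*`. -/
def IsSection (S : Set Qneg) : Prop := Set.BijOn phiQ S M2starSet

/-- The set `T` of unordered pairs `{S, Q∖S}` with `S` a section of `φ`. -/
def TSet : Set (Set (Set Qneg)) := {t | ∃ S : Set Qneg, IsSection S ∧ t = {S, Sᶜ}}

/-- `M[2] ⊆ M`, the subgroup of elements killed by `2`. -/
def Mtwo : AddSubgroup Mfour where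
  carrier := {a | a + a = 0}
  zero_mem' := by simp
  add_mem' := by
    intro a b ha hb
    have key : ∀ a b : Mfour, a + a = 0 → b + b = 0 → (a + b) + (a + b) = 0 := by decide
    exact key a b ha hb
  neg_mem' := by
    intro a ha
    have key : ∀ a : Mfour, a + a = 0 → (-a) + (-a) = 0 := by decide
    exact key a ha

theorem mem_Mstar (x : Mfour) : x ∈ MstarSet ↔ x + x ≠ 0 := by
  constructor
  · intro h h0
    have h4 : addOrderOf x = 4 := h
    have : addOrderOf x ∣ 2 := addOrderOf_dvd_of_nsmul_eq_zero (by rw [two_nsmul]; exact h0)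
    rw [h4] at this
    revert this; decide
  · intro h
    have k : ∀ x : Mfour, 4 • x = 0 := by decide
    have := addOrderOf_eq_prime_pow (p := 2) (n := 1) (x := x)
      (by rw [pow_one, two_nsmul]; exact h) (k x)
    exact this

theorem mem_M2star (x : Mfour) : x ∈ M2starSet ↔ x + x = 0 ∧ x ≠ 0 := by
  show addOrderOf x = 2 ↔ _
  rw [addOrderOf_eq_prime_iff, two_nsmul]

theorem phi_mk (x : Mstar) : phiQ ⟦x⟧ = (x : Mfour) + x := rfl

theorem phi_cases (q : Qneg) : phiQ q = (2, 0) ∨ phiQ q = (0, 2) ∨ phiQ q = (2, 2) := by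
  induction q using Quotient.inductionOn with
  | h x =>
    have k : ∀ x : Mfour, x + x ≠ 0 → x + x = (2, 0) ∨ x + x = (0, 2) ∨ x + x = (2, 2) := by
      decide
    exact k x ((mem_Mstar _).1 x.2)

theorem phi_mem (q : Qneg) : phiQ q ∈ M2starSet := by
  rw [mem_M2star]
  rcases phi_cases q with h | h | h <;> rw [h] <;> decide

theorem add_mem_Mstar (a : Mtwo) (x : Mstar) : ((x : Mfour) + (a : Mfour)) ∈ MstarSet := by
  have hx := (mem_Mstar _).1 x.2
  have ha : (a : Mfour) + a = 0 := a.2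
  rw [mem_Mstar, add_add_add_comm, ha, add_zero]
  exact hx

theorem Mtwo_neg (a : Mtwo) : -(a : Mfour) = a := by
  have ha : (a : Mfour) + a = 0 := a.2
  exact neg_eq_of_add_eq_zero_left ha

def trQ (a : Mtwo) : Qneg → Qneg :=
  Quotient.map (fun x : Mstar => (⟨(x : Mfour) + a, add_mem_Mstar a x⟩ : Mstar)) (by
    rintro x y (h | h)
    · left; show (y : Mfour) + a = x + a; rw [h]
    · right; show (y : Mfour) + a = -(x + a); rw [h, neg_add, Mtwo_neg])

theorem trQ_add (a b : Mtwo) (q : Qneg) : trQ (a + b) q = trQ b (trQ a q) := by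
  induction q using Quotient.inductionOn with
  | h x =>
    apply Quotient.sound
    left
    show (x : Mfour) + a + b = x + (a + b)
    rw [add_assoc]

theorem trQ_zero (q : Qneg) : trQ 0 q = q := by
  induction q using Quotient.inductionOn with
  | h x =>
    apply Quotient.sound
    left
    show (x : Mfour) = x + 0
    rw [add_zero]

theorem trQ_trQ (a : Mtwo) (q : Qneg) : trQ a (trQ a q) = q := by
  rw [← trQ_add]
  have : a + a = 0 := Subtype.ext a.2
  rw [this, trQ_zero]

def actQ (a : Mtwo) : Equiv.Perm Qneg := ⟨trQ a, trQ a, trQ_trQ a, trQ_trQ a⟩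

theorem phi_act (a : Mtwo) (q : Qneg) : phiQ (actQ a q) = phiQ q := by
  induction q using Quotient.inductionOn with
  | h x =>
    have ha : (a : Mfour) + a = 0 := a.2
    show (x : Mfour) + a + (x + a) = x + x
    rw [add_add_add_comm, ha, add_zero]

theorem act_fix (a : Mtwo) (q : Qneg) (h : (a : Mfour) = phiQ q) : actQ a q = q := by
  induction q using Quotient.inductionOn with
  | h x =>
    apply Quotient.sound
    right
    show (x : Mfour) = -(x + a)
    rw [neg_add, Mtwo_neg, h, phi_mk, neg_add_cancel_left]

theorem mem_image_act (a : Mtwo) (S : Set Qneg) (q : Qneg) :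
    q ∈ actQ a '' S ↔ actQ a q ∈ S := by
  constructor
  · rintro ⟨p, hp, rfl⟩
    have : actQ a (actQ a p) = p := trQ_trQ a p
    rwa [this]
  · intro h
    exact ⟨_, h, trQ_trQ a q⟩

theorem section_image (a : Mtwo) (S : Set Qneg) (hS : IsSection S) :
    IsSection (actQ a '' S) := by
  refine ⟨fun q _ => phi_mem q, ?_, ?_⟩
  · rintro _ ⟨p, hp, rfl⟩ _ ⟨r, hr, rfl⟩ h
    rw [phi_act, phi_act] at h
    rw [hS.2.1 hp hr h]
  · intro v hv
    obtain ⟨p, hp, rfl⟩ := hS.2.2 hv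
    exact ⟨_, ⟨p, hp, rfl⟩, phi_act a p⟩

theorem fiber (a : Mtwo) (h0 : (a : Mfour) ≠ 0) (q r : Qneg) (h : (a : Mfour) ≠ phiQ q)
    (hr : phiQ r = phiQ q) : r = q ∨ r = actQ a q := by
  induction q using Quotient.inductionOn with
  | h x =>
  induction r using Quotient.inductionOn with
  | h y =>
    have k : ∀ a : Mfour, a + a = 0 → a ≠ 0 → ∀ x : Mfour, x + x ≠ 0 → a ≠ x + x →
        ∀ y : Mfour, y + y = x + x → (x = y ∨ x = -y) ∨ (x + a = y ∨ x + a = -y) := by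
      decide +kernel
    rcases k a a.2 h0 x ((mem_Mstar _).1 x.2) h y hr with h | h
    · left; exact Quotient.sound h
    · right; exact Quotient.sound h

theorem act_ne (a : Mtwo) (h0 : (a : Mfour) ≠ 0) (q : Qneg) (h : (a : Mfour) ≠ phiQ q) :
    actQ a q ≠ q := by
  induction q using Quotient.inductionOn with
  | h x =>
    intro e
    have k : ∀ a : Mfour, a ≠ 0 → ∀ x : Mfour, a ≠ x + x →
        a + a = 0 → ¬ (x = x + a ∨ x = -(x + a)) := by
      decide +kernel
    exact k a h0 x h a.2 (Quotient.exact e)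

theorem act_swap (a : Mtwo) (h0 : (a : Mfour) ≠ 0) (q : Qneg) (h : (a : Mfour) ≠ phiQ q)
    (S : Set Qneg) (hS : IsSection S) : actQ a q ∈ S ↔ q ∉ S := by
  constructor
  · intro h1 h2
    exact act_ne a h0 q h (hS.2.1 h1 h2 (phi_act a q))
  · intro h1
    obtain ⟨s, hs, e⟩ := hS.2.2 (phi_mem q)
    rcases fiber a h0 q s h e with rfl | rfl
    · exact absurd hs h1
    · exact hs

theorem agree_const (S R : Set Qneg) (hS : IsSection S) (hR : IsSection R) (q r : Qneg)
    (h : phiQ r = phiQ q) : (r ∈ S ↔ r ∈ R) ↔ (q ∈ S ↔ q ∈ R) := by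
  obtain ⟨a, h0, ha⟩ : ∃ a : Mtwo, (a : Mfour) ≠ 0 ∧ (a : Mfour) ≠ phiQ q := by
    by_cases h : phiQ q = (2, 0)
    · exact ⟨⟨(0, 2), show _ + _ = _ by decide⟩, by decide, by rw [h]; decide⟩
    · exact ⟨⟨(2, 0), show _ + _ = _ by decide⟩, by decide, fun e => h e.symm⟩
  rcases fiber a h0 q r ha h with rfl | rfl
  · rfl
  · rw [act_swap a h0 q ha S hS, act_swap a h0 q ha R hR]
    tauto

theorem agree_prop (S R : Set Qneg) (hS : IsSection S) (hR : IsSection R) (v : Mfour) :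
    ∃ P : Prop, ∀ r, phiQ r = v → ((r ∈ S ↔ r ∈ R) ↔ P) := by
  by_cases h : ∃ q, phiQ q = v
  · obtain ⟨q, rfl⟩ := h
    exact ⟨_, fun r hr => agree_const S R hS hR q r hr⟩
  · exact ⟨True, fun r hr => absurd ⟨r, hr⟩ h⟩

theorem act_zero (q : Qneg) : actQ 0 q = q := trQ_zero q

theorem iff_of_not_iff {P Q R : Prop} (h : ¬ (P ↔ Q)) (h' : ¬ (P ↔ R)) : Q ↔ R := by
  tauto

theorem exists_act (S R : Set Qneg) (hS : IsSection S) (hR : IsSection R) :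
    ∃ a : Mtwo, (∀ q, actQ a q ∈ S ↔ q ∈ R) ∨ (∀ q, actQ a q ∈ S ↔ q ∉ R) := by
  obtain ⟨P1, h1⟩ := agree_prop S R hS hR (2, 0)
  obtain ⟨P2, h2⟩ := agree_prop S R hS hR (0, 2)
  obtain ⟨P3, h3⟩ := agree_prop S R hS hR (2, 2)
  have key : ∀ a : Mtwo, (a : Mfour) ≠ 0 →
      ((∀ q, phiQ q = a → (q ∈ S ↔ q ∈ R)) ∧ (∀ q, phiQ q ≠ a → ¬ (q ∈ S ↔ q ∈ R)) ∨
       (∀ q, phiQ q = a → ¬ (q ∈ S ↔ q ∈ R)) ∧ (∀ q, phiQ q ≠ a → (q ∈ S ↔ q ∈ R))) →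
      ((∀ q, actQ a q ∈ S ↔ q ∈ R) ∨ (∀ q, actQ a q ∈ S ↔ q ∉ R)) := by
    intro a h0 h
    refine h.imp ?_ ?_
    all_goals
      rintro ⟨u, w⟩ q
      by_cases e : phiQ q = a
      · rw [act_fix a q e.symm]
        have := u q e
        tauto
      · rw [act_swap a h0 q (fun h => e h.symm) S hS]
        have := w q e
        tauto
  have d1 : ((2, 0) : Mfour) ≠ (0, 2) := by decide
  have d2 : ((2, 0) : Mfour) ≠ (2, 2) := by decide
  have d3 : ((0, 2) : Mfour) ≠ (2, 2) := by decide
  have A1 : ¬ (P1 ↔ P2) → (P2 ↔ P3) → ∃ a : Mtwo, (∀ q, actQ a q ∈ S ↔ q ∈ R) ∨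
      (∀ q, actQ a q ∈ S ↔ q ∉ R) := fun n1 n2 =>
    ⟨⟨(2, 0), show _ + _ = _ by decide⟩, key _ (by decide) (by
      by_cases p : P1
      · left
        refine ⟨fun q e => (h1 q e).2 p, fun q e => ?_⟩
        rcases phi_cases q with c | c | c
        · exact absurd c e
        · rw [h2 q c]; tauto
        · rw [h3 q c]; tauto
      · right
        refine ⟨fun q e => by rw [h1 q e]; exact p, fun q e => ?_⟩
        rcases phi_cases q with c | c | c
        · exact absurd c e
        · rw [h2 q c]; tauto
        · rw [h3 q c]; tauto)⟩
  have A2 : ¬ (P1 ↔ P2) → (P1 ↔ P3) → ∃ a : Mtwo, (∀ q, actQ a q ∈ S ↔ q ∈ R) ∨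
      (∀ q, actQ a q ∈ S ↔ q ∉ R) := fun n1 n2 =>
    ⟨⟨(0, 2), show _ + _ = _ by decide⟩, key _ (by decide) (by
      by_cases p : P2
      · left
        refine ⟨fun q e => (h2 q e).2 p, fun q e => ?_⟩
        rcases phi_cases q with c | c | c
        · rw [h1 q c]; tauto
        · exact absurd c e
        · rw [h3 q c]; tauto
      · right
        refine ⟨fun q e => by rw [h2 q e]; exact p, fun q e => ?_⟩
        rcases phi_cases q with c | c | c
        · rw [h1 q c]; tauto
        · exact absurd c e
        · rw [h3 q c]; tauto)⟩
  have A3 : (P1 ↔ P2) → ¬ (P1 ↔ P3) → ∃ a : Mtwo, (∀ q, actQ a q ∈ S ↔ q ∈ R) ∨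
      (∀ q, actQ a q ∈ S ↔ q ∉ R) := fun n1 n2 =>
    ⟨⟨(2, 2), show _ + _ = _ by decide⟩, key _ (by decide) (by
      by_cases p : P3
      · left
        refine ⟨fun q e => (h3 q e).2 p, fun q e => ?_⟩
        rcases phi_cases q with c | c | c
        · rw [h1 q c]; tauto
        · rw [h2 q c]; tauto
        · exact absurd c e
      · right
        refine ⟨fun q e => by rw [h3 q e]; exact p, fun q e => ?_⟩
        rcases phi_cases q with c | c | c
        · rw [h1 q c]; tauto
        · rw [h2 q c]; tauto
        · exact absurd c e)⟩
  have A0 : (P1 ↔ P2) → (P1 ↔ P3) → ∃ a : Mtwo, (∀ q, actQ a q ∈ S ↔ q ∈ R) ∨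
      (∀ q, actQ a q ∈ S ↔ q ∉ R) := by
    intro n1 n2
    refine ⟨0, ?_⟩
    simp only [act_zero]
    by_cases p : P1
    · left
      intro q
      rcases phi_cases q with c | c | c
      · rw [h1 q c]; tauto
      · rw [h2 q c]; tauto
      · rw [h3 q c]; tauto
    · right
      intro q
      have : ¬ (q ∈ S ↔ q ∈ R) := by
        rcases phi_cases q with c | c | c
        · rw [h1 q c]; tauto
        · rw [h2 q c]; tauto
        · rw [h3 q c]; tauto
      tauto
  by_cases n1 : (P1 ↔ P2)
  · by_cases n2 : (P1 ↔ P3)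
    · exact A0 n1 n2
    · exact A3 n1 n2
  · by_cases n2 : (P1 ↔ P3)
    · exact A2 n1 n2
    · exact A1 n1 (iff_of_not_iff n1 n2)

theorem image_pair (a : Mtwo) (S : Set Qneg) :
    (Set.image (actQ a)) '' {S, Sᶜ} = {actQ a '' S, (actQ a '' S)ᶜ} := by
  rw [Set.image_pair, Set.image_compl_eq (actQ a).bijective]

/-- for `a ∈ M[2]`, translation `x ↦ x + a` preserves `M*` and descends to a
permutation of `Q` commuting with `φ`; it carries sections to sections and induces an action
of `M[2]` on the `4`-element set `T`, and this action is transitive. -/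
theorem translation_action_on_T :
    (∀ (a : Mtwo) (x : Mstar), ((x : Mfour) + (a : Mfour)) ∈ MstarSet) ∧
    ∃ act : Mtwo → Equiv.Perm Qneg,
      (∀ (a : Mtwo) (x : Mstar) (h : ((x : Mfour) + (a : Mfour)) ∈ MstarSet),
        act a ⟦x⟧ = ⟦(⟨(x : Mfour) + (a : Mfour), h⟩ : Mstar)⟧) ∧
      (∀ (a : Mtwo) (q : Qneg), phiQ (act a q) = phiQ q) ∧
      (∀ (a : Mtwo) (S : Set Qneg), IsSection S → IsSection (act a '' S)) ∧
      (∀ a b : Mtwo, act (a + b) = (act a).trans (act b)) ∧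
      (∀ (a : Mtwo), ∀ t ∈ TSet, (Set.image (act a)) '' t ∈ TSet) ∧
      (∀ t₁ ∈ TSet, ∀ t₂ ∈ TSet, ∃ a : Mtwo, (Set.image (act a)) '' t₁ = t₂) := by
  refine ⟨add_mem_Mstar, actQ, fun a x h => rfl, phi_act, section_image, ?_, ?_, ?_⟩
  · intro a b
    ext q
    exact trQ_add a b q
  · rintro a t ⟨S, hS, rfl⟩
    exact ⟨_, section_image a S hS, image_pair a S⟩
  · rintro _ ⟨S, hS, rfl⟩ _ ⟨R, hR, rfl⟩
    obtain ⟨a, h | h⟩ := exists_act S R hS hR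
    · refine ⟨a, ?_⟩
      have : actQ a '' S = R := by
        ext q; rw [mem_image_act]; exact h q
      rw [image_pair, this]
    · refine ⟨a, ?_⟩
      have : actQ a '' S = Rᶜ := by
        ext q; rw [mem_image_act]; exact h q
      rw [image_pair, this, compl_compl, Set.pair_comm]
end
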